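/- arXiv:2007.04918 — 3 statements merged into one kernel-verified Lean document; each statement's English description precedes it below -/
import Mathlib

section
/- Fix r with 1/3 < r < 3 and b with 0 < b < 2/(3+r). Let u be an admissible smooth solution of the 2D Zakharov–Kuznetsov equation on [2,∞) with sup_{t≥2} ‖u(t,·)‖_{L²(ℝ²)} < ∞. For t ≥ 2 set Ω(t) = {(x,y) ∈ ℝ² : |x| < t^b and |y| < t^{b r}}. Then liminf_{t→∞} ∫_{Ω(t)} u(t,x,y)² dx dy = 0. -/
open MeasureTheory Filter

noncomputable section

/-- Partial derivative in time of a function `u(t,x,y)`. -/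
def pt2 (u : ℝ → ℝ → ℝ → ℝ) : ℝ → ℝ → ℝ → ℝ := fun t x y => deriv (fun s => u s x y) t

/-- Partial derivative in the first space variable of a function `u(t,x,y)`. -/
def px2 (u : ℝ → ℝ → ℝ → ℝ) : ℝ → ℝ → ℝ → ℝ := fun t x y => deriv (fun a => u t a y) x

/-- Partial derivative in the second space variable of a function `u(t,x,y)`. -/
def py2 (u : ℝ → ℝ → ℝ → ℝ) : ℝ → ℝ → ℝ → ℝ := fun t x y => deriv (fun c => u t x c) y

/-- Iterated partial derivatives of `u(t,x,y)`, indexed by a list of directions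
(`0` = t, `1` = x, `2` = y). -/
def D2 (u : ℝ → ℝ → ℝ → ℝ) : List (Fin 3) → (ℝ → ℝ → ℝ → ℝ)
  | [] => u
  | i :: l => if i = 0 then pt2 (D2 u l) else if i = 1 then px2 (D2 u l) else py2 (D2 u l)

/-- An admissible smooth solution of the 2D Zakharov–Kuznetsov equation
`∂ₜu + ∂ₓ(∂ₓ²u + ∂ᵧ²u) + u ∂ₓu = 0` on `[2,∞)`: it is `C^∞`, solves the equation
pointwise for `t ≥ 2`, and all iterated partial derivatives decay in space faster
than any polynomial, locally uniformly in time. -/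
structure IsAdmissibleZK2 (u : ℝ → ℝ → ℝ → ℝ) : Prop where
  smooth : ContDiff ℝ (⊤ : ℕ∞) (fun p : ℝ × ℝ × ℝ => u p.1 p.2.1 p.2.2)
  eqn : ∀ t x y : ℝ, 2 ≤ t →
    pt2 u t x y
      + px2 (fun t' x' y' => px2 (px2 u) t' x' y' + py2 (py2 u) t' x' y') t x y
      + u t x y * px2 u t x y = 0
  decay : ∀ (l : List (Fin 3)) (N : ℕ) (a b : ℝ), 2 ≤ a →
    ∃ C : ℝ, ∀ t x y : ℝ, t ∈ Set.Icc a b →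
      (1 + |x| + |y|) ^ N * |D2 u l t x y| ≤ C

/-- Joint smoothness of a function `u(t,x,y)`. -/
def SmoothField (u : ℝ → ℝ → ℝ → ℝ) : Prop :=
  ContDiff ℝ (⊤ : ℕ∞) (fun p : ℝ × ℝ × ℝ => u p.1 p.2.1 p.2.2)

namespace SmoothField

variable {u v : ℝ → ℝ → ℝ → ℝ}

lemma hasDerivAt_comp (hu : SmoothField u) (c : ℝ → ℝ × ℝ × ℝ) (w : ℝ × ℝ × ℝ) (s : ℝ)
    (hc : HasDerivAt c w s) :
    HasDerivAt (fun s => u (c s).1 (c s).2.1 (c s).2.2)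
      (fderiv ℝ (fun p : ℝ × ℝ × ℝ => u p.1 p.2.1 p.2.2) (c s) w) s :=
  ((hu.differentiable (by simp)) (c s)).hasFDerivAt.comp_hasDerivAt s hc

lemma hasDerivAt_t (hu : SmoothField u) (t x y : ℝ) :
    HasDerivAt (fun s => u s x y) (pt2 u t x y) t :=
  (hu.hasDerivAt_comp (fun s => (s, x, y)) (1, 0, 0) t
    ((hasDerivAt_id t).prodMk (hasDerivAt_const t (x, y)))).differentiableAt.hasDerivAt

lemma hasDerivAt_x (hu : SmoothField u) (t x y : ℝ) :
    HasDerivAt (fun s => u t s y) (px2 u t x y) x :=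
  (hu.hasDerivAt_comp (fun s => (t, s, y)) (0, 1, 0) x
    ((hasDerivAt_const x t).prodMk ((hasDerivAt_id x).prodMk
      (hasDerivAt_const x y)))).differentiableAt.hasDerivAt

lemma hasDerivAt_y (hu : SmoothField u) (t x y : ℝ) :
    HasDerivAt (fun s => u t x s) (py2 u t x y) y :=
  (hu.hasDerivAt_comp (fun s => (t, x, s)) (0, 0, 1) y
    ((hasDerivAt_const y t).prodMk ((hasDerivAt_const y x).prodMk
      (hasDerivAt_id y)))).differentiableAt.hasDerivAt

lemma contDiff_fderiv_apply (hu : SmoothField u) (w : ℝ × ℝ × ℝ) :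
    ContDiff ℝ (⊤ : ℕ∞)
      (fun p => fderiv ℝ (fun p : ℝ × ℝ × ℝ => u p.1 p.2.1 p.2.2) p w) :=
  (ContDiff.fderiv_right (m := (⊤ : ℕ∞)) hu (by simp)).clm_apply contDiff_const

lemma pt2 (hu : SmoothField u) : SmoothField (pt2 u) := by
  have h := hu.contDiff_fderiv_apply (1, 0, 0)
  refine (congrArg (ContDiff ℝ _) (funext fun p => ?_)).mpr h
  exact (hu.hasDerivAt_comp (fun s => (s, p.2.1, p.2.2)) (1, 0, 0) p.1
    ((hasDerivAt_id _).prodMk (hasDerivAt_const _ _))).deriv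

lemma px2 (hu : SmoothField u) : SmoothField (px2 u) := by
  have h := hu.contDiff_fderiv_apply (0, 1, 0)
  refine (congrArg (ContDiff ℝ _) (funext fun p => ?_)).mpr h
  exact (hu.hasDerivAt_comp (fun s => (p.1, s, p.2.2)) (0, 1, 0) p.2.1
    ((hasDerivAt_const _ _).prodMk ((hasDerivAt_id _).prodMk (hasDerivAt_const _ _)))).deriv

lemma py2 (hu : SmoothField u) : SmoothField (py2 u) := by
  have h := hu.contDiff_fderiv_apply (0, 0, 1)
  refine (congrArg (ContDiff ℝ _) (funext fun p => ?_)).mpr h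
  exact (hu.hasDerivAt_comp (fun s => (p.1, p.2.1, s)) (0, 0, 1) p.2.2
    ((hasDerivAt_const _ _).prodMk ((hasDerivAt_const _ _).prodMk (hasDerivAt_id _)))).deriv

lemma add (hu : SmoothField u) (hv : SmoothField v) :
    SmoothField (fun t x y => u t x y + v t x y) :=
  ContDiff.add hu hv

lemma continuous (hu : SmoothField u) :
    Continuous (fun p : ℝ × ℝ × ℝ => u p.1 p.2.1 p.2.2) :=
  ContDiff.continuous hu

lemma continuous_slice (hu : SmoothField u) (t : ℝ) :
    Continuous (fun p : ℝ × ℝ => u t p.1 p.2) :=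
  hu.continuous.comp (continuous_const.prodMk continuous_id)

end SmoothField

/-- Smooth compactly supported functions of one real variable. -/
structure IsTestFun (a : ℝ → ℝ) : Prop where
  contDiff : ContDiff ℝ (⊤ : ℕ∞) a
  hasCompactSupport : HasCompactSupport a

namespace IsTestFun

variable {a : ℝ → ℝ}

lemma continuous (ha : IsTestFun a) : Continuous a := ha.contDiff.continuous

lemma hasDerivAt (ha : IsTestFun a) (s : ℝ) : HasDerivAt a (deriv a s) s :=
  (ha.contDiff.differentiable (by simp) s).hasDerivAt

lemma deriv (ha : IsTestFun a) : IsTestFun (deriv a) :=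
  ⟨by simpa using ha.contDiff.iterate_deriv 1, ha.hasCompactSupport.deriv⟩

lemma id_mul (ha : IsTestFun a) : IsTestFun (fun s => s * a s) :=
  ⟨contDiff_id.mul ha.contDiff, ha.hasCompactSupport.mul_left⟩

lemma exists_eq_zero (ha : IsTestFun a) : ∃ R : ℝ, 0 < R ∧ ∀ s, R < |s| → a s = 0 := by
  obtain ⟨R, hR⟩ := ha.hasCompactSupport.isBounded.subset_closedBall (0 : ℝ)
  refine ⟨max R 1, by positivity, fun s hs => ?_⟩
  by_contra h
  have := hR (subset_tsupport a h)
  rw [mem_closedBall_zero_iff, Real.norm_eq_abs] at this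
  exact absurd ((le_max_left R 1).trans_lt hs) this.not_gt

end IsTestFun

/-- The tensor product of `a` and `c`, with the two variables dilated by `α` and `γ`. -/
def tensorDilate (a c : ℝ → ℝ) (α γ : ℝ) (p : ℝ × ℝ) : ℝ := a (α * p.1) * c (γ * p.2)

section TensorDilate

variable {a c : ℝ → ℝ} {α γ : ℝ}

lemma continuous_tensorDilate (ha : IsTestFun a) (hc : IsTestFun c) :
    Continuous (tensorDilate a c α γ) :=
  (ha.continuous.comp (continuous_const.mul continuous_fst)).mul
    (hc.continuous.comp (continuous_const.mul continuous_snd))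

lemma tensorDilate_eq_zero {R A : ℝ} (ha : ∀ s, R < |s| → a s = 0) (hc : ∀ s, R < |s| → c s = 0)
    (hα : 0 < α) (hγ : 0 < γ) (hA : R ≤ α * A) (hA' : R ≤ γ * A) {p : ℝ × ℝ}
    (hp : p ∉ Metric.closedBall (0 : ℝ × ℝ) A) : tensorDilate a c α γ p = 0 := by
  rw [mem_closedBall_zero_iff, Prod.norm_def, sup_le_iff, not_and_or, not_le, not_le,
    Real.norm_eq_abs, Real.norm_eq_abs] at hp
  rcases hp with hp | hp
  · have : a (α * p.1) = 0 := ha _ (by rw [abs_mul, abs_of_pos hα]; nlinarith)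
    simp [tensorDilate, this]
  · have : c (γ * p.2) = 0 := hc _ (by rw [abs_mul, abs_of_pos hγ]; nlinarith)
    simp [tensorDilate, this]

lemma hasCompactSupport_tensorDilate (ha : IsTestFun a) (hc : IsTestFun c)
    (hα : 0 < α) (hγ : 0 < γ) : HasCompactSupport (tensorDilate a c α γ) := by
  obtain ⟨R, hR, hRa⟩ := ha.exists_eq_zero
  obtain ⟨S, hS, hSc⟩ := hc.exists_eq_zero
  refine HasCompactSupport.intro
    (isCompact_closedBall (0 : ℝ × ℝ) (max R S / min α γ)) fun p hp => ?_
  have hm : 0 < min α γ := lt_min hα hγ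
  have hM : 0 < max R S := lt_max_of_lt_left hR
  refine tensorDilate_eq_zero (R := max R S) (fun s hs => hRa s ((le_max_left _ _).trans_lt hs))
    (fun s hs => hSc s ((le_max_right _ _).trans_lt hs)) hα hγ ?_ ?_ hp
  · rw [mul_div_assoc', le_div_iff₀ hm, mul_comm]
    exact mul_le_mul_of_nonneg_right (min_le_left _ _) hM.le
  · rw [mul_div_assoc', le_div_iff₀ hm, mul_comm]
    exact mul_le_mul_of_nonneg_right (min_le_right _ _) hM.le

lemma integrable_mul_tensorDilate {w : ℝ × ℝ → ℝ} (hw : Continuous w)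
    (ha : IsTestFun a) (hc : IsTestFun c) (hα : 0 < α) (hγ : 0 < γ) :
    Integrable (fun p => w p * tensorDilate a c α γ p) :=
  (hw.mul (continuous_tensorDilate ha hc)).integrable_of_hasCompactSupport
    (hasCompactSupport_tensorDilate ha hc hα hγ).mul_left

lemma integral_tensorDilate_sq (hα : 0 < α) (hγ : 0 < γ) :
    ∫ p, tensorDilate a c α γ p ^ 2 = (α * γ)⁻¹ * ((∫ s, a s ^ 2) * ∫ s, c s ^ 2) := by
  have h := integral_prod_mul (μ := (volume : Measure ℝ)) (ν := (volume : Measure ℝ))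
    (fun x => a (α * x) ^ 2) (fun y => c (γ * y) ^ 2)
  rw [Measure.integral_comp_mul_left (fun s => a s ^ 2),
    Measure.integral_comp_mul_left (fun s => c s ^ 2), abs_of_pos (inv_pos.2 hα),
    abs_of_pos (inv_pos.2 hγ)] at h
  simp only [tensorDilate, mul_pow]
  refine h.trans ?_
  simp only [smul_eq_mul]
  rw [mul_inv]
  ring

/-- A weighted Cauchy–Schwarz bound for the pairing with a dilated tensor product. -/
lemma abs_integral_mul_tensorDilate_le {w : ℝ × ℝ → ℝ} {C κ : ℝ} (hw : Continuous w)
    (hw2 : Integrable fun p => w p ^ 2) (hC : ∫ p, w p ^ 2 ≤ C)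
    (ha : IsTestFun a) (hc : IsTestFun c) (hα : 0 < α) (hγ : 0 < γ) (hκ : 0 < κ)
    (hκ2 : κ ^ 2 * (α * γ) = 1) :
    |∫ p, w p * tensorDilate a c α γ p| ≤ (C + (∫ s, a s ^ 2) * ∫ s, c s ^ 2) * κ := by
  have hT2 : Integrable fun p => tensorDilate a c α γ p ^ 2 := by
    simpa [sq] using integrable_mul_tensorDilate (α := α) (γ := γ)
      (continuous_tensorDilate ha hc) ha hc hα hγ
  have hαγ : (α * γ)⁻¹ = κ ^ 2 := by
    rw [inv_eq_iff_eq_inv, eq_comm, inv_eq_of_mul_eq_one_right hκ2]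
  calc |∫ p, w p * tensorDilate a c α γ p|
      ≤ ∫ p, |w p * tensorDilate a c α γ p| := abs_integral_le_integral_abs
    _ ≤ ∫ p, (κ * w p ^ 2 + κ⁻¹ * tensorDilate a c α γ p ^ 2) := by
        refine integral_mono (integrable_mul_tensorDilate hw ha hc hα hγ).abs
          ((hw2.const_mul _).add (hT2.const_mul _)) fun p => ?_
        set s := w p
        set q := tensorDilate a c α γ p
        have h1 : κ * s ^ 2 + κ⁻¹ * q ^ 2 - 2 * (|s| * |q|) = κ * (|s| - κ⁻¹ * |q|) ^ 2 := by
          rw [sub_sq, mul_pow, sq_abs, sq_abs]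
          field_simp
          ring
        have h2 : 0 ≤ κ * (|s| - κ⁻¹ * |q|) ^ 2 := by positivity
        have h3 : 0 ≤ |s| * |q| := by positivity
        simp only [abs_mul]
        linarith
    _ = κ * (∫ p, w p ^ 2) + κ⁻¹ * ∫ p, tensorDilate a c α γ p ^ 2 := by
        rw [integral_add (hw2.const_mul _) (hT2.const_mul _), integral_const_mul,
          integral_const_mul]
    _ ≤ (C + (∫ s, a s ^ 2) * ∫ s, c s ^ 2) * κ := by
        rw [integral_tensorDilate_sq hα hγ, hαγ]
        have : κ⁻¹ * (κ ^ 2 * ((∫ s, a s ^ 2) * ∫ s, c s ^ 2))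
            = κ * ((∫ s, a s ^ 2) * ∫ s, c s ^ 2) := by
          field_simp
        rw [this]
        nlinarith

lemma integral_px2_mul_tensorDilate {v : ℝ → ℝ → ℝ → ℝ} (hv : SmoothField v)
    (ha : IsTestFun a) (hc : IsTestFun c) (hα : 0 < α) (hγ : 0 < γ) (t : ℝ) :
    ∫ p : ℝ × ℝ, px2 v t p.1 p.2 * tensorDilate a c α γ p
      = -(α * ∫ p : ℝ × ℝ, v t p.1 p.2 * tensorDilate (deriv a) c α γ p) := by
  have key := integral_bilinear_hasLineDerivAt_right_eq_neg_left_of_integrable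
    (μ := (volume : Measure (ℝ × ℝ))) (B := ContinuousLinearMap.mul ℝ ℝ) (v := ((1, 0) : ℝ × ℝ))
    (f := fun p => v t p.1 p.2) (f' := fun p => px2 v t p.1 p.2)
    (g := tensorDilate a c α γ) (g' := fun p => α * tensorDilate (deriv a) c α γ p)
    (integrable_mul_tensorDilate (hv.px2.continuous_slice t) ha hc hα hγ)
    (by
      refine ((integrable_mul_tensorDilate (hv.continuous_slice t) ha.deriv hc hα hγ).const_mul
        α).congr (Eventually.of_forall fun p => ?_)
      simp only [ContinuousLinearMap.mul_apply']
      ring)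
    (integrable_mul_tensorDilate (hv.continuous_slice t) ha hc hα hγ)
    (fun p _ => by
      have h := hv.hasDerivAt_x t p.1 p.2
      have h' := HasDerivAt.comp_const_add p.1 0 (by simpa using h)
      simpa [HasLineDerivAt] using h')
    (fun p _ => by
      have h := ((ha.hasDerivAt (α * p.1)).comp p.1
        ((hasDerivAt_id p.1).const_mul α)).mul_const (c (γ * p.2))
      have h' := HasDerivAt.comp_const_add p.1 0 (by simpa using h)
      simp only [HasLineDerivAt, tensorDilate]
      convert h' using 1
      · simp
      · ring)
  simp only [ContinuousLinearMap.mul_apply'] at key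
  rw [← integral_const_mul, eq_neg_iff_add_eq_zero, add_comm, ← eq_neg_iff_add_eq_zero, ← key]
  congr 1; ext p; ring

lemma integral_py2_mul_tensorDilate {v : ℝ → ℝ → ℝ → ℝ} (hv : SmoothField v)
    (ha : IsTestFun a) (hc : IsTestFun c) (hα : 0 < α) (hγ : 0 < γ) (t : ℝ) :
    ∫ p : ℝ × ℝ, py2 v t p.1 p.2 * tensorDilate a c α γ p
      = -(γ * ∫ p : ℝ × ℝ, v t p.1 p.2 * tensorDilate a (deriv c) α γ p) := by
  have key := integral_bilinear_hasLineDerivAt_right_eq_neg_left_of_integrable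
    (μ := (volume : Measure (ℝ × ℝ))) (B := ContinuousLinearMap.mul ℝ ℝ) (v := ((0, 1) : ℝ × ℝ))
    (f := fun p => v t p.1 p.2) (f' := fun p => py2 v t p.1 p.2)
    (g := tensorDilate a c α γ) (g' := fun p => γ * tensorDilate a (deriv c) α γ p)
    (integrable_mul_tensorDilate (hv.py2.continuous_slice t) ha hc hα hγ)
    (by
      refine ((integrable_mul_tensorDilate (hv.continuous_slice t) ha hc.deriv hα hγ).const_mul
        γ).congr (Eventually.of_forall fun p => ?_)
      simp only [ContinuousLinearMap.mul_apply']
      ring)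
    (integrable_mul_tensorDilate (hv.continuous_slice t) ha hc hα hγ)
    (fun p _ => by
      have h := hv.hasDerivAt_y t p.1 p.2
      have h' := HasDerivAt.comp_const_add p.2 0 (by simpa using h)
      simpa [HasLineDerivAt] using h')
    (fun p _ => by
      have h := ((hc.hasDerivAt (γ * p.2)).comp p.2
        ((hasDerivAt_id p.2).const_mul γ)).const_mul (a (α * p.1))
      have h' := HasDerivAt.comp_const_add p.2 0 (by simpa using h)
      simp only [HasLineDerivAt, tensorDilate]
      convert h' using 1
      · simp
      · ring)
  simp only [ContinuousLinearMap.mul_apply'] at key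
  rw [← integral_const_mul, eq_neg_iff_add_eq_zero, add_comm, ← eq_neg_iff_add_eq_zero, ← key]
  congr 1; ext p; ring

end TensorDilate

/-- The momentum-type virial identity at a fixed time. -/
lemma IsAdmissibleZK2.integral_pt2_mul_tensorDilate {u : ℝ → ℝ → ℝ → ℝ} (hu : IsAdmissibleZK2 u)
    {f g : ℝ → ℝ} (hf : IsTestFun f) (hg : IsTestFun g) {α γ t : ℝ} (hα : 0 < α) (hγ : 0 < γ)
    (ht : 2 ≤ t) :
    ∫ p : ℝ × ℝ, pt2 u t p.1 p.2 * tensorDilate f g α γ p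
      = α ^ 3 * (∫ p : ℝ × ℝ, u t p.1 p.2
            * tensorDilate (deriv (deriv (deriv f))) g α γ p)
        + α * γ ^ 2 * (∫ p : ℝ × ℝ, u t p.1 p.2
            * tensorDilate (deriv f) (deriv (deriv g)) α γ p)
        + α / 2 * ∫ p : ℝ × ℝ, u t p.1 p.2 ^ 2 * tensorDilate (deriv f) g α γ p := by
  have hs : SmoothField u := hu.smooth
  have hV := hs.px2.px2.add hs.py2.py2
  have hQ : SmoothField (fun t x y => u t x y ^ 2) := ContDiff.pow hu.smooth 2
  have hQx : ∀ x y, px2 (fun t x y => u t x y ^ 2) t x y = 2 * (u t x y * px2 u t x y) := by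
    intro x y
    have := ((hs.hasDerivAt_x t x y).pow 2).deriv
    simp only [px2] at this ⊢
    refine Eq.trans this ?_
    simp
    ring
  have e1 : ∫ p : ℝ × ℝ, pt2 u t p.1 p.2 * tensorDilate f g α γ p
      = -(∫ p : ℝ × ℝ, px2 (fun t x y => px2 (px2 u) t x y + py2 (py2 u) t x y) t p.1 p.2
            * tensorDilate f g α γ p)
        - (1 / 2) * ∫ p : ℝ × ℝ, px2 (fun t x y => u t x y ^ 2) t p.1 p.2
            * tensorDilate f g α γ p := by
    have i1 := integrable_mul_tensorDilate (hV.px2.continuous_slice t) hf hg hα hγ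
    have i2 := integrable_mul_tensorDilate (hQ.px2.continuous_slice t) hf hg hα hγ
    rw [← integral_neg, ← integral_const_mul]
    refine Eq.trans ?_ (integral_sub i1.neg (i2.const_mul _))
    refine integral_congr_ae (Eventually.of_forall fun p => ?_)
    have := hu.eqn t p.1 p.2 ht
    simp only [hQx]
    linear_combination tensorDilate f g α γ p * this
  have e2 : ∫ p : ℝ × ℝ, (px2 (px2 u) t p.1 p.2 + py2 (py2 u) t p.1 p.2)
          * tensorDilate (deriv f) g α γ p
      = α ^ 2 * (∫ p : ℝ × ℝ, u t p.1 p.2 * tensorDilate (deriv (deriv (deriv f))) g α γ p)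
        + γ ^ 2 * ∫ p : ℝ × ℝ, u t p.1 p.2
            * tensorDilate (deriv f) (deriv (deriv g)) α γ p := by
    simp only [add_mul]
    rw [integral_add
      (integrable_mul_tensorDilate (hs.px2.px2.continuous_slice t) hf.deriv hg hα hγ)
      (integrable_mul_tensorDilate (hs.py2.py2.continuous_slice t) hf.deriv hg hα hγ),
      integral_px2_mul_tensorDilate hs.px2 hf.deriv hg hα hγ,
      integral_px2_mul_tensorDilate hs hf.deriv.deriv hg hα hγ,
      integral_py2_mul_tensorDilate hs.py2 hf.deriv hg hα hγ,
      integral_py2_mul_tensorDilate hs hf.deriv hg.deriv hα hγ]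
    ring
  rw [e1, integral_px2_mul_tensorDilate hV hf hg hα hγ,
    integral_px2_mul_tensorDilate hQ hf hg hα hγ, e2]
  ring

lemma continuousOn_tensorDilate_rpow {a c : ℝ → ℝ} (ha : IsTestFun a) (hc : IsTestFun c)
    (b d : ℝ) :
    ContinuousOn (fun q : ℝ × ℝ × ℝ => tensorDilate a c (q.1 ^ (-b)) (q.1 ^ (-d)) q.2)
      (Set.Ioi 0 ×ˢ Set.univ) := by
  have h (e : ℝ) : ContinuousOn (fun q : ℝ × ℝ × ℝ => q.1 ^ e) (Set.Ioi 0 ×ˢ Set.univ) :=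
    continuousOn_fst.rpow_const fun q hq => Or.inl (ne_of_gt hq.1)
  exact (ha.continuous.comp_continuousOn
      ((h (-b)).mul (continuous_fst.comp continuous_snd).continuousOn)).mul
    (hc.continuous.comp_continuousOn
      ((h (-d)).mul (continuous_snd.comp continuous_snd).continuousOn))

lemma hasDerivAt_tensorDilate_rpow {f g : ℝ → ℝ} (hf : IsTestFun f) (hg : IsTestFun g)
    (b d : ℝ) {t : ℝ} (ht : 0 < t) (p : ℝ × ℝ) :
    HasDerivAt (fun t : ℝ => tensorDilate f g (t ^ (-b)) (t ^ (-d)) p)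
      (-(b / t) * tensorDilate (fun s => s * deriv f s) g (t ^ (-b)) (t ^ (-d)) p
        - d / t * tensorDilate f (fun s => s * deriv g s) (t ^ (-b)) (t ^ (-d)) p) t := by
  have hp (e z : ℝ) : HasDerivAt (fun t : ℝ => t ^ (-e) * z) (-e * (t ^ (-e) / t) * z) t := by
    have := (Real.hasDerivAt_rpow_const (p := -e) (Or.inl ht.ne')).mul_const z
    rwa [Real.rpow_sub_one ht.ne'] at this
  have h := ((hf.hasDerivAt _).comp t (hp b p.1)).mul ((hg.hasDerivAt _).comp t (hp d p.2))
  refine h.congr_deriv ?_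
  simp only [tensorDilate, Function.comp_apply]
  ring

/-- Differentiation of the localized mean `∫ u W` when the spatial scales are powers of time. -/
lemma SmoothField.hasDerivAt_integral_mul_tensorDilate {u : ℝ → ℝ → ℝ → ℝ} (hu : SmoothField u)
    {f g : ℝ → ℝ} (hf : IsTestFun f) (hg : IsTestFun g) {b d : ℝ} (hb : 0 < b) (hd : 0 < d)
    {t : ℝ} (ht : 0 < t) :
    HasDerivAt (fun t : ℝ => ∫ p : ℝ × ℝ, u t p.1 p.2 * tensorDilate f g (t ^ (-b)) (t ^ (-d)) p)
      ((∫ p : ℝ × ℝ, _root_.pt2 u t p.1 p.2 * tensorDilate f g (t ^ (-b)) (t ^ (-d)) p)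
        - b / t * (∫ p : ℝ × ℝ, u t p.1 p.2
            * tensorDilate (fun s => s * deriv f s) g (t ^ (-b)) (t ^ (-d)) p)
        - d / t * ∫ p : ℝ × ℝ, u t p.1 p.2
            * tensorDilate f (fun s => s * deriv g s) (t ^ (-b)) (t ^ (-d)) p) t := by
  obtain ⟨R, hR, hRf⟩ := hf.exists_eq_zero
  obtain ⟨S, hS, hSg⟩ := hg.exists_eq_zero
  have hf1 := hf.deriv.id_mul
  have hg1 := hg.deriv.id_mul
  obtain ⟨R', hR', hRf'⟩ := hf1.exists_eq_zero
  obtain ⟨S', hS', hSg'⟩ := hg1.exists_eq_zero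
  set M := max (max R S) (max R' S') with hM
  have hMpos : 0 < M := lt_max_of_lt_left (lt_max_of_lt_left hR)
  have hA : ∀ s ∈ Set.Icc (t / 2) (2 * t), ∀ e, 0 < e → (e = b ∨ e = d) →
      M ≤ s ^ (-e) * (M * max ((2 * t) ^ b) ((2 * t) ^ d)) := by
    intro s hs e he hebd
    have hs0 : 0 < s := by linarith [hs.1]
    have h1 : s ^ e ≤ max ((2 * t) ^ b) ((2 * t) ^ d) := by
      refine (Real.rpow_le_rpow hs0.le hs.2 he.le).trans ?_
      rcases hebd with rfl | rfl
      · exact le_max_left _ _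
      · exact le_max_right _ _
    rw [Real.rpow_neg hs0.le, ← div_eq_inv_mul, le_div_iff₀ (Real.rpow_pos_of_pos hs0 e)]
    exact mul_le_mul_of_nonneg_left h1 hMpos.le
  set A := M * max ((2 * t) ^ b) ((2 * t) ^ d)
  have hzero : ∀ s ∈ Set.Icc (t / 2) (2 * t), ∀ p ∉ Metric.closedBall (0 : ℝ × ℝ) A,
      tensorDilate f g (s ^ (-b)) (s ^ (-d)) p = 0
      ∧ tensorDilate (fun s => s * deriv f s) g (s ^ (-b)) (s ^ (-d)) p = 0
      ∧ tensorDilate f (fun s => s * deriv g s) (s ^ (-b)) (s ^ (-d)) p = 0 := by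
    intro s hs p hp
    have hs0 : 0 < s := by linarith [hs.1]
    have l1 : R ≤ M := (le_max_left _ _).trans (le_max_left _ _)
    have l2 : S ≤ M := (le_max_right _ _).trans (le_max_left _ _)
    have l3 : R' ≤ M := (le_max_left _ _).trans (le_max_right _ _)
    have l4 : S' ≤ M := (le_max_right _ _).trans (le_max_right _ _)
    refine ⟨?_, ?_, ?_⟩ <;>
      refine tensorDilate_eq_zero (R := M) ?_ ?_ (Real.rpow_pos_of_pos hs0 _)
        (Real.rpow_pos_of_pos hs0 _) (hA s hs b hb (Or.inl rfl)) (hA s hs d hd (Or.inr rfl)) hp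
    · exact fun z hz => hRf z (l1.trans_lt hz)
    · exact fun z hz => hSg z (l2.trans_lt hz)
    · exact fun z hz => hRf' z (l3.trans_lt hz)
    · exact fun z hz => hSg z (l2.trans_lt hz)
    · exact fun z hz => hRf z (l1.trans_lt hz)
    · exact fun z hz => hSg' z (l4.trans_lt hz)
  set H' : ℝ → ℝ × ℝ → ℝ := fun s p =>
    _root_.pt2 u s p.1 p.2 * tensorDilate f g (s ^ (-b)) (s ^ (-d)) p
      + u s p.1 p.2 * (-(b / s) * tensorDilate (fun s => s * deriv f s) g (s ^ (-b)) (s ^ (-d)) p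
        - d / s * tensorDilate f (fun s => s * deriv g s) (s ^ (-b)) (s ^ (-d)) p) with hH'
  have hcont : ContinuousOn (fun q : ℝ × ℝ × ℝ => H' q.1 q.2) (Set.Ioi 0 ×ˢ Set.univ) := by
    have hdiv (e : ℝ) : ContinuousOn (fun q : ℝ × ℝ × ℝ => e / q.1) (Set.Ioi 0 ×ˢ Set.univ) :=
      continuousOn_const.div continuousOn_fst fun q hq => ne_of_gt hq.1
    exact (hu.pt2.continuous.continuousOn.mul (continuousOn_tensorDilate_rpow hf hg b d)).add
      (hu.continuous.continuousOn.mul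
        (((hdiv b).neg.mul (continuousOn_tensorDilate_rpow hf1 hg b d)).sub
          ((hdiv d).mul (continuousOn_tensorDilate_rpow hf hg1 b d))))
  obtain ⟨B, hB⟩ := (isCompact_Icc.prod
      (isCompact_closedBall (0 : ℝ × ℝ) A)).exists_bound_of_continuousOn
    (hcont.mono (Set.prod_mono (s₁ := Set.Icc (t / 2) (2 * t))
      (fun s hs => lt_of_lt_of_le (half_pos ht) hs.1) (Set.subset_univ _)))
  have hα (e : ℝ) : 0 < t ^ e := Real.rpow_pos_of_pos ht e
  have i0 := integrable_mul_tensorDilate (hu.continuous_slice t) hf hg (hα (-b)) (hα (-d))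
  have i1 := integrable_mul_tensorDilate (hu.pt2.continuous_slice t) hf hg (hα (-b)) (hα (-d))
  have i2 := integrable_mul_tensorDilate (hu.continuous_slice t) hf1 hg (hα (-b)) (hα (-d))
  have i3 := integrable_mul_tensorDilate (hu.continuous_slice t) hf hg1 (hα (-b)) (hα (-d))
  have hmain := (hasDerivAt_integral_of_dominated_loc_of_deriv_le
    (μ := (volume : Measure (ℝ × ℝ)))
    (F := fun s p => u s p.1 p.2 * tensorDilate f g (s ^ (-b)) (s ^ (-d)) p) (F' := H')
    (bound := (Metric.closedBall (0 : ℝ × ℝ) A).indicator fun _ => B)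
    (Icc_mem_nhds (by linarith : t / 2 < t) (by linarith : t < 2 * t))
    (Eventually.of_forall fun s => ((hu.continuous_slice s).mul
      (continuous_tensorDilate hf hg)).aestronglyMeasurable) i0
    (by
      refine Continuous.aestronglyMeasurable ?_
      exact ((hu.pt2.continuous_slice t).mul (continuous_tensorDilate hf hg)).add
        ((hu.continuous_slice t).mul
          ((continuous_const.mul (continuous_tensorDilate hf1 hg)).sub
            (continuous_const.mul (continuous_tensorDilate hf hg1)))))
    (Eventually.of_forall fun p s hs => by
      by_cases hp : p ∈ Metric.closedBall (0 : ℝ × ℝ) A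
      · rw [Set.indicator_of_mem hp]
        exact hB (s, p) ⟨hs, hp⟩
      · obtain ⟨z1, z2, z3⟩ := hzero s hs p hp
        rw [Set.indicator_of_notMem hp]
        simp [hH', z1, z2, z3])
    ((integrable_indicator_iff measurableSet_closedBall).2
      (continuousOn_const.integrableOn_compact (isCompact_closedBall _ _)))
    (Eventually.of_forall fun p s hs => by
      have hs0 : 0 < s := by linarith [hs.1]
      exact (hu.hasDerivAt_t s p.1 p.2).mul (hasDerivAt_tensorDilate_rpow hf hg b d hs0 p))).2
  refine hmain.congr_deriv ?_
  rw [← integral_const_mul, ← integral_const_mul, ← integral_sub i1 (i2.const_mul _)]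
  refine Eq.trans ?_ (integral_sub (i1.sub (i2.const_mul _)) (i3.const_mul _))
  refine integral_congr_ae (Eventually.of_forall fun p => ?_)
  simp only [hH']
  ring

/-- There is a test function whose derivative is at least `1/2 - ε` on `(-1,1)` and at least
`-ε` everywhere. -/
lemma exists_isTestFun_deriv_ge {ε : ℝ} (hε : 0 < ε) :
    ∃ f : ℝ → ℝ, IsTestFun f ∧ (∀ s, -ε ≤ deriv f s) ∧ ∀ s, |s| < 1 → 1 / 2 - ε ≤ deriv f s := by
  let χ : ContDiffBump (0 : ℝ) := ⟨1, 2, one_pos, one_lt_two⟩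
  have hχ : IsTestFun χ := ⟨χ.contDiff, χ.hasCompactSupport⟩
  obtain ⟨M, hM⟩ := hχ.deriv.continuous.bounded_above_of_compact_support
    hχ.deriv.hasCompactSupport
  have hM0 : 0 ≤ M := (norm_nonneg _).trans (hM 0)
  set κ := min 1 (ε / (2 * (M + 1))) with hκdef
  have hκ : 0 < κ := lt_min one_pos (by positivity)
  have hκ1 : κ ≤ 1 := min_le_left _ _
  have hκε : κ * (2 * (M + 1)) ≤ ε := by
    rw [← le_div_iff₀ (by positivity)]
    exact min_le_right _ _
  have hder : ∀ s, HasDerivAt (fun s => Real.arctan s * χ (κ * s))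
      (1 / (1 + s ^ 2) * χ (κ * s) + Real.arctan s * (deriv χ (κ * s) * κ)) s := fun s => by
    refine (Real.hasDerivAt_arctan s).mul ?_
    have := (hχ.hasDerivAt (κ * s)).comp s ((hasDerivAt_id s).const_mul κ)
    rwa [mul_one] at this
  have herr : ∀ s, |Real.arctan s * (deriv χ (κ * s) * κ)| ≤ ε := fun s => by
    have h1 : |Real.arctan s| ≤ 2 := by
      rw [abs_le]
      constructor <;>
        linarith [Real.neg_pi_div_two_lt_arctan s, Real.arctan_lt_pi_div_two s, Real.pi_le_four]
    have h2 : |deriv χ (κ * s)| ≤ M := hM _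
    rw [abs_mul, abs_mul, abs_of_pos hκ]
    calc |Real.arctan s| * (|deriv χ (κ * s)| * κ) ≤ 2 * (M * κ) := by gcongr
      _ ≤ ε := by nlinarith
  refine ⟨fun s => Real.arctan s * χ (κ * s), ⟨?_, ?_⟩, fun s => ?_, fun s hs => ?_⟩
  · exact Real.contDiff_arctan.mul (χ.contDiff.comp (contDiff_const.mul contDiff_id))
  · refine HasCompactSupport.mul_left ?_
    exact χ.hasCompactSupport.comp_homeomorph (Homeomorph.mulLeft₀ κ hκ.ne')
  · rw [(hder s).deriv]
    have : 0 ≤ 1 / (1 + s ^ 2) * χ (κ * s) := mul_nonneg (by positivity) χ.nonneg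
    linarith [neg_le_of_abs_le (herr s)]
  · rw [(hder s).deriv]
    have h1 : χ (κ * s) = 1 := χ.one_of_mem_closedBall (by
      rw [mem_closedBall_zero_iff, Real.norm_eq_abs, abs_mul, abs_of_pos hκ]
      exact mul_le_one₀ hκ1 (abs_nonneg s) hs.le)
    have h2 : 1 / 2 ≤ 1 / (1 + s ^ 2) := by
      have : s ^ 2 < 1 := (sq_lt_one_iff_abs_lt_one s).2 hs
      exact one_div_le_one_div_of_le (by positivity) (by linarith)
    rw [h1, mul_one]
    linarith [neg_le_of_abs_le (herr s)]

/-- A function whose derivative is at least `m t ^ (-b)` cannot grow slower than `t ^ (1 - b)`. -/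
lemma not_abs_le_rpow_of_rpow_le_deriv {J J' : ℝ → ℝ} {T m b K β : ℝ} (hT : 0 < T) (hm : 0 < m)
    (hb : b < 1) (hβ : β < 1 - b) (hJ : ∀ t, T ≤ t → HasDerivAt J (J' t) t)
    (hJ' : ∀ t, T ≤ t → m * t ^ (-b) ≤ J' t) (hK : ∀ t, T ≤ t → |J t| ≤ K * t ^ β) : False := by
  have h1b : 0 < 1 - b := by linarith
  have hG : ∀ t, T ≤ t →
      HasDerivAt (fun t => J t - m / (1 - b) * t ^ (1 - b)) (J' t - m * t ^ (-b)) t := by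
    intro t ht
    have ht0 : 0 < t := hT.trans_le ht
    have := (hJ t ht).sub ((Real.hasDerivAt_rpow_const (p := 1 - b)
      (Or.inl ht0.ne')).const_mul (m / (1 - b)))
    refine this.congr_deriv ?_
    rw [show 1 - b - 1 = -b by ring]
    field_simp
  have hmono : MonotoneOn (fun t => J t - m / (1 - b) * t ^ (1 - b)) (Set.Ici T) := by
    refine monotoneOn_of_deriv_nonneg (convex_Ici T)
      (fun t ht => (hG t ht).continuousAt.continuousWithinAt)
      (fun t ht => (hG t (interior_subset ht)).differentiableAt.differentiableWithinAt)
      fun t ht => ?_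
    rw [(hG t (interior_subset ht)).deriv, sub_nonneg]
    exact hJ' t (interior_subset ht)
  set G0 := J T - m / (1 - b) * T ^ (1 - b)
  have hineq : ∀ᶠ t : ℝ in atTop,
      m / (1 - b) + G0 * t ^ (-(1 - b)) ≤ K * t ^ (-(1 - b - β)) := by
    filter_upwards [eventually_ge_atTop T] with t ht
    have ht0 : 0 < t := hT.trans_le ht
    have h1 : G0 ≤ J t - m / (1 - b) * t ^ (1 - b) := hmono Set.self_mem_Ici ht ht
    have h2 := (le_abs_self _).trans (hK t ht)
    have h3 : 0 < t ^ (-(1 - b)) := Real.rpow_pos_of_pos ht0 _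
    have h4 : t ^ (1 - b) * t ^ (-(1 - b)) = 1 := by
      rw [← Real.rpow_add ht0]; simp
    have h5 : t ^ β * t ^ (-(1 - b)) = t ^ (-(1 - b - β)) := by
      rw [← Real.rpow_add ht0]; ring_nf
    have h6 : (m / (1 - b) * t ^ (1 - b) + G0) * t ^ (-(1 - b)) ≤ K * t ^ β * t ^ (-(1 - b)) :=
      mul_le_mul_of_nonneg_right (by linarith) h3.le
    rw [← h5]
    linear_combination h6 - m / (1 - b) * h4
  have hl : Tendsto (fun t : ℝ => m / (1 - b) + G0 * t ^ (-(1 - b))) atTop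
      (nhds (m / (1 - b) + G0 * 0)) :=
    tendsto_const_nhds.add ((tendsto_rpow_neg_atTop h1b).const_mul _)
  have hr : Tendsto (fun t : ℝ => K * t ^ (-(1 - b - β))) atTop (nhds (K * 0)) :=
    (tendsto_rpow_neg_atTop (by linarith)).const_mul _
  have := le_of_tendsto_of_tendsto hl hr hineq
  have hpos : 0 < m / (1 - b) := by positivity
  linarith

lemma IsAdmissibleZK2.integrable_sq {u : ℝ → ℝ → ℝ → ℝ} (hu : IsAdmissibleZK2 u) {t : ℝ}
    (ht : 2 ≤ t) : Integrable fun p : ℝ × ℝ => u t p.1 p.2 ^ 2 := by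
  have hs : SmoothField u := hu.smooth
  obtain ⟨C, hC⟩ := hu.decay [] 2 t t ht
  have hI : Integrable fun p : ℝ × ℝ => C ^ 2 * ((1 + p.1 ^ 2)⁻¹ * (1 + p.2 ^ 2)⁻¹) :=
    (integrable_inv_one_add_sq.mul_prod integrable_inv_one_add_sq).const_mul _
  refine hI.mono' ((hs.continuous_slice t).pow 2).aestronglyMeasurable
    (Eventually.of_forall fun p => ?_)
  have h := hC t p.1 p.2 ⟨le_rfl, le_rfl⟩
  have h0 : 0 ≤ (1 + |p.1| + |p.2|) ^ 2 * |u t p.1 p.2| := by positivity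
  have h1 := pow_le_pow_left₀ h0 h 2
  rw [mul_pow, sq_abs] at h1
  have h2 : (1 + p.1 ^ 2) * (1 + p.2 ^ 2) ≤ ((1 + |p.1| + |p.2|) ^ 2) ^ 2 := by
    have a1 := abs_nonneg p.1
    have a2 := abs_nonneg p.2
    rw [sq ((1 + |p.1| + |p.2|) ^ 2), ← sq_abs p.1, ← sq_abs p.2]
    gcongr <;> nlinarith
  rw [Real.norm_of_nonneg (by positivity), ← mul_inv, ← div_eq_mul_inv,
    le_div_iff₀ (by positivity)]
  nlinarith [sq_nonneg (u t p.1 p.2)]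

/-- Lower bound for the quadratic term of the virial identity. -/
lemma le_integral_sq_mul_tensorDilate {w : ℝ × ℝ → ℝ} {h g : ℝ → ℝ} {C ε α γ : ℝ}
    (hw : Continuous w) (hw2 : Integrable fun p => w p ^ 2) (hC : ∫ p, w p ^ 2 ≤ C) (hε : 0 ≤ ε)
    (hh : IsTestFun h) (hg : IsTestFun g) (hα : 0 < α) (hγ : 0 < γ)
    (hh0 : ∀ s, -ε ≤ h s) (hh1 : ∀ s, |s| < 1 → 1 / 2 - ε ≤ h s)
    (hg0 : ∀ s, 0 ≤ g s) (hg1 : ∀ s, g s ≤ 1) (hg2 : ∀ s, |s| < 1 → g s = 1) :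
    1 / 2 * (∫ p in {q : ℝ × ℝ | |q.1| < α⁻¹ ∧ |q.2| < γ⁻¹}, w p ^ 2) - ε * C
      ≤ ∫ p, w p ^ 2 * tensorDilate h g α γ p := by
  set Ω := {q : ℝ × ℝ | |q.1| < α⁻¹ ∧ |q.2| < γ⁻¹} with hΩ
  have hΩm : MeasurableSet Ω :=
    ((isOpen_lt (continuous_abs.comp continuous_fst) continuous_const).inter
      (isOpen_lt (continuous_abs.comp continuous_snd) continuous_const)).measurableSet
  have i1 : Integrable (Ω.indicator fun p => w p ^ 2) := hw2.indicator hΩm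
  have key : ∫ p, (1 / 2 * Ω.indicator (fun p => w p ^ 2) p - ε * w p ^ 2)
      ≤ ∫ p, w p ^ 2 * tensorDilate h g α γ p := by
    refine integral_mono ((i1.const_mul _).sub (hw2.const_mul _))
      (integrable_mul_tensorDilate (hw.pow 2) hh hg hα hγ) fun p => ?_
    have hsq := sq_nonneg (w p)
    by_cases hp : p ∈ Ω
    · have h1 : |α * p.1| < 1 := by
        rw [abs_mul, abs_of_pos hα, ← lt_inv_mul_iff₀ hα]; simpa using hp.1
      have h2 : |γ * p.2| < 1 := by
        rw [abs_mul, abs_of_pos hγ, ← lt_inv_mul_iff₀ hγ]; simpa using hp.2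
      simp only [Set.indicator_of_mem hp, tensorDilate, hg2 _ h2, mul_one]
      nlinarith [hh1 _ h1]
    · simp only [Set.indicator_of_notMem hp, tensorDilate]
      have h1 : -ε ≤ h (α * p.1) * g (γ * p.2) := by
        nlinarith [hh0 (α * p.1), hg0 (γ * p.2), hg1 (γ * p.2)]
      nlinarith
  rw [integral_sub (i1.const_mul _) (hw2.const_mul _), integral_const_mul, integral_const_mul,
    integral_indicator hΩm] at key
  nlinarith

/-- The local `L²` mass cannot stay bounded below. -/
lemma IsAdmissibleZK2.not_eventually_le_setIntegral {r b : ℝ} (hr₁ : 1 / 3 < r) (hr₂ : r < 3)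
    (hb₁ : 0 < b) (hb₂ : b < 2 / (3 + r)) {u : ℝ → ℝ → ℝ → ℝ} (hu : IsAdmissibleZK2 u) {C : ℝ}
    (hC : ∀ t : ℝ, 2 ≤ t → ∫ p : ℝ × ℝ, u t p.1 p.2 ^ 2 ≤ C) {m : ℝ} (hm : 0 < m)
    (h : ∀ᶠ t : ℝ in atTop,
      m ≤ ∫ p in {q : ℝ × ℝ | |q.1| < t ^ b ∧ |q.2| < t ^ (b * r)}, u t p.1 p.2 ^ 2) : False := by
  have hs : SmoothField u := hu.smooth
  have hC0 : 0 ≤ C := (integral_nonneg fun p => sq_nonneg _).trans (hC 2 le_rfl)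
  set ε := m / (4 * (C + 1)) with hε
  have hε0 : 0 < ε := by positivity
  have hεC : ε * C ≤ m / 4 := by
    rw [hε, div_mul_eq_mul_div, div_le_div_iff₀ (by positivity) (by positivity)]
    nlinarith
  obtain ⟨f, hf, hf0, hf1⟩ := exists_isTestFun_deriv_ge hε0
  let χ : ContDiffBump (0 : ℝ) := ⟨1, 2, one_pos, one_lt_two⟩
  set g : ℝ → ℝ := ⇑χ
  have hg : IsTestFun g := ⟨χ.contDiff, χ.hasCompactSupport⟩
  have hg1 : ∀ s, |s| < 1 → g s = 1 := fun s hs => χ.one_of_mem_closedBall (by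
    rw [mem_closedBall_zero_iff, Real.norm_eq_abs]; exact hs.le)
  set d := b * r with hd
  have hd0 : 0 < d := mul_pos hb₁ (by linarith)
  set β := (b + d) / 2 with hβ
  have hb3 : b * (3 + r) < 2 := (lt_div_iff₀ (by linarith)).1 hb₂
  have hb1 : b < 1 := by nlinarith
  have hβ1 : β < 1 - b := by rw [hβ, hd]; linarith
  have hβ2 : β < 2 * b := by rw [hβ, hd]; nlinarith
  have hβ3 : β < 2 * d := by rw [hβ, hd]; nlinarith
  let N : (ℝ → ℝ) → (ℝ → ℝ) → ℝ := fun a c => C + (∫ s, a s ^ 2) * ∫ s, c s ^ 2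
  have hpair : ∀ {a c : ℝ → ℝ}, IsTestFun a → IsTestFun c → ∀ t : ℝ, 2 ≤ t →
      |∫ p : ℝ × ℝ, u t p.1 p.2 * tensorDilate a c (t ^ (-b)) (t ^ (-d)) p| ≤ N a c * t ^ β := by
    intro a c ha hc t ht
    have ht0 : 0 < t := by linarith
    refine abs_integral_mul_tensorDilate_le (hs.continuous_slice t) (hu.integrable_sq ht) (hC t ht)
      ha hc (Real.rpow_pos_of_pos ht0 _) (Real.rpow_pos_of_pos ht0 _)
      (Real.rpow_pos_of_pos ht0 _) ?_
    rw [sq, ← Real.rpow_add ht0, ← Real.rpow_add ht0, ← Real.rpow_add ht0, hβ]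
    ring_nf
    exact Real.rpow_zero t
  set K₁ := N (deriv (deriv (deriv f))) g
  set K₂ := N (deriv f) (deriv (deriv g))
  set K₃ := b * N (fun s => s * deriv f s) g + d * N f (fun s => s * deriv g s) with hK₃
  have hsmall : ∀ᶠ t : ℝ in atTop, K₁ * t ^ (-(2 * b - β)) + K₂ * t ^ (-(2 * d - β))
      + K₃ * t ^ (-(1 - b - β)) < m / 16 := by
    have hlim : Tendsto (fun t : ℝ => K₁ * t ^ (-(2 * b - β)) + K₂ * t ^ (-(2 * d - β))
        + K₃ * t ^ (-(1 - b - β))) atTop (nhds (K₁ * 0 + K₂ * 0 + K₃ * 0)) :=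
      (((tendsto_rpow_neg_atTop (by linarith)).const_mul _).add
        ((tendsto_rpow_neg_atTop (by linarith)).const_mul _)).add
        ((tendsto_rpow_neg_atTop (by linarith)).const_mul _)
    exact hlim.eventually_lt_const (by simpa using by positivity)
  obtain ⟨T, hT⟩ := eventually_atTop.1 ((h.and hsmall).and (eventually_ge_atTop (2 : ℝ)))
  have hT2 : 2 ≤ T := (hT T le_rfl).2
  refine not_abs_le_rpow_of_rpow_le_deriv (T := T) (by linarith) (show 0 < m / 16 by positivity) hb1
    hβ1 (fun t ht => hs.hasDerivAt_integral_mul_tensorDilate hf hg hb₁ hd0 (by linarith))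
    (fun t ht => ?_) (fun t ht => hpair hf hg t (hT2.trans ht))
  obtain ⟨⟨hmass, hsm⟩, ht2⟩ := hT t ht
  have ht0 : 0 < t := by linarith
  have hα : 0 < t ^ (-b) := Real.rpow_pos_of_pos ht0 _
  have hγ : 0 < t ^ (-d) := Real.rpow_pos_of_pos ht0 _
  rw [hu.integral_pt2_mul_tensorDilate hf hg hα hγ ht2]
  have hquad := le_integral_sq_mul_tensorDilate (hs.continuous_slice t) (hu.integrable_sq ht2)
    (hC t ht2) hε0.le hf.deriv hg hα hγ hf0 hf1 (fun s => χ.nonneg) (fun s => χ.le_one) hg1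
  rw [← Real.rpow_neg ht0.le, ← Real.rpow_neg ht0.le, neg_neg, neg_neg] at hquad
  have hQ : m / 4 ≤ ∫ p : ℝ × ℝ, u t p.1 p.2 ^ 2
      * tensorDilate (deriv f) g (t ^ (-b)) (t ^ (-d)) p := by linarith
  have p1 := (abs_le.1 (hpair hf.deriv.deriv.deriv hg t ht2)).1
  have p2 := (abs_le.1 (hpair hf.deriv hg.deriv.deriv t ht2)).1
  have p3 := (abs_le.1 (hpair hf.deriv.id_mul hg t ht2)).2
  have p4 := (abs_le.1 (hpair hf hg.deriv.id_mul t ht2)).2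
  have q1 := mul_le_mul_of_nonneg_left p1 (pow_pos hα 3).le
  have q2 := mul_le_mul_of_nonneg_left p2 (mul_pos hα (pow_pos hγ 2)).le
  have q3 := mul_le_mul_of_nonneg_left p3 (div_pos hb₁ ht0).le
  have q4 := mul_le_mul_of_nonneg_left p4 (div_pos hd0 ht0).le
  have q5 := mul_le_mul_of_nonneg_left hQ (half_pos hα).le
  have q6 := mul_le_mul_of_nonneg_left hsm.le hα.le
  have r1 : (t ^ (-b)) ^ 3 * t ^ β = t ^ (-b) * t ^ (-(2 * b - β)) := by
    rw [pow_succ, sq, ← Real.rpow_add ht0, ← Real.rpow_add ht0, ← Real.rpow_add ht0,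
      ← Real.rpow_add ht0]
    ring_nf
  have r2 : t ^ (-b) * (t ^ (-d)) ^ 2 * t ^ β = t ^ (-b) * t ^ (-(2 * d - β)) := by
    rw [sq, ← Real.rpow_add ht0, ← Real.rpow_add ht0, ← Real.rpow_add ht0, ← Real.rpow_add ht0]
    ring_nf
  have r3 : t⁻¹ * t ^ β = t ^ (-b) * t ^ (-(1 - b - β)) := by
    rw [← Real.rpow_neg_one, ← Real.rpow_add ht0, ← Real.rpow_add ht0]
    ring_nf
  have e3 : K₃ * (t⁻¹ * t ^ β) = b / t * (N (fun s => s * deriv f s) g * t ^ β)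
      + d / t * (N f (fun s => s * deriv g s) * t ^ β) := by
    rw [hK₃]; ring
  rw [r3] at e3
  linear_combination q1 + q2 + q3 + q4 + q5 + q6 + K₁ * r1 + K₂ * r2 - e3

/-- Local energy decay for `L²` solutions of 2D ZK:
`liminf_{t→∞} ∫_{Ω(t)} u(t,x,y)² dxdy = 0` where
`Ω(t) = {(x,y) : |x| < t^b, |y| < t^{br}}`. -/
theorem zk2_L2_liminf_decay
    (r b : ℝ) (hr₁ : 1/3 < r) (hr₂ : r < 3) (hb₁ : 0 < b) (hb₂ : b < 2/(3+r))
    (u : ℝ → ℝ → ℝ → ℝ) (hu : IsAdmissibleZK2 u)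
    (hL2 : ∃ C : ℝ, ∀ t : ℝ, 2 ≤ t → (∫ p : ℝ × ℝ, (u t p.1 p.2)^2) ≤ C) :
    Filter.liminf
      (fun t : ℝ =>
        ∫ p in {q : ℝ × ℝ | |q.1| < t ^ b ∧ |q.2| < t ^ (b*r)}, (u t p.1 p.2)^2)
      Filter.atTop = 0 := by
  obtain ⟨C, hC⟩ := hL2
  set F : ℝ → ℝ := fun t : ℝ =>
    ∫ p in {q : ℝ × ℝ | |q.1| < t ^ b ∧ |q.2| < t ^ (b*r)}, (u t p.1 p.2)^2 with hF
  have hF0 : ∀ t, 0 ≤ F t := fun t => integral_nonneg fun p => sq_nonneg _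
  have hFC : ∀ᶠ t in atTop, F t ≤ C := by
    filter_upwards [eventually_ge_atTop (2 : ℝ)] with t ht
    exact (setIntegral_le_integral (hu.integrable_sq ht)
      (Eventually.of_forall fun p => sq_nonneg _)).trans (hC t ht)
  refine le_antisymm (le_of_not_gt fun hpos => ?_) ?_
  · obtain ⟨m, hm0, hm⟩ := exists_between hpos
    have hev := eventually_lt_of_lt_liminf hm (isBoundedUnder_of ⟨0, hF0⟩)
    exact hu.not_eventually_le_setIntegral hr₁ hr₂ hb₁ hb₂ hC hm0 (hev.mono fun t ht => ht.le)
  · exact le_liminf_of_le (isBoundedUnder_of_eventually_le hFC).isCoboundedUnder_ge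
      (Eventually.of_forall hF0)
end
end

section
/- Fix r with 1/3 < r < 3 and b with 0 < b < 2/(3+r). Let u be an admissible smooth solution of the 2D Zakharov–Kuznetsov equation on [2,∞) with sup_{t≥2} ‖u(t,·)‖_{L²(ℝ²)} < ∞, and set Ω(t) = {(x,y) ∈ ℝ² : |x| < t^b and |y| < t^{b r}}. Then there exist a constant C₀ > 0 and a strictly increasing sequence of times t_n → ∞ such that for every n, ∫_{Ω(t_n)} u(t_n,x,y)² dx dy ≤ C₀ / (log t_n)^{1/b − 1}. -/
open MeasureTheory Filter

noncomputable section

theorem hasDerivAt_slice_fst {u : ℝ → ℝ → ℝ → ℝ}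
    (hu : ContDiff ℝ (⊤ : ℕ∞) (fun p : ℝ × ℝ × ℝ => u p.1 p.2.1 p.2.2)) (t x y : ℝ) :
    HasDerivAt (fun s => u s x y)
      (fderiv ℝ (fun p : ℝ × ℝ × ℝ => u p.1 p.2.1 p.2.2) (t, x, y) (1, 0, 0)) t := by
  have h1 := (hu.differentiable (by simp) (t, x, y)).hasFDerivAt
  have h2 : HasDerivAt (fun s : ℝ => ((s, x, y) : ℝ × ℝ × ℝ)) (1, 0, 0) t :=
    (hasDerivAt_id t).prodMk ((hasDerivAt_const t x).prodMk (hasDerivAt_const t y))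
  exact h1.comp_hasDerivAt t h2

theorem hasDerivAt_slice_snd {u : ℝ → ℝ → ℝ → ℝ}
    (hu : ContDiff ℝ (⊤ : ℕ∞) (fun p : ℝ × ℝ × ℝ => u p.1 p.2.1 p.2.2)) (t x y : ℝ) :
    HasDerivAt (fun a => u t a y)
      (fderiv ℝ (fun p : ℝ × ℝ × ℝ => u p.1 p.2.1 p.2.2) (t, x, y) (0, 1, 0)) x := by
  have h1 := (hu.differentiable (by simp) (t, x, y)).hasFDerivAt
  have h2 : HasDerivAt (fun a : ℝ => ((t, a, y) : ℝ × ℝ × ℝ)) (0, 1, 0) x :=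
    (hasDerivAt_const x t).prodMk ((hasDerivAt_id x).prodMk (hasDerivAt_const x y))
  exact h1.comp_hasDerivAt x h2

theorem hasDerivAt_slice_thd {u : ℝ → ℝ → ℝ → ℝ}
    (hu : ContDiff ℝ (⊤ : ℕ∞) (fun p : ℝ × ℝ × ℝ => u p.1 p.2.1 p.2.2)) (t x y : ℝ) :
    HasDerivAt (fun c => u t x c)
      (fderiv ℝ (fun p : ℝ × ℝ × ℝ => u p.1 p.2.1 p.2.2) (t, x, y) (0, 0, 1)) y := by
  have h1 := (hu.differentiable (by simp) (t, x, y)).hasFDerivAt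
  have h2 : HasDerivAt (fun c : ℝ => ((t, x, c) : ℝ × ℝ × ℝ)) (0, 0, 1) y :=
    (hasDerivAt_const y t).prodMk ((hasDerivAt_const y x).prodMk (hasDerivAt_id y))
  exact h1.comp_hasDerivAt y h2

theorem contDiff_fderiv_apply_top {f : ℝ × ℝ × ℝ → ℝ} (hf : ContDiff ℝ (⊤ : ℕ∞) f)
    (v : ℝ × ℝ × ℝ) : ContDiff ℝ (⊤ : ℕ∞) (fun p => fderiv ℝ f p v) :=
  (hf.fderiv_right (m := ((⊤ : ℕ∞) : WithTop ℕ∞)) (by simp)).clm_apply contDiff_const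

theorem contDiff_D2 {u : ℝ → ℝ → ℝ → ℝ}
    (hu : ContDiff ℝ (⊤ : ℕ∞) (fun p : ℝ × ℝ × ℝ => u p.1 p.2.1 p.2.2)) (l : List (Fin 3)) :
    ContDiff ℝ (⊤ : ℕ∞) (fun p : ℝ × ℝ × ℝ => D2 u l p.1 p.2.1 p.2.2) := by
  induction l with
  | nil => exact hu
  | cons i l ih =>
    unfold D2
    split_ifs
    · convert contDiff_fderiv_apply_top ih (1, 0, 0) using 2 with p
      exact (hasDerivAt_slice_fst ih _ _ _).deriv
    · convert contDiff_fderiv_apply_top ih (0, 1, 0) using 2 with p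
      exact (hasDerivAt_slice_snd ih _ _ _).deriv
    · convert contDiff_fderiv_apply_top ih (0, 0, 1) using 2 with p
      exact (hasDerivAt_slice_thd ih _ _ _).deriv

theorem hasDerivAt_pt2 {u : ℝ → ℝ → ℝ → ℝ}
    (hu : ContDiff ℝ (⊤ : ℕ∞) (fun p : ℝ × ℝ × ℝ => u p.1 p.2.1 p.2.2)) (t x y : ℝ) :
    HasDerivAt (fun s => u s x y) (pt2 u t x y) t :=
  (hasDerivAt_slice_fst hu t x y).differentiableAt.hasDerivAt

theorem hasDerivAt_px2 {u : ℝ → ℝ → ℝ → ℝ}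
    (hu : ContDiff ℝ (⊤ : ℕ∞) (fun p : ℝ × ℝ × ℝ => u p.1 p.2.1 p.2.2)) (t x y : ℝ) :
    HasDerivAt (fun a => u t a y) (px2 u t x y) x :=
  (hasDerivAt_slice_snd hu t x y).differentiableAt.hasDerivAt

theorem hasDerivAt_py2 {u : ℝ → ℝ → ℝ → ℝ}
    (hu : ContDiff ℝ (⊤ : ℕ∞) (fun p : ℝ × ℝ × ℝ => u p.1 p.2.1 p.2.2)) (t x y : ℝ) :
    HasDerivAt (fun c => u t x c) (py2 u t x y) y :=
  (hasDerivAt_slice_thd hu t x y).differentiableAt.hasDerivAt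

theorem integral_mul_dx_eq_neg {f f' g g' : ℝ × ℝ → ℝ}
    (hf : ∀ x y, HasDerivAt (fun a => f (a, y)) (f' (x, y)) x)
    (hg : ∀ x y, HasDerivAt (fun a => g (a, y)) (g' (x, y)) x)
    (hf'g : Integrable (fun p => f' p * g p)) (hfg' : Integrable (fun p => f p * g' p))
    (hfg : Integrable (fun p => f p * g p)) :
    ∫ p, f' p * g p = - ∫ p, f p * g' p := by
  have key : ∀ {k k' : ℝ × ℝ → ℝ}, (∀ x y, HasDerivAt (fun a => k (a, y)) (k' (x, y)) x) →
      ∀ p, HasLineDerivAt ℝ k (k' p) p (1, 0) := by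
    rintro k k' hk ⟨x, y⟩
    have h1 : HasDerivAt (fun t : ℝ => x + t) 1 0 := (hasDerivAt_id 0).const_add x
    have h2 := (show HasDerivAt (fun a => k (a, y)) (k' (x, y)) (x + 0) by
      simpa using hk x y).comp (0 : ℝ) h1
    simpa [HasLineDerivAt, Function.comp_def] using h2
  have := integral_bilinear_hasLineDerivAt_right_eq_neg_left_of_integrable
    (μ := (volume : Measure (ℝ × ℝ))) (B := ContinuousLinearMap.mul ℝ ℝ) (v := (1, 0))
    (f := f) (f' := f') (g := g) (g' := g') (by simpa using hf'g) (by simpa using hfg')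
    (by simpa using hfg) (fun p _ => key hf p) (fun p _ => key hg p)
  simp only [ContinuousLinearMap.mul_apply'] at this
  linarith

theorem integral_mul_dy_eq_neg {f f' g g' : ℝ × ℝ → ℝ}
    (hf : ∀ x y, HasDerivAt (fun c => f (x, c)) (f' (x, y)) y)
    (hg : ∀ x y, HasDerivAt (fun c => g (x, c)) (g' (x, y)) y)
    (hf'g : Integrable (fun p => f' p * g p)) (hfg' : Integrable (fun p => f p * g' p))
    (hfg : Integrable (fun p => f p * g p)) :
    ∫ p, f' p * g p = - ∫ p, f p * g' p := by
  have key : ∀ {k k' : ℝ × ℝ → ℝ}, (∀ x y, HasDerivAt (fun c => k (x, c)) (k' (x, y)) y) →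
      ∀ p, HasLineDerivAt ℝ k (k' p) p (0, 1) := by
    rintro k k' hk ⟨x, y⟩
    have h1 : HasDerivAt (fun t : ℝ => y + t) 1 0 := (hasDerivAt_id 0).const_add y
    have h2 := (show HasDerivAt (fun c => k (x, c)) (k' (x, y)) (y + 0) by
      simpa using hk x y).comp (0 : ℝ) h1
    simpa [HasLineDerivAt, Function.comp_def] using h2
  have := integral_bilinear_hasLineDerivAt_right_eq_neg_left_of_integrable
    (μ := (volume : Measure (ℝ × ℝ))) (B := ContinuousLinearMap.mul ℝ ℝ) (v := (0, 1))
    (f := f) (f' := f') (g := g) (g' := g') (by simpa using hf'g) (by simpa using hfg')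
    (by simpa using hfg) (fun p _ => key hf p) (fun p _ => key hg p)
  simp only [ContinuousLinearMap.mul_apply'] at this
  linarith

/-- The Cauchy profile `1 / (1 + s²)`. -/
def cauchyProfile (s : ℝ) : ℝ := (1 + s ^ 2)⁻¹

theorem cauchyProfile_pos (s : ℝ) : 0 < cauchyProfile s := by
  unfold cauchyProfile; positivity

theorem cauchyProfile_le_one (s : ℝ) : cauchyProfile s ≤ 1 := by
  unfold cauchyProfile
  exact inv_le_one_of_one_le₀ (by nlinarith [sq_nonneg s])

theorem continuous_cauchyProfile : Continuous cauchyProfile := by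
  unfold cauchyProfile
  exact Continuous.inv₀ (by fun_prop) (fun s => by positivity)

theorem integrable_cauchyProfile_div {K : ℝ} (hK : 0 < K) :
    Integrable (fun s => cauchyProfile (s / K)) := by
  unfold cauchyProfile
  exact integrable_inv_one_add_sq.comp_div hK.ne'

theorem integral_cauchyProfile_div {K : ℝ} (hK : 0 < K) :
    ∫ s, cauchyProfile (s / K) = K * Real.pi := by
  have := Measure.integral_comp_div cauchyProfile K
  rw [this, abs_of_pos hK, smul_eq_mul]
  congr 1
  exact integral_univ_inv_one_add_sq

theorem integrable_cauchyProfile_prod {M K : ℝ} (hM : 0 < M) (hK : 0 < K) :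
    Integrable (fun p : ℝ × ℝ => cauchyProfile (p.1 / M) * cauchyProfile (p.2 / K)) :=
  (integrable_cauchyProfile_div hM).mul_prod (integrable_cauchyProfile_div hK)

theorem integral_cauchyProfile_prod {M K : ℝ} (hM : 0 < M) (hK : 0 < K) :
    ∫ p : ℝ × ℝ, cauchyProfile (p.1 / M) * cauchyProfile (p.2 / K) = M * K * Real.pi ^ 2 := by
  have := integral_prod_mul (μ := (volume : Measure ℝ)) (ν := (volume : Measure ℝ))
    (fun s => cauchyProfile (s / M)) (fun s => cauchyProfile (s / K))
  rw [integral_cauchyProfile_div hM, integral_cauchyProfile_div hK] at this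
  rw [Measure.volume_eq_prod, this]; ring

theorem IsAdmissibleZK2.exists_bound {u : ℝ → ℝ → ℝ → ℝ} (hu : IsAdmissibleZK2 u)
    (l : List (Fin 3)) {a b : ℝ} (ha : 2 ≤ a) :
    ∃ C : ℝ, 0 ≤ C ∧ ∀ t x y : ℝ, t ∈ Set.Icc a b →
      |D2 u l t x y| ≤ C * (cauchyProfile (x / 1) * cauchyProfile (y / 1)) := by
  obtain ⟨C, hC⟩ := hu.decay l 4 a b ha
  refine ⟨max C 0, le_max_right _ _, fun t x y ht => ?_⟩
  have h := (hC t x y ht).trans (le_max_left C 0)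
  have h1 : (1 + x ^ 2) * (1 + y ^ 2) ≤ (1 + |x| + |y|) ^ 4 := by
    rw [← sq_abs x, ← sq_abs y]
    have hx := abs_nonneg x
    have hy := abs_nonneg y
    calc (1 + |x| ^ 2) * (1 + |y| ^ 2) ≤ (1 + |x| + |y|) ^ 2 * (1 + |x| + |y|) ^ 2 := by
          gcongr <;> nlinarith [mul_nonneg hx hy]
      _ = _ := by ring
  have h2 : (1 + x ^ 2) * (1 + y ^ 2) * |D2 u l t x y| ≤ max C 0 :=
    (mul_le_mul_of_nonneg_right h1 (abs_nonneg _)).trans h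
  simp only [cauchyProfile, div_one]
  rw [← mul_inv, ← div_eq_mul_inv, le_div_iff₀ (by positivity)]
  linarith

theorem continuous_D2_slice {u : ℝ → ℝ → ℝ → ℝ} (hu : IsAdmissibleZK2 u)
    (l : List (Fin 3)) (t : ℝ) : Continuous (fun p : ℝ × ℝ => D2 u l t p.1 p.2) :=
  (contDiff_D2 hu.smooth l).continuous.comp (by fun_prop : Continuous fun p : ℝ × ℝ => (t, p.1, p.2))

theorem integrable_D2_mul {u : ℝ → ℝ → ℝ → ℝ} (hu : IsAdmissibleZK2 u)
    (l : List (Fin 3)) {t : ℝ} (ht : 2 ≤ t) {w : ℝ × ℝ → ℝ} (hw : Continuous w) {B : ℝ}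
    (hB : ∀ p, |w p| ≤ B) : Integrable (fun p : ℝ × ℝ => D2 u l t p.1 p.2 * w p) := by
  obtain ⟨C, hC0, hC⟩ := hu.exists_bound l (b := t) ht
  refine ((integrable_cauchyProfile_prod one_pos one_pos).const_mul (C * B)).mono'
    ((continuous_D2_slice hu l t).mul hw).aestronglyMeasurable (Eventually.of_forall fun p => ?_)
  rw [Real.norm_eq_abs, abs_mul]
  calc _ ≤ C * (cauchyProfile (p.1 / 1) * cauchyProfile (p.2 / 1)) * B :=
        mul_le_mul (hC t p.1 p.2 ⟨le_rfl, le_rfl⟩) (hB p) (abs_nonneg _)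
          (mul_nonneg hC0 (mul_nonneg (cauchyProfile_pos _).le (cauchyProfile_pos _).le))
    _ = _ := by ring

theorem exists_abs_D2_le {u : ℝ → ℝ → ℝ → ℝ} (hu : IsAdmissibleZK2 u)
    (l : List (Fin 3)) {t : ℝ} (ht : 2 ≤ t) : ∃ C, ∀ p : ℝ × ℝ, |D2 u l t p.1 p.2| ≤ C := by
  obtain ⟨C, hC0, hC⟩ := hu.exists_bound l (b := t) ht
  refine ⟨C, fun p => (hC t p.1 p.2 ⟨le_rfl, le_rfl⟩).trans ?_⟩
  exact mul_le_of_le_one_right hC0 (mul_le_one₀ (cauchyProfile_le_one _)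
    (cauchyProfile_pos _).le (cauchyProfile_le_one _))

theorem hasDerivAt_integral_mul {u : ℝ → ℝ → ℝ → ℝ} (hu : IsAdmissibleZK2 u) {t : ℝ}
    (ht : 2 < t) {w : ℝ × ℝ → ℝ} (hw : Continuous w) {B : ℝ} (hB : ∀ p, |w p| ≤ B) :
    HasDerivAt (fun s => ∫ p : ℝ × ℝ, u s p.1 p.2 * w p)
      (∫ p : ℝ × ℝ, pt2 u t p.1 p.2 * w p) t := by
  obtain ⟨C, hC0, hC⟩ := hu.exists_bound [0] (a := 2) (b := t + 1) le_rfl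
  refine (hasDerivAt_integral_of_dominated_loc_of_deriv_le (s := Set.Icc 2 (t + 1))
    (F' := fun s p => pt2 u s p.1 p.2 * w p)
    (bound := fun p => C * B * (cauchyProfile (p.1 / 1) * cauchyProfile (p.2 / 1)))
    (Icc_mem_nhds ht (by linarith)) ?_ ?_ ?_ ?_ ?_ ?_).2
  · exact Eventually.of_forall fun s => ((continuous_D2_slice hu [] s).mul hw).aestronglyMeasurable
  · exact integrable_D2_mul hu [] ht.le hw hB
  · exact ((continuous_D2_slice hu [0] t).mul hw).aestronglyMeasurable
  · refine Eventually.of_forall fun p s hs => ?_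
    rw [Real.norm_eq_abs, abs_mul]
    calc _ ≤ C * (cauchyProfile (p.1 / 1) * cauchyProfile (p.2 / 1)) * B :=
          mul_le_mul (hC s p.1 p.2 hs) (hB p) (abs_nonneg _)
            (mul_nonneg hC0 (mul_nonneg (cauchyProfile_pos _).le (cauchyProfile_pos _).le))
      _ = _ := by ring
  · exact (integrable_cauchyProfile_prod one_pos one_pos).const_mul (C * B)
  · exact Eventually.of_forall fun p s _ => (hasDerivAt_pt2 hu.smooth s p.1 p.2).mul_const _

theorem hasDerivAt_virial {u : ℝ → ℝ → ℝ → ℝ} (hu : IsAdmissibleZK2 u) {t : ℝ} (ht : 2 < t)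
    {f₀ f₁ f₂ f₃ g₀ g₁ g₂ : ℝ → ℝ} {B : ℝ}
    (hf₀ : ∀ x, HasDerivAt f₀ (f₁ x) x) (hf₁ : ∀ x, HasDerivAt f₁ (f₂ x) x)
    (hf₂ : ∀ x, HasDerivAt f₂ (f₃ x) x) (hf₃ : Continuous f₃)
    (hg₀ : ∀ y, HasDerivAt g₀ (g₁ y) y) (hg₁ : ∀ y, HasDerivAt g₁ (g₂ y) y)
    (hg₂ : Continuous g₂)
    (bf₀ : ∀ x, |f₀ x| ≤ B) (bf₁ : ∀ x, |f₁ x| ≤ B) (bf₂ : ∀ x, |f₂ x| ≤ B)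
    (bf₃ : ∀ x, |f₃ x| ≤ B) (bg₀ : ∀ y, |g₀ y| ≤ B) (bg₁ : ∀ y, |g₁ y| ≤ B)
    (bg₂ : ∀ y, |g₂ y| ≤ B) :
    HasDerivAt (fun s => ∫ p : ℝ × ℝ, u s p.1 p.2 * (f₀ p.1 * g₀ p.2))
      ((∫ p : ℝ × ℝ, u t p.1 p.2 * (f₃ p.1 * g₀ p.2))
        + (∫ p : ℝ × ℝ, u t p.1 p.2 * (f₁ p.1 * g₂ p.2))
        + 1 / 2 * ∫ p : ℝ × ℝ, u t p.1 p.2 ^ 2 * (f₁ p.1 * g₀ p.2)) t := by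
  have cf₀ : Continuous f₀ := continuous_iff_continuousAt.2 fun x => (hf₀ x).continuousAt
  have cf₁ : Continuous f₁ := continuous_iff_continuousAt.2 fun x => (hf₁ x).continuousAt
  have cf₂ : Continuous f₂ := continuous_iff_continuousAt.2 fun x => (hf₂ x).continuousAt
  have cg₀ : Continuous g₀ := continuous_iff_continuousAt.2 fun x => (hg₀ x).continuousAt
  have cg₁ : Continuous g₁ := continuous_iff_continuousAt.2 fun x => (hg₁ x).continuousAt
  have hprod : ∀ {f g : ℝ → ℝ}, Continuous f → Continuous g →
      Continuous (fun p : ℝ × ℝ => f p.1 * g p.2) := fun hf hg =>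
    (hf.comp continuous_fst).mul (hg.comp continuous_snd)
  have hbd : ∀ {f g : ℝ → ℝ}, (∀ x, |f x| ≤ B) → (∀ y, |g y| ≤ B) →
      ∀ p : ℝ × ℝ, |f p.1 * g p.2| ≤ B * B := fun hf hg p => by
    rw [abs_mul]
    exact mul_le_mul (hf _) (hg _) (abs_nonneg _) ((abs_nonneg _).trans (hf 0))
  have hInt : ∀ (l : List (Fin 3)) {f g : ℝ → ℝ}, Continuous f → Continuous g →
      (∀ x, |f x| ≤ B) → (∀ y, |g y| ≤ B) →
      Integrable (fun p : ℝ × ℝ => D2 u l t p.1 p.2 * (f p.1 * g p.2)) :=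
    fun l f g cf cg bf bg => integrable_D2_mul hu l ht.le (hprod cf cg) (hbd bf bg)
  obtain ⟨U, hU⟩ := exists_abs_D2_le hu [] ht.le
  have hIntSq : ∀ (l : List (Fin 3)) {f g : ℝ → ℝ}, Continuous f → Continuous g →
      (∀ x, |f x| ≤ B) → (∀ y, |g y| ≤ B) →
      Integrable (fun p : ℝ × ℝ => D2 u l t p.1 p.2 * (u t p.1 p.2 * (f p.1 * g p.2))) := by
    intro l f g cf cg bf bg
    refine integrable_D2_mul hu l ht.le (B := U * (B * B))
      ((continuous_D2_slice hu [] t).mul (hprod cf cg)) fun p => ?_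
    rw [abs_mul]
    exact mul_le_mul (hU p) (hbd bf bg p) (abs_nonneg _) ((abs_nonneg _).trans (hU 0))
  have su := hu.smooth
  have sx : ContDiff ℝ (⊤ : ℕ∞) (fun p : ℝ × ℝ × ℝ => px2 u p.1 p.2.1 p.2.2) := contDiff_D2 su [1]
  have sy : ContDiff ℝ (⊤ : ℕ∞) (fun p : ℝ × ℝ × ℝ => py2 u p.1 p.2.1 p.2.2) := contDiff_D2 su [2]
  have sxx : ContDiff ℝ (⊤ : ℕ∞) (fun p : ℝ × ℝ × ℝ => px2 (px2 u) p.1 p.2.1 p.2.2) :=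
    contDiff_D2 su [1, 1]
  have syy : ContDiff ℝ (⊤ : ℕ∞) (fun p : ℝ × ℝ × ℝ => py2 (py2 u) p.1 p.2.1 p.2.2) :=
    contDiff_D2 su [2, 2]
  set v : ℝ → ℝ → ℝ → ℝ := fun t' x' y' => px2 (px2 u) t' x' y' + py2 (py2 u) t' x' y' with hv
  have sv : ContDiff ℝ (⊤ : ℕ∞) (fun p : ℝ × ℝ × ℝ => v p.1 p.2.1 p.2.2) := sxx.add syy
  have htest : ∀ {f f' g : ℝ → ℝ}, (∀ x, HasDerivAt f (f' x) x) → ∀ x y : ℝ,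
      HasDerivAt (fun a => f (a, y).1 * g (a, y).2) (f' (x, y).1 * g (x, y).2) x :=
    fun {_ _ g} hf x y => (hf x).mul_const (g y)
  have htest' : ∀ {f g g' : ℝ → ℝ}, (∀ x, HasDerivAt g (g' x) x) → ∀ x y : ℝ,
      HasDerivAt (fun c => f (x, c).1 * g (x, c).2) (f (x, y).1 * g' (x, y).2) y :=
    fun {f _ _} hg x y => (hg y).const_mul (f x)
  have i_t : Integrable (fun p : ℝ × ℝ => pt2 u t p.1 p.2 * (f₀ p.1 * g₀ p.2)) :=
    hInt [0] cf₀ cg₀ bf₀ bg₀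
  have i_uux : Integrable
      (fun p : ℝ × ℝ => px2 u t p.1 p.2 * (u t p.1 p.2 * (f₀ p.1 * g₀ p.2))) :=
    hIntSq [1] cf₀ cg₀ bf₀ bg₀
  have hpde : ∀ p : ℝ × ℝ, px2 v t p.1 p.2 * (f₀ p.1 * g₀ p.2)
      = -(pt2 u t p.1 p.2 * (f₀ p.1 * g₀ p.2))
        - px2 u t p.1 p.2 * (u t p.1 p.2 * (f₀ p.1 * g₀ p.2)) := fun p => by
    linear_combination (f₀ p.1 * g₀ p.2) * hu.eqn t p.1 p.2 ht.le
  have i_vx : Integrable (fun p : ℝ × ℝ => px2 v t p.1 p.2 * (f₀ p.1 * g₀ p.2)) := by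
    simp only [hpde]
    exact i_t.neg.sub i_uux
  have i_xx : ∀ {f g : ℝ → ℝ}, Continuous f → Continuous g →
      (∀ x, |f x| ≤ B) → (∀ y, |g y| ≤ B) →
      Integrable (fun p : ℝ × ℝ => px2 (px2 u) t p.1 p.2 * (f p.1 * g p.2)) := hInt [1, 1]
  have i_yy : ∀ {f g : ℝ → ℝ}, Continuous f → Continuous g →
      (∀ x, |f x| ≤ B) → (∀ y, |g y| ≤ B) →
      Integrable (fun p : ℝ × ℝ => py2 (py2 u) t p.1 p.2 * (f p.1 * g p.2)) := hInt [2, 2]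
  have i_v : ∀ {f g : ℝ → ℝ}, Continuous f → Continuous g →
      (∀ x, |f x| ≤ B) → (∀ y, |g y| ≤ B) →
      Integrable (fun p : ℝ × ℝ => v t p.1 p.2 * (f p.1 * g p.2)) := by
    intro f g cf cg bf bg
    simp only [hv, add_mul]
    exact (i_xx cf cg bf bg).add (i_yy cf cg bf bg)
  have e_t : ∫ p : ℝ × ℝ, px2 v t p.1 p.2 * (f₀ p.1 * g₀ p.2)
      = -(∫ p : ℝ × ℝ, pt2 u t p.1 p.2 * (f₀ p.1 * g₀ p.2))
        - ∫ p : ℝ × ℝ, px2 u t p.1 p.2 * (u t p.1 p.2 * (f₀ p.1 * g₀ p.2)) := by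
    simp only [hpde]
    rw [← integral_neg]
    exact integral_sub i_t.neg i_uux
  have e_v := integral_mul_dx_eq_neg (f := fun p => v t p.1 p.2)
    (f' := fun p => px2 v t p.1 p.2) (fun x y => hasDerivAt_px2 sv t x y) (htest (g := g₀) hf₀)
    i_vx (i_v cf₁ cg₀ bf₁ bg₀) (i_v cf₀ cg₀ bf₀ bg₀)
  have e_split : ∫ p : ℝ × ℝ, v t p.1 p.2 * (f₁ p.1 * g₀ p.2)
      = (∫ p : ℝ × ℝ, px2 (px2 u) t p.1 p.2 * (f₁ p.1 * g₀ p.2))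
        + ∫ p : ℝ × ℝ, py2 (py2 u) t p.1 p.2 * (f₁ p.1 * g₀ p.2) := by
    simp only [hv, add_mul]
    exact integral_add (i_xx cf₁ cg₀ bf₁ bg₀) (i_yy cf₁ cg₀ bf₁ bg₀)
  have e_xx := integral_mul_dx_eq_neg (f := fun p => px2 u t p.1 p.2)
    (f' := fun p => px2 (px2 u) t p.1 p.2) (fun x y => hasDerivAt_px2 sx t x y)
    (htest (g := g₀) hf₁) (i_xx cf₁ cg₀ bf₁ bg₀)
    (hInt [1] cf₂ cg₀ bf₂ bg₀) (hInt [1] cf₁ cg₀ bf₁ bg₀)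
  have e_x := integral_mul_dx_eq_neg (f := fun p => u t p.1 p.2)
    (f' := fun p => px2 u t p.1 p.2) (fun x y => hasDerivAt_px2 su t x y)
    (htest (g := g₀) hf₂) (hInt [1] cf₂ cg₀ bf₂ bg₀)
    (hInt [] hf₃ cg₀ bf₃ bg₀) (hInt [] cf₂ cg₀ bf₂ bg₀)
  have e_yy := integral_mul_dy_eq_neg (f := fun p => py2 u t p.1 p.2)
    (f' := fun p => py2 (py2 u) t p.1 p.2) (fun x y => hasDerivAt_py2 sy t x y)
    (htest' (f := f₁) hg₀) (i_yy cf₁ cg₀ bf₁ bg₀)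
    (hInt [2] cf₁ cg₁ bf₁ bg₁) (hInt [2] cf₁ cg₀ bf₁ bg₀)
  have e_y := integral_mul_dy_eq_neg (f := fun p => u t p.1 p.2)
    (f' := fun p => py2 u t p.1 p.2) (fun x y => hasDerivAt_py2 su t x y)
    (htest' (f := f₁) hg₁) (hInt [2] cf₁ cg₁ bf₁ bg₁)
    (hInt [] cf₁ hg₂ bf₁ bg₂) (hInt [] cf₁ cg₁ bf₁ bg₁)
  have i_sq : ∀ {f g : ℝ → ℝ}, Continuous f → Continuous g →
      (∀ x, |f x| ≤ B) → (∀ y, |g y| ≤ B) →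
      Integrable (fun p : ℝ × ℝ => u t p.1 p.2 ^ 2 * (f p.1 * g p.2)) := by
    intro f g cf cg bf bg
    refine (hIntSq [] cf cg bf bg).congr (Eventually.of_forall fun p => ?_)
    simp only [D2]; ring
  have e_sq := integral_mul_dx_eq_neg (f := fun p => u t p.1 p.2 ^ 2)
    (f' := fun p => 2 * (px2 u t p.1 p.2 * u t p.1 p.2))
    (fun x y => ((hasDerivAt_px2 su t x y).pow 2).congr_deriv (by norm_num; ring))
    (htest (g := g₀) hf₀)
    ((i_uux.const_mul 2).congr (Eventually.of_forall fun p => by simp only; ring))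
    (i_sq cf₁ cg₀ bf₁ bg₀) (i_sq cf₀ cg₀ bf₀ bg₀)
  have e_two : ∫ p : ℝ × ℝ, 2 * (px2 u t p.1 p.2 * u t p.1 p.2) * (f₀ p.1 * g₀ p.2)
      = 2 * ∫ p : ℝ × ℝ, px2 u t p.1 p.2 * (u t p.1 p.2 * (f₀ p.1 * g₀ p.2)) := by
    rw [← integral_const_mul]
    congr 1 with p
    ring
  refine (hasDerivAt_integral_mul hu ht (hprod cf₀ cg₀) (hbd bf₀ bg₀)).congr_deriv ?_
  linarith

/-- The first derivative of `cauchyProfile`. -/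
def cauchyProfileDeriv (s : ℝ) : ℝ := -2 * s * cauchyProfile s ^ 2

/-- The second derivative of `cauchyProfile`. -/
def cauchyProfileDeriv₂ (s : ℝ) : ℝ := (6 * s ^ 2 - 2) * cauchyProfile s ^ 3

theorem one_add_sq_mul_cauchyProfile (s : ℝ) : (1 + s ^ 2) * cauchyProfile s = 1 :=
  mul_inv_cancel₀ (by positivity)

theorem hasDerivAt_cauchyProfile (s : ℝ) :
    HasDerivAt cauchyProfile (cauchyProfileDeriv s) s := by
  have h : HasDerivAt (fun s : ℝ => 1 + s ^ 2) (2 * s) s := by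
    simpa using (hasDerivAt_pow 2 s).const_add 1
  refine (h.inv (by positivity)).congr_deriv ?_
  unfold cauchyProfileDeriv cauchyProfile
  field_simp

theorem hasDerivAt_cauchyProfileDeriv (s : ℝ) :
    HasDerivAt cauchyProfileDeriv (cauchyProfileDeriv₂ s) s := by
  have h := ((hasDerivAt_id s).const_mul (-2)).mul ((hasDerivAt_cauchyProfile s).pow 2)
  refine h.congr_deriv ?_
  have h1 := one_add_sq_mul_cauchyProfile s
  simp only [cauchyProfileDeriv, cauchyProfileDeriv₂, id, Pi.pow_apply]
  push_cast
  linear_combination (2 * cauchyProfile s ^ 2) * h1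

theorem continuous_cauchyProfileDeriv₂ : Continuous cauchyProfileDeriv₂ := by
  have := continuous_cauchyProfile
  unfold cauchyProfileDeriv₂
  fun_prop

theorem abs_cauchyProfileDeriv_le (s : ℝ) : |cauchyProfileDeriv s| ≤ 1 := by
  have h1 := one_add_sq_mul_cauchyProfile s
  have h2 := cauchyProfile_le_one s
  have h3 := cauchyProfile_pos s
  have h4 : cauchyProfile s ^ 2 ≤ cauchyProfile s := by nlinarith
  unfold cauchyProfileDeriv
  rw [abs_le]
  constructor <;> nlinarith [mul_nonneg (sq_nonneg (s - 1)) (sq_nonneg (cauchyProfile s)),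
    mul_nonneg (sq_nonneg (s + 1)) (sq_nonneg (cauchyProfile s))]

theorem abs_cauchyProfileDeriv₂_le (s : ℝ) :
    |cauchyProfileDeriv₂ s| ≤ 6 * cauchyProfile s := by
  have h1 := one_add_sq_mul_cauchyProfile s
  have h2 := cauchyProfile_le_one s
  have h3 := cauchyProfile_pos s
  have h4 : cauchyProfile s ^ 2 ≤ cauchyProfile s := by nlinarith
  have h5 : cauchyProfile s ^ 3 ≤ cauchyProfile s ^ 2 := by nlinarith [sq_nonneg (cauchyProfile s)]
  have h6 : s ^ 2 * cauchyProfile s ^ 3 = cauchyProfile s ^ 2 - cauchyProfile s ^ 3 := by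
    linear_combination cauchyProfile s ^ 2 * h1
  have h7 : 0 < cauchyProfile s ^ 3 := by positivity
  unfold cauchyProfileDeriv₂
  rw [abs_le]
  constructor <;> nlinarith

theorem cauchyProfile_div_le {L M : ℝ} (hL : 0 < L) (hLM : L ≤ M) (x : ℝ) :
    cauchyProfile (x / L) ≤ cauchyProfile (x / M) := by
  unfold cauchyProfile
  apply inv_anti₀ (by positivity)
  rw [div_pow, div_pow]
  gcongr

theorem half_le_cauchyProfile_div {L x : ℝ} (hL : 0 < L) (hx : |x| ≤ L) :
    1 / 2 ≤ cauchyProfile (x / L) := by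
  unfold cauchyProfile
  rw [one_div]
  apply inv_anti₀ (by positivity)
  have : (x / L) ^ 2 ≤ 1 := by
    rw [div_pow, div_le_one (by positivity), ← sq_abs x]
    gcongr
  linarith

theorem sq_arctan_sub_arctan_le {L M : ℝ} (hL : 0 < L) (hLM : L ≤ M) (x : ℝ) :
    (Real.arctan (x / L) - Real.arctan (x / M)) ^ 2 ≤ 4 * cauchyProfile (x / M) := by
  have hM : 0 < M := hL.trans_le hLM
  wlog hx : 0 ≤ x generalizing x
  · have := this (-x) (by linarith)
    simp only [neg_div, Real.arctan_neg, cauchyProfile, neg_sq] at this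
    simp only [cauchyProfile]
    linarith [this, show (Real.arctan (x / L) - Real.arctan (x / M)) ^ 2
      = (-Real.arctan (x / L) - -Real.arctan (x / M)) ^ 2 by ring]
  have hmono : Real.arctan (x / M) ≤ Real.arctan (x / L) :=
    Real.arctan_strictMono.monotone (by gcongr)
  have h0 : 0 ≤ Real.arctan (x / M) := Real.arctan_nonneg.2 (by positivity)
  have hpi := Real.arctan_lt_pi_div_two (x / L)
  have hpi4 := Real.pi_lt_d2
  set d := Real.arctan (x / L) - Real.arctan (x / M) with hd
  have d0 : 0 ≤ d := by linarith
  have d1 : d ≤ 1.6 := by norm_num; linarith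
  have d2 : (x / M) * d ≤ 1 := by
    rcases hx.eq_or_lt with rfl | hx
    · simp
    have hs : 0 < x / M := by positivity
    have h1 : d ≤ Real.arctan (x / M)⁻¹ := by
      rw [Real.arctan_inv_of_pos hs]; linarith
    have h2 : Real.arctan (x / M)⁻¹ ≤ (x / M)⁻¹ := by
      have h3 := Real.le_tan (Real.arctan_nonneg.2 (inv_nonneg.2 hs.le)) (Real.arctan_lt_pi_div_two _)
      rwa [Real.tan_arctan] at h3
    calc (x / M) * d ≤ (x / M) * (x / M)⁻¹ := by gcongr; linarith
      _ = 1 := mul_inv_cancel₀ hs.ne'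
  have hs0 : 0 ≤ x / M := by positivity
  have d3 : ((x / M) * d) ^ 2 ≤ 1 := by
    have := mul_nonneg hs0 d0
    nlinarith
  unfold cauchyProfile
  rw [← div_eq_mul_inv, le_div_iff₀ (by positivity)]
  nlinarith

theorem abs_integral_mul_le {v w : ℝ × ℝ → ℝ} {A c S M K : ℝ} (hM : 0 < M) (hK : 0 < K)
    (hS : 0 < S) (hSMK : S ^ 2 = M * K) (hc : 0 < c) (hv : Integrable (fun p => v p ^ 2))
    (hA : ∫ p, v p ^ 2 ≤ A)
    (hw : ∀ p, w p ^ 2 ≤ c ^ 2 * (cauchyProfile (p.1 / M) * cauchyProfile (p.2 / K))) :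
    |∫ p, v p * w p| ≤ c / 2 * S * (A + Real.pi ^ 2) := by
  have hH := integrable_cauchyProfile_prod hM hK
  have hInt := ((hv.const_mul S).add (hH.const_mul S⁻¹)).const_mul (c / 2)
  have hpt : ∀ p : ℝ × ℝ, ‖v p * w p‖ ≤ c / 2 * (S * v p ^ 2
      + S⁻¹ * (cauchyProfile (p.1 / M) * cauchyProfile (p.2 / K))) := by
    intro p
    set H := cauchyProfile (p.1 / M) * cauchyProfile (p.2 / K) with hHdef
    have h1 := hw p
    rw [← hHdef] at h1
    have h2 : w p ^ 2 / (c * S) ≤ c * (S⁻¹ * H) := by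
      rw [div_le_iff₀ (by positivity)]
      calc _ ≤ c ^ 2 * H := h1
        _ = _ := by field_simp
    have h3 : 2 * (|v p| * |w p|) ≤ c * S * v p ^ 2 + w p ^ 2 / (c * S) := by
      have h4 : 0 ≤ (c * S * |v p| - |w p|) ^ 2 / (c * S) := by positivity
      have h5 : (c * S * |v p| - |w p|) ^ 2 / (c * S)
          = c * S * v p ^ 2 + w p ^ 2 / (c * S) - 2 * (|v p| * |w p|) := by
        rw [← sq_abs (v p), ← sq_abs (w p)]
        field_simp
        ring
      linarith
    rw [Real.norm_eq_abs, abs_mul]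
    linarith
  have := norm_integral_le_of_norm_le hInt (Eventually.of_forall hpt)
  rw [Real.norm_eq_abs] at this
  refine this.trans ?_
  simp only [Pi.add_apply]
  rw [integral_const_mul, integral_add (hv.const_mul S) (hH.const_mul S⁻¹), integral_const_mul,
    integral_const_mul, integral_cauchyProfile_prod hM hK, ← hSMK]
  have : S⁻¹ * (S ^ 2 * Real.pi ^ 2) = S * Real.pi ^ 2 := by field_simp
  rw [this, mul_assoc, ← mul_add]
  gcongr

theorem integrable_sq_slice {u : ℝ → ℝ → ℝ → ℝ} (hu : IsAdmissibleZK2 u) {t : ℝ} (ht : 2 ≤ t) :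
    Integrable (fun p : ℝ × ℝ => u t p.1 p.2 ^ 2) := by
  obtain ⟨U, hU⟩ := exists_abs_D2_le hu [] ht
  refine (integrable_D2_mul hu [] ht (continuous_D2_slice hu [] t) hU).congr
    (Eventually.of_forall fun p => ?_)
  simp only [D2]; ring

theorem exists_time_local_mass_le {u : ℝ → ℝ → ℝ → ℝ} (hu : IsAdmissibleZK2 u) {A : ℝ}
    (hA : ∀ t : ℝ, 2 ≤ t → (∫ p : ℝ × ℝ, u t p.1 p.2 ^ 2) ≤ A)
    {L M K S T : ℝ} (hL : 1 ≤ L) (hLM : L ≤ M) (hK : 1 ≤ K) (hS : 0 < S) (hSMK : S ^ 2 = M * K)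
    (hT : 2 < T) :
    ∃ t ∈ Set.Ioo T (2 * T),
      (∫ p in {q : ℝ × ℝ | |q.1| ≤ L ∧ |q.2| ≤ K}, u t p.1 p.2 ^ 2)
        ≤ 48 * (A + Real.pi ^ 2) * (S * L / T + S / L ^ 2 + S / K ^ 2 + L / M) := by
  have hL0 : 0 < L := by linarith
  have hM0 : 0 < M := by linarith
  have hK0 : 0 < K := by linarith
  have hA0 : 0 ≤ A := (integral_nonneg fun p => sq_nonneg _).trans (hA 2 le_rfl)
  set E := A + Real.pi ^ 2 with hE
  set f₀ : ℝ → ℝ := fun x => Real.arctan (x / L) - Real.arctan (x / M) with hf₀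
  set f₁ : ℝ → ℝ := fun x => cauchyProfile (x / L) / L - cauchyProfile (x / M) / M with hf₁
  set f₂ : ℝ → ℝ :=
    fun x => cauchyProfileDeriv (x / L) / L ^ 2 - cauchyProfileDeriv (x / M) / M ^ 2 with hf₂
  set f₃ : ℝ → ℝ :=
    fun x => cauchyProfileDeriv₂ (x / L) / L ^ 3 - cauchyProfileDeriv₂ (x / M) / M ^ 3 with hf₃
  set g₀ : ℝ → ℝ := fun y => cauchyProfile (y / K) with hg₀
  set g₁ : ℝ → ℝ := fun y => cauchyProfileDeriv (y / K) / K with hg₁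
  set g₂ : ℝ → ℝ := fun y => cauchyProfileDeriv₂ (y / K) / K ^ 2 with hg₂
  have hdiv : ∀ {h h' : ℝ → ℝ} (c x : ℝ), (∀ s, HasDerivAt h (h' s) s) →
      HasDerivAt (fun x => h (x / c)) (h' (x / c) / c) x := fun {h h'} c x hh =>
    ((hh (x / c)).comp x ((hasDerivAt_id x).div_const c)).congr_deriv (by ring)
  have harctan : ∀ s, HasDerivAt Real.arctan (cauchyProfile s) s := fun s =>
    (Real.hasDerivAt_arctan s).congr_deriv (one_div _)
  have df₀ : ∀ x, HasDerivAt f₀ (f₁ x) x := fun x =>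
    (hdiv L x harctan).sub (hdiv M x harctan)
  have df₁ : ∀ x, HasDerivAt f₁ (f₂ x) x := fun x =>
    (((hdiv L x hasDerivAt_cauchyProfile).div_const L).sub
      ((hdiv M x hasDerivAt_cauchyProfile).div_const M)).congr_deriv (by simp only [hf₂]; ring)
  have df₂ : ∀ x, HasDerivAt f₂ (f₃ x) x := fun x =>
    (((hdiv L x hasDerivAt_cauchyProfileDeriv).div_const (L ^ 2)).sub
      ((hdiv M x hasDerivAt_cauchyProfileDeriv).div_const (M ^ 2))).congr_deriv
        (by simp only [hf₃]; ring)
  have cf₃ : Continuous f₃ := by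
    have := continuous_cauchyProfileDeriv₂
    simp only [hf₃]; fun_prop
  have dg₀ : ∀ y, HasDerivAt g₀ (g₁ y) y := fun y => hdiv K y hasDerivAt_cauchyProfile
  have dg₁ : ∀ y, HasDerivAt g₁ (g₂ y) y := fun y =>
    ((hdiv K y hasDerivAt_cauchyProfileDeriv).div_const K).congr_deriv
      (by simp only [hg₂]; ring)
  have cg₂ : Continuous g₂ := by
    have := continuous_cauchyProfileDeriv₂
    simp only [hg₂]; fun_prop
  have cf₁ : Continuous f₁ := continuous_iff_continuousAt.2 fun x => (df₁ x).continuousAt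
  have cg₀ : Continuous g₀ := continuous_iff_continuousAt.2 fun x => (dg₀ x).continuousAt
  have hML : M⁻¹ ≤ L⁻¹ := inv_anti₀ hL0 hLM
  have hcp := cauchyProfile_pos
  have hcp1 := cauchyProfile_le_one
  have hcpLM := fun x => cauchyProfile_div_le hL0 hLM x
  -- sharp bounds
  have sf₀ : ∀ x, f₀ x ^ 2 ≤ 2 ^ 2 * cauchyProfile (x / M) := fun x =>
    (sq_arctan_sub_arctan_le hL0 hLM x).trans_eq (by norm_num)
  have sf₁ : ∀ x, |f₁ x| ≤ L⁻¹ * cauchyProfile (x / M) := by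
    intro x
    simp only [hf₁]
    have h1 : cauchyProfile (x / L) / L ≤ L⁻¹ * cauchyProfile (x / M) := by
      rw [div_eq_inv_mul]; exact mul_le_mul_of_nonneg_left (hcpLM x) (by positivity)
    have h2 : cauchyProfile (x / M) / M ≤ L⁻¹ * cauchyProfile (x / M) := by
      rw [div_eq_inv_mul]; exact mul_le_mul_of_nonneg_right hML (hcp _).le
    have h3 : 0 ≤ cauchyProfile (x / L) / L := div_nonneg (hcp _).le hL0.le
    have h4 : 0 ≤ cauchyProfile (x / M) / M := div_nonneg (hcp _).le hM0.le
    rw [abs_le]; constructor <;> linarith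
  have sf₃ : ∀ x, |f₃ x| ≤ 12 / L ^ 3 * cauchyProfile (x / M) := by
    intro x
    have h1 : |cauchyProfileDeriv₂ (x / L) / L ^ 3| ≤ 6 * cauchyProfile (x / M) / L ^ 3 := by
      rw [abs_div, abs_of_pos (by positivity : 0 < L ^ 3)]
      gcongr
      exact (abs_cauchyProfileDeriv₂_le _).trans (by linarith [hcpLM x])
    have h2 : |cauchyProfileDeriv₂ (x / M) / M ^ 3| ≤ 6 * cauchyProfile (x / M) / L ^ 3 := by
      rw [abs_div, abs_of_pos (by positivity : 0 < M ^ 3)]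
      have := (hcp (x / M)).le
      gcongr
      exact abs_cauchyProfileDeriv₂_le _
    calc |f₃ x| ≤ _ := abs_sub _ _
      _ ≤ 6 * cauchyProfile (x / M) / L ^ 3 + 6 * cauchyProfile (x / M) / L ^ 3 := add_le_add h1 h2
      _ = _ := by ring
  have sg₂ : ∀ y, |g₂ y| ≤ 6 / K ^ 2 * cauchyProfile (y / K) := by
    intro y
    simp only [hg₂]
    rw [abs_div, abs_of_pos (by positivity : 0 < K ^ 2), div_mul_eq_mul_div]
    gcongr
    exact abs_cauchyProfileDeriv₂_le _
  -- uniform bounds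
  have hLi : L⁻¹ ≤ 1 := inv_le_one_of_one_le₀ hL
  have bf₀ : ∀ x, |f₀ x| ≤ 12 := fun x => by
    have h1 : f₀ x ^ 2 ≤ 2 ^ 2 := (sf₀ x).trans (by linarith [hcp1 (x / M)])
    linarith [abs_le_of_sq_le_sq h1 (by norm_num)]
  have bf₁ : ∀ x, |f₁ x| ≤ 12 := fun x =>
    (sf₁ x).trans ((mul_le_one₀ hLi (hcp _).le (hcp1 _)).trans (by norm_num))
  have bdiv : ∀ {n z B : ℝ}, 1 ≤ n → |z| ≤ B → |z / n| ≤ B := fun {n z B} hn hz => by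
    rw [abs_div, abs_of_pos (by linarith : 0 < n)]
    exact (div_le_self (abs_nonneg _) hn).trans hz
  have bf₂ : ∀ x, |f₂ x| ≤ 12 := fun x => by
    have h1 := bdiv (one_le_pow₀ hL (n := 2)) (abs_cauchyProfileDeriv_le (x / L))
    have h2 := bdiv (one_le_pow₀ (hL.trans hLM) (n := 2))
      (abs_cauchyProfileDeriv_le (x / M))
    exact (abs_sub _ _).trans (by linarith)
  have bf₃ : ∀ x, |f₃ x| ≤ 12 := fun x => by
    refine (sf₃ x).trans ?_
    have h1 : 12 / L ^ 3 ≤ 12 := div_le_self (by norm_num) (one_le_pow₀ hL)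
    exact (mul_le_mul h1 (hcp1 _) (hcp _).le (by norm_num)).trans (by norm_num)
  have bg₀ : ∀ y, |g₀ y| ≤ 12 := fun y => by
    rw [abs_of_pos (hcp _)]; linarith [hcp1 (y / K)]
  have bg₁ : ∀ y, |g₁ y| ≤ 12 := fun y =>
    (bdiv hK (abs_cauchyProfileDeriv_le (y / K))).trans (by norm_num)
  have bg₂ : ∀ y, |g₂ y| ≤ 12 := fun y => by
    refine (sg₂ y).trans ?_
    have h1 : 6 / K ^ 2 ≤ 6 := div_le_self (by norm_num) (one_le_pow₀ hK)
    exact (mul_le_mul h1 (hcp1 _) (hcp _).le (by norm_num)).trans (by norm_num)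
  -- integral bounds
  have hsq := fun t ht => integrable_sq_slice hu (t := t) ht
  have sq_prod : ∀ {a c P : ℝ}, |a| ≤ c * P → 0 ≤ c → 0 ≤ P → P ≤ 1 → a ^ 2 ≤ c ^ 2 * P := by
    intro a c P h1 hc hP hP1
    calc a ^ 2 = |a| ^ 2 := (sq_abs a).symm
      _ ≤ (c * P) ^ 2 := by gcongr
      _ = c ^ 2 * (P * P) := by ring
      _ ≤ c ^ 2 * P := by gcongr; nlinarith
  have hPpos : ∀ p : ℝ × ℝ, 0 ≤ cauchyProfile (p.1 / M) * cauchyProfile (p.2 / K) := fun p =>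
    mul_nonneg (hcp _).le (hcp _).le
  have hP1 : ∀ p : ℝ × ℝ, cauchyProfile (p.1 / M) * cauchyProfile (p.2 / K) ≤ 1 := fun p =>
    mul_le_one₀ (hcp1 _) (hcp _).le (hcp1 _)
  have bG : ∀ t, 2 ≤ t → |∫ p : ℝ × ℝ, u t p.1 p.2 * (f₀ p.1 * g₀ p.2)| ≤ S * E := by
    intro t ht
    refine (abs_integral_mul_le hM0 hK0 hS hSMK (c := 2) (by norm_num) (hsq t ht) (hA t ht)
      fun p => ?_).trans_eq (by ring)
    rw [mul_pow, ← mul_assoc]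
    refine mul_le_mul (sf₀ _) ?_ (sq_nonneg _) (mul_nonneg (by norm_num) (hcp _).le)
    have h1 := hcp1 (p.2 / K)
    have h2 := hcp (p.2 / K)
    simp only [hg₀]; nlinarith
  have bI : ∀ t, 2 ≤ t → |∫ p : ℝ × ℝ, u t p.1 p.2 * (f₃ p.1 * g₀ p.2)| ≤ 6 / L ^ 3 * S * E := by
    intro t ht
    refine (abs_integral_mul_le hM0 hK0 hS hSMK (c := 12 / L ^ 3) (by positivity) (hsq t ht)
      (hA t ht) fun p => sq_prod ?_ (by positivity) (hPpos p) (hP1 p)).trans_eq (by ring)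
    rw [abs_mul, ← mul_assoc]
    exact mul_le_mul (sf₃ _) (abs_of_pos (hcp _)).le (abs_nonneg _)
      (mul_nonneg (by positivity) (hcp _).le)
  have bJ : ∀ t, 2 ≤ t →
      |∫ p : ℝ × ℝ, u t p.1 p.2 * (f₁ p.1 * g₂ p.2)| ≤ 3 / (L * K ^ 2) * S * E := by
    intro t ht
    refine (abs_integral_mul_le hM0 hK0 hS hSMK (c := L⁻¹ * (6 / K ^ 2)) (by positivity) (hsq t ht)
      (hA t ht) fun p => sq_prod ?_ (by positivity) (hPpos p) (hP1 p)).trans_eq (by field_simp; ring)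
    rw [abs_mul]
    refine (mul_le_mul (sf₁ _) (sg₂ _) (abs_nonneg _)
      (mul_nonneg (by positivity) (hcp _).le)).trans_eq (by ring)
  -- mean value theorem for the virial functional
  have hder := fun t (ht : 2 < t) =>
    hasDerivAt_virial hu ht df₀ df₁ df₂ cf₃ dg₀ dg₁ cg₂ bf₀ bf₁ bf₂ bf₃ bg₀ bg₁ bg₂
  obtain ⟨t, ht, hmv⟩ := exists_hasDerivAt_eq_slope _ _ (show T < 2 * T by linarith)
    (fun t ht => (hder t (by linarith [ht.1])).continuousAt.continuousWithinAt)
    (fun t ht => hder t (by linarith [ht.1]))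
  have ht2 : 2 ≤ t := by linarith [ht.1]
  refine ⟨t, ht, ?_⟩
  have hslope := (abs_le.1 (bG (2 * T) (by linarith))).2
  have hslope' := (abs_le.1 (bG T hT.le)).1
  have hI := (abs_le.1 (bI t ht2)).1
  have hJ := (abs_le.1 (bJ t ht2)).1
  have hmain : (∫ p : ℝ × ℝ, u t p.1 p.2 ^ 2 * (f₁ p.1 * g₀ p.2))
      ≤ 4 * (S * E / T) + 12 / L ^ 3 * S * E + 6 / (L * K ^ 2) * S * E := by
    have h1 : ((∫ p : ℝ × ℝ, u (2 * T) p.1 p.2 * (f₀ p.1 * g₀ p.2))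
        - ∫ p : ℝ × ℝ, u T p.1 p.2 * (f₀ p.1 * g₀ p.2)) / (2 * T - T) ≤ 2 * (S * E / T) := by
      rw [show 2 * T - T = T by ring, ← mul_div_assoc]
      gcongr
      linarith
    have e1 : 12 / L ^ 3 * S * E = 2 * (6 / L ^ 3 * S * E) := by ring
    have e2 : 6 / (L * K ^ 2) * S * E = 2 * (3 / (L * K ^ 2) * S * E) := by ring
    rw [← hmv] at h1
    rw [e1, e2]
    linarith
  have iQ : Integrable (fun p : ℝ × ℝ => u t p.1 p.2 ^ 2 * (f₁ p.1 * g₀ p.2)) := by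
    refine (hsq t ht2).mul_bdd (c := 12 * 12)
      ((cf₁.comp continuous_fst).mul (cg₀.comp continuous_snd)).aestronglyMeasurable
      (Eventually.of_forall fun p => ?_)
    rw [Real.norm_eq_abs, abs_mul]
    exact mul_le_mul (bf₁ _) (bg₀ _) (abs_nonneg _) (by norm_num)
  have iR : Integrable (fun p : ℝ × ℝ =>
      4 * L * (u t p.1 p.2 ^ 2 * (f₁ p.1 * g₀ p.2) + u t p.1 p.2 ^ 2 * M⁻¹)) :=
    (iQ.add ((hsq t ht2).mul_const M⁻¹)).const_mul (4 * L)
  have hweight : ∀ p : ℝ × ℝ,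
      L⁻¹ * (cauchyProfile (p.1 / L) * cauchyProfile (p.2 / K)) ≤ f₁ p.1 * g₀ p.2 + M⁻¹ := by
    intro p
    have h1 : 0 ≤ M⁻¹ * (1 - cauchyProfile (p.1 / M) * cauchyProfile (p.2 / K)) :=
      mul_nonneg (by positivity) (by linarith [hP1 p])
    simp only [hf₁, hg₀, div_eq_mul_inv] at h1 ⊢
    linarith
  have hmeas : MeasurableSet {q : ℝ × ℝ | |q.1| ≤ L ∧ |q.2| ≤ K} :=
    (measurableSet_le (measurable_norm.comp measurable_fst) measurable_const).inter
      (measurableSet_le (measurable_norm.comp measurable_snd) measurable_const)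
  calc (∫ p in {q : ℝ × ℝ | |q.1| ≤ L ∧ |q.2| ≤ K}, u t p.1 p.2 ^ 2)
      ≤ ∫ p in {q : ℝ × ℝ | |q.1| ≤ L ∧ |q.2| ≤ K},
          4 * L * (u t p.1 p.2 ^ 2 * (f₁ p.1 * g₀ p.2) + u t p.1 p.2 ^ 2 * M⁻¹) := by
        refine setIntegral_mono_on (hsq t ht2).integrableOn iR.integrableOn hmeas fun p hp => ?_
        have h1 := half_le_cauchyProfile_div hL0 hp.1
        have h2 := half_le_cauchyProfile_div hK0 hp.2
        have h3 : 1 / 4 ≤ cauchyProfile (p.1 / L) * cauchyProfile (p.2 / K) := by nlinarith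
        have h4 : L⁻¹ * (1 / 4) ≤ f₁ p.1 * g₀ p.2 + M⁻¹ :=
          (mul_le_mul_of_nonneg_left h3 (by positivity)).trans (hweight p)
        calc u t p.1 p.2 ^ 2 = 4 * L * (u t p.1 p.2 ^ 2 * (L⁻¹ * (1 / 4))) := by field_simp
          _ ≤ 4 * L * (u t p.1 p.2 ^ 2 * (f₁ p.1 * g₀ p.2 + M⁻¹)) := by gcongr
          _ = _ := by ring
    _ ≤ ∫ p : ℝ × ℝ, 4 * L * (u t p.1 p.2 ^ 2 * (f₁ p.1 * g₀ p.2) + u t p.1 p.2 ^ 2 * M⁻¹) := by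
        refine setIntegral_le_integral iR (Eventually.of_forall fun p => ?_)
        have h1 : 0 ≤ f₁ p.1 * g₀ p.2 + M⁻¹ :=
          (mul_nonneg (by positivity) (mul_nonneg (hcp _).le (hcp _).le)).trans (hweight p)
        have h2 : 0 ≤ 4 * L * (u t p.1 p.2 ^ 2 * (f₁ p.1 * g₀ p.2 + M⁻¹)) := by positivity
        simp only [Pi.zero_apply]
        linarith
    _ = 4 * L * ((∫ p : ℝ × ℝ, u t p.1 p.2 ^ 2 * (f₁ p.1 * g₀ p.2))
          + (∫ p : ℝ × ℝ, u t p.1 p.2 ^ 2) * M⁻¹) := by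
        rw [integral_const_mul, integral_add iQ ((hsq t ht2).mul_const M⁻¹), integral_mul_const]
    _ ≤ 4 * L * ((4 * (S * E / T) + 12 / L ^ 3 * S * E + 6 / (L * K ^ 2) * S * E) + E * M⁻¹) := by
        have h1 : (∫ p : ℝ × ℝ, u t p.1 p.2 ^ 2) ≤ E := (hA t ht2).trans (by rw [hE]; nlinarith)
        gcongr
    _ = E * (16 * (S * L / T) + 48 * (S / L ^ 2) + 24 * (S / K ^ 2) + 4 * (L / M)) := by
        field_simp; ring
    _ ≤ E * (48 * (S * L / T) + 48 * (S / L ^ 2) + 48 * (S / K ^ 2) + 48 * (L / M)) := by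
        have hE0 : 0 ≤ E := by positivity
        gcongr <;> norm_num
    _ = _ := by ring

theorem exists_decay_exponents {r b : ℝ} (hr₁ : 1/3 < r) (hr₂ : r < 3) (hb₁ : 0 < b)
    (hb₂ : b < 2/(3+r)) :
    ∃ q ε : ℝ, 1 < q ∧ 0 < ε ∧ b * ((q + r) / 2) + b - 1 ≤ -ε ∧
      b * ((q + r) / 2) - b * 2 ≤ -ε ∧ b * ((q + r) / 2) - b * r * 2 ≤ -ε ∧
      b - b * q ≤ -ε := by
  have hb : b * (3 + r) < 2 := (lt_div_iff₀ (by linarith)).1 hb₂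
  have h1 : 1 < 2 / b - 2 - r := by
    have : 3 + r < 2 / b := by rw [lt_div_iff₀ hb₁]; linarith
    linarith
  obtain ⟨q, hq1, hq⟩ := exists_between
    (show (1 : ℝ) < min (2 / b - 2 - r) (min (4 - r) (3 * r)) from
      lt_min h1 (lt_min (by linarith) (by linarith)))
  rw [lt_min_iff, lt_min_iff] at hq
  obtain ⟨h2, h3, h4⟩ := hq
  have h2' : b * (q + 2 + r) < 2 := by
    have : q + 2 + r < 2 / b := by linarith
    rw [lt_div_iff₀ hb₁] at this; linarith
  have h5 : 0 < b * (4 - r - q) := mul_pos hb₁ (by linarith)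
  have h6 : 0 < b * (3 * r - q) := mul_pos hb₁ (by linarith)
  have h7 : 0 < b * (q - 1) := mul_pos hb₁ (by linarith)
  obtain ⟨ε, hε0, hε⟩ := exists_between (show (0 : ℝ) < min ((2 - b * (q + 2 + r)) / 2)
    (min (b * (4 - r - q) / 2) (min (b * (3 * r - q) / 2) (b * (q - 1)))) from
      lt_min (by linarith) (lt_min (by linarith) (lt_min (by linarith) h7)))
  simp only [lt_min_iff] at hε
  obtain ⟨e1, e2, e3, e4⟩ := hε
  exact ⟨q, ε, hq1, hε0, by linarith, by linarith, by linarith, by linarith⟩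

theorem exists_time_power_decay {r b : ℝ} (hr₁ : 1/3 < r) (hr₂ : r < 3) (hb₁ : 0 < b)
    (hb₂ : b < 2/(3+r)) {u : ℝ → ℝ → ℝ → ℝ} (hu : IsAdmissibleZK2 u) {A : ℝ}
    (hA : ∀ t : ℝ, 2 ≤ t → (∫ p : ℝ × ℝ, u t p.1 p.2 ^ 2) ≤ A) :
    ∃ ε C : ℝ, 0 < ε ∧ 0 < C ∧ ∀ T : ℝ, 2 < T → ∃ t ∈ Set.Ioo T (2 * T),
      (∫ p in {q : ℝ × ℝ | |q.1| < t ^ b ∧ |q.2| < t ^ (b * r)}, u t p.1 p.2 ^ 2)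
        ≤ C * t ^ (-ε) := by
  obtain ⟨q, ε, hq, hε, h1, h2, h3, h4⟩ := exists_decay_exponents hr₁ hr₂ hb₁ hb₂
  have hA0 : 0 ≤ A := (integral_nonneg fun p => sq_nonneg _).trans (hA 2 le_rfl)
  have hE0 : 0 < A + Real.pi ^ 2 := by positivity
  refine ⟨ε, 48 * (A + Real.pi ^ 2) * 5, hε, by positivity, fun T hT => ?_⟩
  have hX1 : 1 ≤ 2 * T := by linarith
  have hX0 : 0 < 2 * T := by linarith
  have hbr : 0 < b * r := mul_pos hb₁ (by linarith)
  obtain ⟨t, ht, hmass⟩ := exists_time_local_mass_le hu hA (L := (2 * T) ^ b)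
    (M := (2 * T) ^ (b * q)) (K := (2 * T) ^ (b * r)) (S := (2 * T) ^ (b * ((q + r) / 2)))
    (Real.one_le_rpow hX1 hb₁.le) (Real.rpow_le_rpow_of_exponent_le hX1 (by nlinarith))
    (Real.one_le_rpow hX1 hbr.le) (Real.rpow_pos_of_pos hX0 _)
    (by rw [← Real.rpow_natCast, ← Real.rpow_mul hX0.le, ← Real.rpow_add hX0]
        congr 1; push_cast; ring) hT
  refine ⟨t, ht, ?_⟩
  have ht0 : 0 < t := by linarith [ht.1]
  have htX : t ≤ 2 * T := ht.2.le
  have hsub : {q : ℝ × ℝ | |q.1| < t ^ b ∧ |q.2| < t ^ (b * r)}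
      ⊆ {q : ℝ × ℝ | |q.1| ≤ (2 * T) ^ b ∧ |q.2| ≤ (2 * T) ^ (b * r)} := fun p hp =>
    ⟨hp.1.le.trans (Real.rpow_le_rpow ht0.le htX hb₁.le),
      hp.2.le.trans (Real.rpow_le_rpow ht0.le htX hbr.le)⟩
  have hle : ∀ {e : ℝ}, e ≤ -ε → (2 * T) ^ e ≤ (2 * T) ^ (-ε) := fun he =>
    Real.rpow_le_rpow_of_exponent_le hX1 he
  have e1 : (2 * T) ^ (b * ((q + r) / 2)) * (2 * T) ^ b / T ≤ 2 * (2 * T) ^ (-ε) := by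
    have : (2 * T) ^ (b * ((q + r) / 2)) * (2 * T) ^ b / T
        = 2 * (2 * T) ^ (b * ((q + r) / 2) + b - 1) := by
      rw [Real.rpow_sub hX0, Real.rpow_add hX0, Real.rpow_one]
      field_simp
    rw [this]
    linarith [hle h1]
  have e2 : (2 * T) ^ (b * ((q + r) / 2)) / ((2 * T) ^ b) ^ 2 ≤ (2 * T) ^ (-ε) := by
    rw [← Real.rpow_natCast, ← Real.rpow_mul hX0.le, ← Real.rpow_sub hX0]
    exact hle (by push_cast; linarith)
  have e3 : (2 * T) ^ (b * ((q + r) / 2)) / ((2 * T) ^ (b * r)) ^ 2 ≤ (2 * T) ^ (-ε) := by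
    rw [← Real.rpow_natCast, ← Real.rpow_mul hX0.le, ← Real.rpow_sub hX0]
    exact hle (by push_cast; linarith)
  have e4 : (2 * T) ^ b / (2 * T) ^ (b * q) ≤ (2 * T) ^ (-ε) := by
    rw [← Real.rpow_sub hX0]
    exact hle h4
  have e5 : (2 * T) ^ (-ε) ≤ t ^ (-ε) :=
    Real.rpow_le_rpow_of_nonpos ht0 htX (by linarith)
  calc (∫ p in {q : ℝ × ℝ | |q.1| < t ^ b ∧ |q.2| < t ^ (b * r)}, u t p.1 p.2 ^ 2)
      ≤ ∫ p in {q : ℝ × ℝ | |q.1| ≤ (2 * T) ^ b ∧ |q.2| ≤ (2 * T) ^ (b * r)},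
          u t p.1 p.2 ^ 2 :=
        setIntegral_mono_set (integrable_sq_slice hu (by linarith [ht.1])).integrableOn
          (Eventually.of_forall fun p => sq_nonneg _) hsub.eventuallyLE
    _ ≤ _ := hmass
    _ ≤ 48 * (A + Real.pi ^ 2) * (5 * t ^ (-ε)) := by
        gcongr
        linarith
    _ = _ := by ring

theorem rpow_neg_le_div_log_rpow {ε s t : ℝ} (hε : 0 < ε) (hs : 0 < s) (ht : 1 < t) :
    t ^ (-ε) ≤ (s / ε) ^ s / Real.log t ^ s := by
  have ht0 : 0 < t := by linarith
  have hlog : 0 < Real.log t := Real.log_pos ht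
  have h1 : Real.log t ≤ t ^ (ε / s) / (ε / s) := Real.log_le_rpow_div ht0.le (by positivity)
  have h2 : Real.log t ^ s ≤ t ^ ε * (s / ε) ^ s := by
    calc Real.log t ^ s ≤ (t ^ (ε / s) / (ε / s)) ^ s := by gcongr
      _ = (t ^ (ε / s) * (s / ε)) ^ s := by rw [div_div_eq_mul_div, mul_div_assoc]
      _ = t ^ ε * (s / ε) ^ s := by
        rw [Real.mul_rpow (by positivity) (by positivity), ← Real.rpow_mul ht0.le,
          div_mul_cancel₀ _ hs.ne']
  rw [le_div_iff₀ (by positivity), Real.rpow_neg ht0.le, inv_mul_le_iff₀ (by positivity)]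
  exact h2

/-- Sequential rate of decay for `L²` solutions of 2D ZK: there are `C₀ > 0` and a
strictly increasing sequence of times `tₙ → ∞` with
`∫_{Ω(tₙ)} u(tₙ)² ≤ C₀ / (log tₙ)^{1/b−1}`, where `Ω(t) = {|x| < t^b, |y| < t^{br}}`. -/
theorem zk2_L2_sequential_rate
    (r b : ℝ) (hr₁ : 1/3 < r) (hr₂ : r < 3) (hb₁ : 0 < b) (hb₂ : b < 2/(3+r))
    (u : ℝ → ℝ → ℝ → ℝ) (hu : IsAdmissibleZK2 u)
    (hL2 : ∃ C : ℝ, ∀ t : ℝ, 2 ≤ t → (∫ p : ℝ × ℝ, (u t p.1 p.2)^2) ≤ C) :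
    ∃ C₀ : ℝ, 0 < C₀ ∧ ∃ tseq : ℕ → ℝ, StrictMono tseq ∧ Tendsto tseq atTop atTop ∧
      ∀ n : ℕ,
        (∫ p in {q : ℝ × ℝ | |q.1| < (tseq n) ^ b ∧ |q.2| < (tseq n) ^ (b*r)},
            (u (tseq n) p.1 p.2)^2)
          ≤ C₀ / (Real.log (tseq n)) ^ (1/b - 1) := by
  obtain ⟨A, hA⟩ := hL2
  obtain ⟨ε, C, hε, hC, hdecay⟩ := exists_time_power_decay hr₁ hr₂ hb₁ hb₂ hu hA
  have hs : 0 < 1 / b - 1 := by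
    have h1 : b * (3 + r) < 2 := (lt_div_iff₀ (by linarith)).1 hb₂
    have h2 : 1 < 1 / b := by rw [lt_div_iff₀ hb₁]; nlinarith
    linarith
  have hT : ∀ n : ℕ, (2 : ℝ) < 4 ^ (n + 1) := fun n => by
    rw [pow_succ]
    linarith [one_le_pow₀ (show (1 : ℝ) ≤ 4 by norm_num) (n := n)]
  choose τ hτ hmass using fun n : ℕ => hdecay (4 ^ (n + 1)) (hT n)
  refine ⟨C * ((1 / b - 1) / ε) ^ (1 / b - 1), by positivity, τ, ?_, ?_, fun n => ?_⟩
  · refine strictMono_nat_of_lt_succ fun n => ?_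
    have h1 := (hτ n).2
    have h2 := (hτ (n + 1)).1
    rw [pow_succ] at h2
    linarith [hT n]
  · exact tendsto_atTop_mono (fun n => (hτ n).1.le)
      ((tendsto_pow_atTop_atTop_of_one_lt (by norm_num)).comp (tendsto_add_atTop_nat 1))
  · refine (hmass n).trans ?_
    rw [mul_div_assoc]
    gcongr
    exact rpow_neg_le_div_log_rpow hε hs (by linarith [(hτ n).1, hT n])
end
end

section
/- Fix r with 1/3 < r < 3, b with 0 < b < 2/(3+r), m with 0 ≤ m < 1 − b(1+r)/2, n with 0 ≤ n < 1 − b(3−r)/2, and signs ε₁, ε₂ ∈ {−1, +1}. Let u be an admissible smooth solution of the 2D Zakharov–Kuznetsov equation on [2,∞) with sup_{t≥2} ‖u(t,·)‖_{L²(ℝ²)} < ∞. For t ≥ 2 set Ω(t) = {(x,y) ∈ ℝ² : |x + ε₁ t^m| < t^b and |y + ε₂ t^n| < t^{b r}}. Then liminf_{t→∞} ∫_{Ω(t)} u(t,x,y)² dx dy = 0. -/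
open MeasureTheory Filter

noncomputable section

namespace IsAdmissibleZK2

theorem hasDerivAt_comp_curve {f : ℝ → ℝ → ℝ → ℝ}
    (hf : ContDiff ℝ (⊤ : ℕ∞) (fun p : ℝ × ℝ × ℝ => f p.1 p.2.1 p.2.2))
    {γ : ℝ → ℝ × ℝ × ℝ} {v : ℝ × ℝ × ℝ} {s : ℝ} (hγ : HasDerivAt γ v s) :
    HasDerivAt (fun s => f (γ s).1 (γ s).2.1 (γ s).2.2)
      (fderiv ℝ (fun p : ℝ × ℝ × ℝ => f p.1 p.2.1 p.2.2) (γ s) v) s :=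
  (hf.differentiable (by simp) (γ s)).hasFDerivAt.comp_hasDerivAt s hγ

theorem contDiff_pt2 {f : ℝ → ℝ → ℝ → ℝ}
    (hf : ContDiff ℝ (⊤ : ℕ∞) (fun p : ℝ × ℝ × ℝ => f p.1 p.2.1 p.2.2)) :
    ContDiff ℝ (⊤ : ℕ∞) (fun p : ℝ × ℝ × ℝ => pt2 f p.1 p.2.1 p.2.2) ∧
      ∀ t x y, HasDerivAt (fun s => f s x y) (pt2 f t x y) t := by
  have key : ∀ t x y, HasDerivAt (fun s => f s x y)
      (fderiv ℝ (fun p : ℝ × ℝ × ℝ => f p.1 p.2.1 p.2.2) (t, x, y) (1, 0, 0)) t := fun t x y =>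
    hasDerivAt_comp_curve hf ((hasDerivAt_id t).prodMk (hasDerivAt_const t (x, y)))
  refine ⟨?_, fun t x y => (key t x y).differentiableAt.hasDerivAt⟩
  have : (fun p : ℝ × ℝ × ℝ => pt2 f p.1 p.2.1 p.2.2) = fun p : ℝ × ℝ × ℝ =>
      fderiv ℝ (fun p : ℝ × ℝ × ℝ => f p.1 p.2.1 p.2.2) p (1, 0, 0) :=
    funext fun p => (key p.1 p.2.1 p.2.2).deriv
  rw [this]
  exact (hf.fderiv_right (by simp)).clm_apply contDiff_const

theorem contDiff_px2 {f : ℝ → ℝ → ℝ → ℝ}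
    (hf : ContDiff ℝ (⊤ : ℕ∞) (fun p : ℝ × ℝ × ℝ => f p.1 p.2.1 p.2.2)) :
    ContDiff ℝ (⊤ : ℕ∞) (fun p : ℝ × ℝ × ℝ => px2 f p.1 p.2.1 p.2.2) ∧
      ∀ t x y, HasDerivAt (fun s => f t s y) (px2 f t x y) x := by
  have key : ∀ t x y, HasDerivAt (fun s => f t s y)
      (fderiv ℝ (fun p : ℝ × ℝ × ℝ => f p.1 p.2.1 p.2.2) (t, x, y) (0, 1, 0)) x := fun t x y =>
    hasDerivAt_comp_curve hf
      ((hasDerivAt_const x t).prodMk ((hasDerivAt_id x).prodMk (hasDerivAt_const x y)))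
  refine ⟨?_, fun t x y => (key t x y).differentiableAt.hasDerivAt⟩
  have : (fun p : ℝ × ℝ × ℝ => px2 f p.1 p.2.1 p.2.2) = fun p : ℝ × ℝ × ℝ =>
      fderiv ℝ (fun p : ℝ × ℝ × ℝ => f p.1 p.2.1 p.2.2) p (0, 1, 0) :=
    funext fun p => (key p.1 p.2.1 p.2.2).deriv
  rw [this]
  exact (hf.fderiv_right (by simp)).clm_apply contDiff_const

theorem contDiff_py2 {f : ℝ → ℝ → ℝ → ℝ}
    (hf : ContDiff ℝ (⊤ : ℕ∞) (fun p : ℝ × ℝ × ℝ => f p.1 p.2.1 p.2.2)) :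
    ContDiff ℝ (⊤ : ℕ∞) (fun p : ℝ × ℝ × ℝ => py2 f p.1 p.2.1 p.2.2) ∧
      ∀ t x y, HasDerivAt (fun s => f t x s) (py2 f t x y) y := by
  have key : ∀ t x y, HasDerivAt (fun s => f t x s)
      (fderiv ℝ (fun p : ℝ × ℝ × ℝ => f p.1 p.2.1 p.2.2) (t, x, y) (0, 0, 1)) y := fun t x y =>
    hasDerivAt_comp_curve hf
      ((hasDerivAt_const y t).prodMk ((hasDerivAt_const y x).prodMk (hasDerivAt_id y)))
  refine ⟨?_, fun t x y => (key t x y).differentiableAt.hasDerivAt⟩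
  have : (fun p : ℝ × ℝ × ℝ => py2 f p.1 p.2.1 p.2.2) = fun p : ℝ × ℝ × ℝ =>
      fderiv ℝ (fun p : ℝ × ℝ × ℝ => f p.1 p.2.1 p.2.2) p (0, 0, 1) :=
    funext fun p => (key p.1 p.2.1 p.2.2).deriv
  rw [this]
  exact (hf.fderiv_right (by simp)).clm_apply contDiff_const

variable {u : ℝ → ℝ → ℝ → ℝ}

theorem contDiff_D2 (hu : IsAdmissibleZK2 u) (l : List (Fin 3)) :
    ContDiff ℝ (⊤ : ℕ∞) (fun p : ℝ × ℝ × ℝ => D2 u l p.1 p.2.1 p.2.2) := by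
  induction l with
  | nil => exact hu.smooth
  | cons i l ih =>
    simp only [D2]
    split_ifs
    · exact (contDiff_pt2 ih).1
    · exact (contDiff_px2 ih).1
    · exact (contDiff_py2 ih).1

theorem hasDerivAt_t (hu : IsAdmissibleZK2 u) (l : List (Fin 3)) (t x y : ℝ) :
    HasDerivAt (fun s => D2 u l s x y) (D2 u (0 :: l) t x y) t :=
  (contDiff_pt2 (hu.contDiff_D2 l)).2 t x y

theorem hasDerivAt_x (hu : IsAdmissibleZK2 u) (l : List (Fin 3)) (t x y : ℝ) :
    HasDerivAt (fun s => D2 u l t s y) (D2 u (1 :: l) t x y) x :=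
  (contDiff_px2 (hu.contDiff_D2 l)).2 t x y

theorem hasDerivAt_y (hu : IsAdmissibleZK2 u) (l : List (Fin 3)) (t x y : ℝ) :
    HasDerivAt (fun s => D2 u l t x s) (D2 u (2 :: l) t x y) y :=
  (contDiff_py2 (hu.contDiff_D2 l)).2 t x y

theorem continuous_D2 (hu : IsAdmissibleZK2 u) (l : List (Fin 3)) (t : ℝ) :
    Continuous (fun p : ℝ × ℝ => D2 u l t p.1 p.2) :=
  (hu.contDiff_D2 l).continuous.comp (by fun_prop : Continuous fun p : ℝ × ℝ => (t, p.1, p.2))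

/-- The equation, expanded in terms of iterated derivatives. -/
theorem eqn_D2 (hu : IsAdmissibleZK2 u) {t : ℝ} (ht : 2 ≤ t) (x y : ℝ) :
    D2 u [0] t x y = -(D2 u [1, 1, 1] t x y + D2 u [1, 2, 2] t x y
      + u t x y * D2 u [1] t x y) := by
  have h := hu.eqn t x y ht
  have h1 : px2 (fun t' x' y' => px2 (px2 u) t' x' y' + py2 (py2 u) t' x' y') t x y
      = D2 u [1, 1, 1] t x y + D2 u [1, 2, 2] t x y :=
    ((hu.hasDerivAt_x [1, 1] t x y).add (hu.hasDerivAt_x [2, 2] t x y)).deriv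
  rw [h1] at h
  change pt2 u t x y = -(_ + u t x y * px2 u t x y)
  linarith

/-- Locally uniform domination of the iterated derivatives by an integrable function. -/
theorem exists_bound_s2 (hu : IsAdmissibleZK2 u) (l : List (Fin 3)) {a : ℝ} (ha : 2 ≤ a) (b : ℝ) :
    ∃ C, 0 ≤ C ∧ ∀ t ∈ Set.Icc a b, ∀ p : ℝ × ℝ,
      |D2 u l t p.1 p.2| ≤ C * (1 + ‖p‖) ^ (-3 : ℝ) := by
  obtain ⟨C, hC⟩ := hu.decay l 3 a b ha
  refine ⟨max C 0, le_max_right _ _, fun t ht p => ?_⟩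
  have h0 : 0 < 1 + ‖p‖ := by positivity
  have h1 : (1 + ‖p‖) ^ 3 ≤ (1 + |p.1| + |p.2|) ^ 3 := by
    have : ‖p‖ ≤ |p.1| + |p.2| := by
      rw [Prod.norm_def, Real.norm_eq_abs, Real.norm_eq_abs]
      exact max_le (by linarith [abs_nonneg p.2]) (by linarith [abs_nonneg p.1])
    exact pow_le_pow_left₀ h0.le (by linarith) 3
  have h2 : (1 + ‖p‖) ^ 3 * |D2 u l t p.1 p.2| ≤ max C 0 :=
    ((mul_le_mul_of_nonneg_right h1 (abs_nonneg _)).trans (hC t p.1 p.2 ht)).trans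
      (le_max_left _ _)
  rw [Real.rpow_neg h0.le, ← div_eq_mul_inv, le_div_iff₀ (by positivity), mul_comm]
  exact_mod_cast h2

theorem integrable_weight : Integrable (fun p : ℝ × ℝ => (1 + ‖p‖) ^ (-3 : ℝ)) :=
  integrable_one_add_norm (by simp; norm_num)

theorem integrable_D2_mul (hu : IsAdmissibleZK2 u) (l : List (Fin 3)) {t : ℝ} (ht : 2 ≤ t)
    {w : ℝ × ℝ → ℝ} (hw : Continuous w) {K : ℝ} (hK : ∀ p, |w p| ≤ K) :
    Integrable (fun p : ℝ × ℝ => D2 u l t p.1 p.2 * w p) := by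
  obtain ⟨C, hC0, hC⟩ := hu.exists_bound_s2 l ht t
  refine (integrable_weight.const_mul (C * K)).mono'
    ((hu.continuous_D2 l t).mul hw).aestronglyMeasurable (Eventually.of_forall fun p => ?_)
  rw [Real.norm_eq_abs, abs_mul]
  have h1 := hC t ⟨le_rfl, le_rfl⟩ p
  calc _ ≤ C * (1 + ‖p‖) ^ (-3 : ℝ) * K :=
        mul_le_mul h1 (hK p) (abs_nonneg _) (by positivity)
    _ = _ := by ring

theorem exists_abs_D2_le (hu : IsAdmissibleZK2 u) (l : List (Fin 3)) {t : ℝ} (ht : 2 ≤ t) :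
    ∃ C, ∀ p : ℝ × ℝ, |D2 u l t p.1 p.2| ≤ C := by
  obtain ⟨C, hC⟩ := hu.decay l 0 t t ht
  exact ⟨C, fun p => by simpa using hC t p.1 p.2 ⟨le_rfl, le_rfl⟩⟩

theorem integrable_sq_mul (hu : IsAdmissibleZK2 u) {t : ℝ} (ht : 2 ≤ t)
    {w : ℝ × ℝ → ℝ} (hw : Continuous w) {K : ℝ} (hK : ∀ p, |w p| ≤ K) :
    Integrable (fun p : ℝ × ℝ => u t p.1 p.2 ^ 2 * w p) := by
  obtain ⟨C, hC⟩ := hu.exists_abs_D2_le [] ht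
  have := hu.integrable_D2_mul [] ht ((hu.continuous_D2 [] t).mul hw) (K := C * K) fun p => by
    rw [Pi.mul_apply, abs_mul]
    exact mul_le_mul (hC p) (hK p) (abs_nonneg _) ((abs_nonneg _).trans (hC p))
  refine this.congr (Eventually.of_forall fun p => ?_)
  simp only [D2, Pi.mul_apply]
  ring

theorem integrable_sq_s2 (hu : IsAdmissibleZK2 u) {t : ℝ} (ht : 2 ≤ t) :
    Integrable (fun p : ℝ × ℝ => u t p.1 p.2 ^ 2) := by
  simpa using hu.integrable_sq_mul ht (w := fun _ => 1) continuous_const (K := 1) (by simp)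

theorem integral_x_mul (hu : IsAdmissibleZK2 u) (l : List (Fin 3)) {t : ℝ} (ht : 2 ≤ t)
    {P P' Q : ℝ → ℝ} (hP : ∀ x, HasDerivAt P (P' x) x) (hP' : Continuous P') (hQ : Continuous Q)
    {A A' B : ℝ} (hA : ∀ x, |P x| ≤ A) (hA' : ∀ x, |P' x| ≤ A') (hB : ∀ x, |Q x| ≤ B) :
    ∫ p : ℝ × ℝ, D2 u (1 :: l) t p.1 p.2 * (P p.1 * Q p.2)
      = -∫ p : ℝ × ℝ, D2 u l t p.1 p.2 * (P' p.1 * Q p.2) := by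
  have hPc : Continuous P := continuous_iff_continuousAt.2 fun x => (hP x).continuousAt
  have b1 : ∀ p : ℝ × ℝ, |P p.1 * Q p.2| ≤ A * B := fun p => by
    rw [abs_mul]
    exact mul_le_mul (hA _) (hB _) (abs_nonneg _) ((abs_nonneg _).trans (hA p.1))
  have b2 : ∀ p : ℝ × ℝ, |P' p.1 * Q p.2| ≤ A' * B := fun p => by
    rw [abs_mul]
    exact mul_le_mul (hA' _) (hB _) (abs_nonneg _) ((abs_nonneg _).trans (hA' p.1))
  have := integral_bilinear_hasLineDerivAt_right_eq_neg_left_of_integrable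
    (μ := (volume : Measure (ℝ × ℝ))) (v := ((1 : ℝ), (0 : ℝ)))
    (B := ContinuousLinearMap.mul ℝ ℝ)
    (f := fun p => D2 u l t p.1 p.2) (f' := fun p => D2 u (1 :: l) t p.1 p.2)
    (g := fun p => P p.1 * Q p.2) (g' := fun p => P' p.1 * Q p.2)
    (hu.integrable_D2_mul (1 :: l) ht (by fun_prop) b1)
    (hu.integrable_D2_mul l ht (by fun_prop) b2)
    (hu.integrable_D2_mul l ht (by fun_prop) b1)
    (fun p _ => ?_) (fun p _ => ?_)
  · simp only [ContinuousLinearMap.mul_apply'] at this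
    rw [this, neg_neg]
  · have h := (hu.hasDerivAt_x l t (p.1 + 0) p.2).comp_const_add p.1 0
    simpa [HasLineDerivAt] using h
  · have h := ((hP (p.1 + 0)).mul_const (Q p.2)).comp_const_add p.1 0
    simpa [HasLineDerivAt] using h

theorem integral_y_mul (hu : IsAdmissibleZK2 u) (l : List (Fin 3)) {t : ℝ} (ht : 2 ≤ t)
    {P Q Q' : ℝ → ℝ} (hQ : ∀ x, HasDerivAt Q (Q' x) x) (hQ' : Continuous Q') (hP : Continuous P)
    {A B B' : ℝ} (hA : ∀ x, |P x| ≤ A) (hB : ∀ x, |Q x| ≤ B) (hB' : ∀ x, |Q' x| ≤ B') :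
    ∫ p : ℝ × ℝ, D2 u (2 :: l) t p.1 p.2 * (P p.1 * Q p.2)
      = -∫ p : ℝ × ℝ, D2 u l t p.1 p.2 * (P p.1 * Q' p.2) := by
  have hQc : Continuous Q := continuous_iff_continuousAt.2 fun x => (hQ x).continuousAt
  have b1 : ∀ p : ℝ × ℝ, |P p.1 * Q p.2| ≤ A * B := fun p => by
    rw [abs_mul]
    exact mul_le_mul (hA _) (hB _) (abs_nonneg _) ((abs_nonneg _).trans (hA p.1))
  have b2 : ∀ p : ℝ × ℝ, |P p.1 * Q' p.2| ≤ A * B' := fun p => by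
    rw [abs_mul]
    exact mul_le_mul (hA _) (hB' _) (abs_nonneg _) ((abs_nonneg _).trans (hA p.1))
  have := integral_bilinear_hasLineDerivAt_right_eq_neg_left_of_integrable
    (μ := (volume : Measure (ℝ × ℝ))) (v := ((0 : ℝ), (1 : ℝ)))
    (B := ContinuousLinearMap.mul ℝ ℝ)
    (f := fun p => D2 u l t p.1 p.2) (f' := fun p => D2 u (2 :: l) t p.1 p.2)
    (g := fun p => P p.1 * Q p.2) (g' := fun p => P p.1 * Q' p.2)
    (hu.integrable_D2_mul (2 :: l) ht (by fun_prop) b1)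
    (hu.integrable_D2_mul l ht (by fun_prop) b2)
    (hu.integrable_D2_mul l ht (by fun_prop) b1)
    (fun p _ => ?_) (fun p _ => ?_)
  · simp only [ContinuousLinearMap.mul_apply'] at this
    rw [this, neg_neg]
  · have h := (hu.hasDerivAt_y l t p.1 (p.2 + 0)).comp_const_add p.2 0
    simpa [HasLineDerivAt] using h
  · have h := ((hQ (p.2 + 0)).const_mul (P p.1)).comp_const_add p.2 0
    simpa [HasLineDerivAt] using h

theorem integral_mul_x_mul (hu : IsAdmissibleZK2 u) {t : ℝ} (ht : 2 ≤ t)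
    {P P' Q : ℝ → ℝ} (hP : ∀ x, HasDerivAt P (P' x) x) (hP' : Continuous P') (hQ : Continuous Q)
    {A A' B : ℝ} (hA : ∀ x, |P x| ≤ A) (hA' : ∀ x, |P' x| ≤ A') (hB : ∀ x, |Q x| ≤ B) :
    ∫ p : ℝ × ℝ, u t p.1 p.2 * D2 u [1] t p.1 p.2 * (P p.1 * Q p.2)
      = -(1 / 2) * ∫ p : ℝ × ℝ, u t p.1 p.2 ^ 2 * (P' p.1 * Q p.2) := by
  have hPc : Continuous P := continuous_iff_continuousAt.2 fun x => (hP x).continuousAt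
  have b1 : ∀ p : ℝ × ℝ, |P p.1 * Q p.2| ≤ A * B := fun p => by
    rw [abs_mul]
    exact mul_le_mul (hA _) (hB _) (abs_nonneg _) ((abs_nonneg _).trans (hA p.1))
  have b2 : ∀ p : ℝ × ℝ, |P' p.1 * Q p.2| ≤ A' * B := fun p => by
    rw [abs_mul]
    exact mul_le_mul (hA' _) (hB _) (abs_nonneg _) ((abs_nonneg _).trans (hA' p.1))
  obtain ⟨C, hC⟩ := hu.exists_abs_D2_le [] ht
  have i1 : Integrable (fun p : ℝ × ℝ => 2 * u t p.1 p.2 * D2 u [1] t p.1 p.2 *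
      (P p.1 * Q p.2)) := by
    have h := (hu.integrable_D2_mul [1] ht
      (w := fun p => D2 u [] t p.1 p.2 * (P p.1 * Q p.2)) (K := C * (A * B))
      ((hu.continuous_D2 [] t).mul (by fun_prop)) (fun p => by
        rw [abs_mul]
        exact mul_le_mul (hC p) (b1 p) (abs_nonneg _) ((abs_nonneg _).trans (hC p)))).const_mul 2
    refine h.congr (Eventually.of_forall fun p => ?_)
    simp only [D2]
    ring
  have := integral_bilinear_hasLineDerivAt_right_eq_neg_left_of_integrable
    (μ := (volume : Measure (ℝ × ℝ))) (v := ((1 : ℝ), (0 : ℝ)))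
    (B := ContinuousLinearMap.mul ℝ ℝ)
    (f := fun p => u t p.1 p.2 ^ 2) (f' := fun p => 2 * u t p.1 p.2 * D2 u [1] t p.1 p.2)
    (g := fun p => P p.1 * Q p.2) (g' := fun p => P' p.1 * Q p.2)
    i1 (hu.integrable_sq_mul ht (by fun_prop) b2) (hu.integrable_sq_mul ht (by fun_prop) b1)
    (fun p _ => ?_) (fun p _ => ?_)
  · simp only [ContinuousLinearMap.mul_apply', mul_assoc (2 : ℝ)] at this
    rw [this, integral_const_mul]
    ring
  · have h := ((hu.hasDerivAt_x [] t (p.1 + 0) p.2).pow 2).comp_const_add p.1 0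
    simpa [HasLineDerivAt, D2] using h
  · have h := ((hP (p.1 + 0)).mul_const (Q p.2)).comp_const_add p.1 0
    simpa [HasLineDerivAt] using h

/-- The spatial part of the virial identity for a product weight. -/
theorem integral_t_mul (hu : IsAdmissibleZK2 u) {t : ℝ} (ht : 2 ≤ t)
    {P P₁ P₂ P₃ Q Q₁ Q₂ : ℝ → ℝ}
    (hP : ∀ x, HasDerivAt P (P₁ x) x) (hP₁ : ∀ x, HasDerivAt P₁ (P₂ x) x)
    (hP₂ : ∀ x, HasDerivAt P₂ (P₃ x) x) (hP₃ : Continuous P₃)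
    (hQ : ∀ x, HasDerivAt Q (Q₁ x) x) (hQ₁ : ∀ x, HasDerivAt Q₁ (Q₂ x) x) (hQ₂ : Continuous Q₂)
    {A A₁ A₂ A₃ B B₁ B₂ : ℝ} (hA : ∀ x, |P x| ≤ A) (hA₁ : ∀ x, |P₁ x| ≤ A₁)
    (hA₂ : ∀ x, |P₂ x| ≤ A₂) (hA₃ : ∀ x, |P₃ x| ≤ A₃)
    (hB : ∀ x, |Q x| ≤ B) (hB₁ : ∀ x, |Q₁ x| ≤ B₁) (hB₂ : ∀ x, |Q₂ x| ≤ B₂) :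
    ∫ p : ℝ × ℝ, D2 u [0] t p.1 p.2 * (P p.1 * Q p.2)
      = (∫ p : ℝ × ℝ, u t p.1 p.2 * (P₃ p.1 * Q p.2))
        + (∫ p : ℝ × ℝ, u t p.1 p.2 * (P₁ p.1 * Q₂ p.2))
        + (1 / 2) * ∫ p : ℝ × ℝ, u t p.1 p.2 ^ 2 * (P₁ p.1 * Q p.2) := by
  have cont : ∀ {f f' : ℝ → ℝ}, (∀ x, HasDerivAt f (f' x) x) → Continuous f :=
    fun h => continuous_iff_continuousAt.2 fun x => (h x).continuousAt
  have cP := cont hP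
  have cP₁ := cont hP₁
  have cP₂ := cont hP₂
  have cQ := cont hQ
  have cQ₁ := cont hQ₁
  have b1 : ∀ p : ℝ × ℝ, |P p.1 * Q p.2| ≤ A * B := fun p => by
    rw [abs_mul]
    exact mul_le_mul (hA _) (hB _) (abs_nonneg _) ((abs_nonneg _).trans (hA p.1))
  obtain ⟨C, hC⟩ := hu.exists_abs_D2_le [] ht
  have e1 := hu.integral_x_mul [1, 1] ht hP cP₁ cQ hA hA₁ hB
  have e2 := hu.integral_x_mul [1] ht hP₁ cP₂ cQ hA₁ hA₂ hB
  have e3 := hu.integral_x_mul [] ht hP₂ hP₃ cQ hA₂ hA₃ hB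
  have e4 := hu.integral_x_mul [2, 2] ht hP cP₁ cQ hA hA₁ hB
  have e5 := hu.integral_y_mul [2] ht hQ cQ₁ cP₁ hA₁ hB hB₁
  have e6 := hu.integral_y_mul [] ht hQ₁ hQ₂ cP₁ hA₁ hB₁ hB₂
  have e7 := hu.integral_mul_x_mul ht hP cP₁ cQ hA hA₁ hB
  have i1 := hu.integrable_D2_mul [1, 1, 1] ht (w := fun p => P p.1 * Q p.2) (by fun_prop) b1
  have i2 := hu.integrable_D2_mul [1, 2, 2] ht (w := fun p => P p.1 * Q p.2) (by fun_prop) b1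
  have i3 : Integrable (fun p : ℝ × ℝ => u t p.1 p.2 * D2 u [1] t p.1 p.2 *
      (P p.1 * Q p.2)) := by
    have h := hu.integrable_D2_mul [1] ht
      (w := fun p => D2 u [] t p.1 p.2 * (P p.1 * Q p.2)) (K := C * (A * B))
      ((hu.continuous_D2 [] t).mul (by fun_prop)) (fun p => by
        rw [abs_mul]
        exact mul_le_mul (hC p) (b1 p) (abs_nonneg _) ((abs_nonneg _).trans (hC p)))
    refine h.congr (Eventually.of_forall fun p => ?_)
    simp only [D2]
    ring
  have split : ∫ p : ℝ × ℝ, D2 u [0] t p.1 p.2 * (P p.1 * Q p.2)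
      = -((∫ p : ℝ × ℝ, D2 u [1, 1, 1] t p.1 p.2 * (P p.1 * Q p.2))
        + (∫ p : ℝ × ℝ, D2 u [1, 2, 2] t p.1 p.2 * (P p.1 * Q p.2))
        + ∫ p : ℝ × ℝ, u t p.1 p.2 * D2 u [1] t p.1 p.2 * (P p.1 * Q p.2)) := by
    rw [← integral_add i1 i2, ← integral_add (by exact i1.add i2) i3, ← integral_neg]
    congr 1 with p
    simp only [hu.eqn_D2 ht]
    ring
  rw [split, e1, e2, e3, e4, e5, e6, e7]
  simp only [D2]
  ring

end IsAdmissibleZK2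

/-- The profile `1 / (1 + z²)`, the derivative of `arctan`. -/
def bump (z : ℝ) : ℝ := (1 + z ^ 2)⁻¹

/-- The first derivative of `bump`. -/
def bump₁ (z : ℝ) : ℝ := -2 * z * bump z ^ 2

/-- The second derivative of `bump`. -/
def bump₂ (z : ℝ) : ℝ := -2 * bump z ^ 2 + 8 * z ^ 2 * bump z ^ 3

/-- The square root of `bump`, a square-integrable profile dominating all weights. -/
def rootBump (z : ℝ) : ℝ := √(bump z)

theorem bump_pos (z : ℝ) : 0 < bump z := by unfold bump; positivity

theorem one_add_sq_mul_bump (z : ℝ) : (1 + z ^ 2) * bump z = 1 :=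
  mul_inv_cancel₀ (by positivity)

theorem bump_le_one (z : ℝ) : bump z ≤ 1 :=
  inv_le_one_of_one_le₀ (by nlinarith [sq_nonneg z])

theorem sq_mul_bump_le_one (z : ℝ) : z ^ 2 * bump z ≤ 1 := by
  nlinarith [one_add_sq_mul_bump z, bump_pos z]

@[fun_prop]
theorem continuous_bump : Continuous bump :=
  Continuous.inv₀ (by fun_prop) fun z => by positivity

@[fun_prop]
theorem continuous_bump₁ : Continuous bump₁ := by unfold bump₁; fun_prop

@[fun_prop]
theorem continuous_bump₂ : Continuous bump₂ := by unfold bump₂; fun_prop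

theorem hasDerivAt_bump (z : ℝ) : HasDerivAt bump (bump₁ z) z := by
  have h := (((hasDerivAt_id z).pow 2).const_add 1).inv
    (show (1 : ℝ) + id z ^ 2 ≠ 0 by positivity)
  refine h.congr_deriv ?_
  simp only [bump₁, bump, id, Pi.pow_apply]
  field_simp
  simp [mul_comm]

theorem hasDerivAt_bump₁ (z : ℝ) : HasDerivAt bump₁ (bump₂ z) z := by
  have h := ((hasDerivAt_id z).const_mul (-2)).mul ((hasDerivAt_bump z).pow 2)
  refine h.congr_deriv ?_
  simp only [bump₁, bump₂, id, Pi.pow_apply]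
  ring

theorem rootBump_nonneg (z : ℝ) : 0 ≤ rootBump z := Real.sqrt_nonneg _

theorem rootBump_sq (z : ℝ) : rootBump z ^ 2 = bump z := Real.sq_sqrt (bump_pos z).le

theorem rootBump_le_one (z : ℝ) : rootBump z ≤ 1 :=
  Real.sqrt_le_one.2 (bump_le_one z)

theorem bump_le_rootBump (z : ℝ) : bump z ≤ rootBump z := by
  rw [← rootBump_sq]
  nlinarith [rootBump_nonneg z, rootBump_le_one z]

theorem abs_mul_bump_le (z : ℝ) : |z| * bump z ≤ rootBump z := by
  refine Real.le_sqrt_of_sq_le ?_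
  rw [mul_pow, sq_abs]
  nlinarith [mul_le_mul_of_nonneg_right (sq_mul_bump_le_one z) (bump_pos z).le]

theorem abs_bump₁_le (z : ℝ) : |bump₁ z| ≤ 2 * bump z := by
  have h := (abs_mul_bump_le z).trans (rootBump_le_one z)
  have h0 := bump_pos z
  rw [bump₁, abs_mul, abs_mul, abs_of_pos (pow_pos h0 2)]
  norm_num
  nlinarith

theorem abs_bump₂_le (z : ℝ) : |bump₂ z| ≤ 10 * bump z := by
  have h := sq_mul_bump_le_one z
  have h0 := bump_pos z
  have h1 := bump_le_one z
  have h2 : bump z ^ 2 ≤ bump z := by nlinarith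
  have h3 : z ^ 2 * bump z ^ 3 ≤ bump z := by nlinarith [pow_pos h0 2]
  have h4 : 0 ≤ z ^ 2 * bump z ^ 3 := by positivity
  rw [bump₂, abs_le]
  constructor <;> nlinarith [pow_pos h0 2]

theorem pi_div_two_sub_arctan_le {z : ℝ} (hz : 0 ≤ z) :
    Real.pi / 2 - Real.arctan z ≤ 2 * rootBump z := by
  have h0 : 0 ≤ Real.arctan z := Real.arctan_nonneg.2 hz
  have h1 := Real.arctan_lt_pi_div_two z
  have h2 := Real.mul_le_sin (x := Real.pi / 2 - Real.arctan z) (by linarith) (by linarith)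
  have h3 : Real.cos (Real.arctan z) = rootBump z := by
    rw [Real.cos_arctan, rootBump, bump, Real.sqrt_inv, one_div]
  rw [Real.sin_pi_div_two_sub, h3, div_mul_eq_mul_div, div_le_iff₀ Real.pi_pos] at h2
  nlinarith [Real.pi_le_four, rootBump_nonneg z]

theorem abs_arctan_sub_arctan_le {a a' : ℝ} (ha' : 0 ≤ a') (h : a' ≤ a) (z : ℝ) :
    |Real.arctan (z * a) - Real.arctan (z * a')| ≤ 2 * rootBump (z * a') := by
  have key : ∀ z : ℝ, 0 ≤ z →
      |Real.arctan (z * a) - Real.arctan (z * a')| ≤ 2 * rootBump (z * a') := fun z hz => by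
    have h1 := Real.arctan_mono (mul_le_mul_of_nonneg_left h hz)
    rw [abs_of_nonneg (by linarith)]
    linarith [Real.arctan_lt_pi_div_two (z * a), pi_div_two_sub_arctan_le (mul_nonneg hz ha')]
  rcases le_total 0 z with hz | hz
  · exact key z hz
  · have := key (-z) (by linarith)
    rw [neg_mul, neg_mul, Real.arctan_neg, Real.arctan_neg, ← neg_sub', abs_neg] at this
    simpa [rootBump, bump] using this

theorem integral_bump_affine {a : ℝ} (ha : 0 < a) (c : ℝ) :
    Integrable (fun x => bump ((x + c) * a)) ∧ ∫ x, bump ((x + c) * a) = Real.pi / a := by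
  constructor
  · exact ((integrable_inv_one_add_sq.comp_mul_right' ha.ne').comp_add_right c : _)
  · rw [integral_add_right_eq_self (fun x => bump (x * a)) c, Measure.integral_comp_mul_right,
      abs_of_pos (inv_pos.2 ha), smul_eq_mul]
    simp only [bump, integral_univ_inv_one_add_sq]
    field_simp

theorem integral_bump_mul_bump {a l : ℝ} (ha : 0 < a) (hl : 0 < l) (c d : ℝ) :
    Integrable (fun p : ℝ × ℝ => a * l * (bump ((p.1 + c) * a) * bump ((p.2 + d) * l))) ∧
      ∫ p : ℝ × ℝ, a * l * (bump ((p.1 + c) * a) * bump ((p.2 + d) * l)) = Real.pi ^ 2 := by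
  obtain ⟨i1, e1⟩ := integral_bump_affine ha c
  obtain ⟨i2, e2⟩ := integral_bump_affine hl d
  refine ⟨(i1.mul_prod i2).const_mul _, ?_⟩
  rw [integral_const_mul]
  have := integral_prod_mul (μ := volume) (ν := volume) (fun x => bump ((x + c) * a))
    (fun y => bump ((y + d) * l))
  rw [Measure.volume_eq_prod, this, e1, e2]
  field_simp

/-- A weighted arithmetic-geometric mean form of the Cauchy–Schwarz inequality against weights
dominated by two rescaled square-integrable profiles. -/
theorem abs_integral_mul_le_s2 {v Ψ : ℝ × ℝ → ℝ} {M : ℝ} (hv : Integrable fun p => v p ^ 2)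
    (hM : ∫ p, v p ^ 2 ≤ M) {a a' l s s' K K' c d : ℝ} (ha : 0 < a) (ha' : 0 < a') (hl : 0 < l)
    (hs : 0 < s) (hs' : 0 < s') (hsa : s ^ 2 * (a * l) = 1) (hsa' : s' ^ 2 * (a' * l) = 1)
    (hK : 0 ≤ K) (hK' : 0 ≤ K')
    (hΨ : ∀ p, |Ψ p| ≤ (K * rootBump ((p.1 + c) * a) + K' * rootBump ((p.1 + c) * a')) *
      rootBump ((p.2 + d) * l)) :
    |∫ p, v p * Ψ p| ≤ (K * s + K' * s') * ((M + Real.pi ^ 2) / 2) := by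
  have amgm : ∀ {a s : ℝ}, 0 < s → s ^ 2 * (a * l) = 1 → ∀ p : ℝ × ℝ,
      |v p| * (rootBump ((p.1 + c) * a) * rootBump ((p.2 + d) * l)) ≤
        s / 2 * (v p ^ 2 + a * l * (bump ((p.1 + c) * a) * bump ((p.2 + d) * l))) := by
    intro a s hs hsa p
    rw [← rootBump_sq, ← rootBump_sq, ← sq_abs (v p), ← mul_pow]
    generalize rootBump ((p.1 + c) * a) * rootBump ((p.2 + d) * l) = w
    have h : s * (a * l) = s⁻¹ := by
      field_simp
      linarith
    have h1 : s / 2 * (|v p| ^ 2 + a * l * w ^ 2) - |v p| * w = s / 2 * (|v p| - s⁻¹ * w) ^ 2 := by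
      have : s / 2 * (a * l * w ^ 2) = s⁻¹ / 2 * w ^ 2 := by rw [← h]; ring
      rw [mul_add, this]
      field_simp
      ring
    have h2 : 0 ≤ s / 2 * (|v p| - s⁻¹ * w) ^ 2 := by positivity
    linarith
  obtain ⟨i1, e1⟩ := integral_bump_mul_bump ha hl c d
  obtain ⟨i2, e2⟩ := integral_bump_mul_bump ha' hl c d
  have j1 := (hv.add i1).const_mul (K * (s / 2))
  have j2 := (hv.add i2).const_mul (K' * (s' / 2))
  have hle := norm_integral_le_of_norm_le (f := fun p => v p * Ψ p) (j1.add j2)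
    (Eventually.of_forall fun p => by
      rw [Real.norm_eq_abs, abs_mul]
      have h1 := mul_le_mul_of_nonneg_left (amgm hs hsa p) hK
      have h2 := mul_le_mul_of_nonneg_left (amgm hs' hsa' p) hK'
      have h3 := mul_le_mul_of_nonneg_left (hΨ p) (abs_nonneg (v p))
      simp only [Pi.add_apply]
      linarith)
  rw [integral_add' j1 j2, integral_const_mul, integral_const_mul, integral_add' hv i1,
    integral_add' hv i2, e1, e2, Real.norm_eq_abs] at hle
  refine hle.trans ?_
  have h1 : K * (s / 2) * (∫ p, v p ^ 2) ≤ K * (s / 2) * M := by gcongr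
  have h2 : K' * (s' / 2) * (∫ p, v p ^ 2) ≤ K' * (s' / 2) * M := by gcongr
  linarith

/-- The moving rescaled coordinate `(x + e t^m) / t^b`. -/
def movingCoord (e m b t x : ℝ) : ℝ := (x + e * t ^ m) * t ^ (-b)

/-- The time derivative of `movingCoord`. -/
def movingCoordDeriv (e m b t x : ℝ) : ℝ :=
  e * m * t ^ (m - 1) * t ^ (-b) + movingCoord e m b t x * (-b * t⁻¹)

/-- Controls the speed of `movingCoord`. -/
def movingSpeed (m b t : ℝ) : ℝ := |m| * t ^ (m - 1 - b) + |b| * t⁻¹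

theorem hasDerivAt_movingCoord (e m b x : ℝ) {t : ℝ} (ht : 0 < t) :
    HasDerivAt (fun t => movingCoord e m b t x) (movingCoordDeriv e m b t x) t := by
  have h1 := ((Real.hasDerivAt_rpow_const (p := m) (Or.inl ht.ne')).const_mul e).const_add x
  have h2 := Real.hasDerivAt_rpow_const (p := -b) (Or.inl ht.ne')
  refine (h1.mul h2).congr_deriv ?_
  rw [Real.rpow_sub_one ht.ne' (-b), movingCoordDeriv, movingCoord]
  ring

theorem movingSpeed_nonneg (m b : ℝ) {t : ℝ} (ht : 0 < t) : 0 ≤ movingSpeed m b t := by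
  unfold movingSpeed; positivity

theorem abs_bump_mul_movingCoordDeriv_le {e : ℝ} (he : |e| = 1) (m b x : ℝ) {t : ℝ}
    (ht : 0 < t) : bump (movingCoord e m b t x) * |movingCoordDeriv e m b t x| ≤
      movingSpeed m b t * rootBump (movingCoord e m b t x) := by
  rw [movingCoordDeriv, movingSpeed]
  generalize movingCoord e m b t x = z
  have h1 : |e * m * t ^ (m - 1) * t ^ (-b)| = |m| * t ^ (m - 1 - b) := by
    rw [mul_assoc, ← Real.rpow_add ht, abs_mul, abs_mul, he, one_mul,
      abs_of_pos (Real.rpow_pos_of_pos ht _), ← sub_eq_add_neg]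
  have h2 : |z * (-b * t⁻¹)| = |z| * (|b| * t⁻¹) := by
    rw [abs_mul, abs_mul, abs_neg, abs_of_pos (inv_pos.2 ht)]
  have h3 := abs_add_le (e * m * t ^ (m - 1) * t ^ (-b)) (z * (-b * t⁻¹))
  rw [h1, h2] at h3
  have hp : 0 ≤ |m| * t ^ (m - 1 - b) := by positivity
  have hq : 0 ≤ |b| * t⁻¹ := by positivity
  have h4 := mul_le_mul_of_nonneg_left h3 (bump_pos z).le
  have h5 := mul_le_mul_of_nonneg_right (bump_le_rootBump z) hp
  have h6 := mul_le_mul_of_nonneg_right (abs_mul_bump_le z) hq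
  linarith

@[fun_prop]
theorem continuous_movingCoord (e m b t : ℝ) : Continuous (movingCoord e m b t) := by
  unfold movingCoord; fun_prop

@[fun_prop]
theorem continuous_movingCoordDeriv (e m b t : ℝ) : Continuous (movingCoordDeriv e m b t) := by
  unfold movingCoordDeriv; fun_prop

theorem continuousOn_movingSpeed (m b : ℝ) : ContinuousOn (movingSpeed m b) (Set.Ioi 0) := by
  unfold movingSpeed
  refine ContinuousOn.add (continuousOn_const.mul fun t ht => ?_)
    (continuousOn_const.mul fun t ht => ?_)
  · exact (Real.continuousAt_rpow_const _ _ (Or.inl (ne_of_gt ht))).continuousWithinAt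
  · exact (continuousAt_inv₀ (ne_of_gt ht)).continuousWithinAt

/-- The `x`-dependent factor of the virial weight: a difference of two `arctan` profiles at the
scales `t^b` and `t^β`. -/
def weightX (e m b β t x : ℝ) : ℝ :=
  Real.arctan (movingCoord e m b t x) - Real.arctan (movingCoord e m β t x)

/-- The time derivative of the product weight. -/
def weightDeriv (e₁ e₂ m n b β k t : ℝ) (p : ℝ × ℝ) : ℝ :=
  (bump (movingCoord e₁ m b t p.1) * movingCoordDeriv e₁ m b t p.1
      - bump (movingCoord e₁ m β t p.1) * movingCoordDeriv e₁ m β t p.1)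
      * bump (movingCoord e₂ n k t p.2)
    + weightX e₁ m b β t p.1
      * (bump₁ (movingCoord e₂ n k t p.2) * movingCoordDeriv e₂ n k t p.2)

theorem hasDerivAt_weight (e₁ e₂ m n b β k : ℝ) (p : ℝ × ℝ) {t : ℝ} (ht : 0 < t) :
    HasDerivAt (fun t => weightX e₁ m b β t p.1 * bump (movingCoord e₂ n k t p.2))
      (weightDeriv e₁ e₂ m n b β k t p) t := by
  have h1 := (hasDerivAt_movingCoord e₁ m b p.1 ht).arctan
  have h2 := (hasDerivAt_movingCoord e₁ m β p.1 ht).arctan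
  have h3 := (hasDerivAt_bump _).comp t (hasDerivAt_movingCoord e₂ n k p.2 ht)
  refine ((h1.sub h2).mul h3).congr_deriv ?_
  simp only [weightDeriv, weightX, bump, one_div, Function.comp, Pi.sub_apply]

@[fun_prop]
theorem continuous_weightX (e m b β t : ℝ) : Continuous (weightX e m b β t) := by
  unfold weightX
  exact (Real.continuous_arctan.comp (continuous_movingCoord ..)).sub
    (Real.continuous_arctan.comp (continuous_movingCoord ..))

theorem continuous_weightDeriv (e₁ e₂ m n b β k t : ℝ) :
    Continuous (weightDeriv e₁ e₂ m n b β k t) := by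
  unfold weightDeriv
  have h₁ := continuous_bump
  have h₂ := continuous_bump₁
  fun_prop

theorem abs_weightX_le (e m x : ℝ) {b β t : ℝ} (hb : b ≤ β) (ht : 1 ≤ t) :
    |weightX e m b β t x| ≤ 2 * rootBump (movingCoord e m β t x) :=
  abs_arctan_sub_arctan_le (by positivity)
    (Real.rpow_le_rpow_of_exponent_le ht (neg_le_neg hb)) _

theorem abs_weightDeriv_le {e₁ e₂ : ℝ} (he₁ : |e₁| = 1) (he₂ : |e₂| = 1) (m n k : ℝ)
    {b β t : ℝ} (hb : b ≤ β) (ht : 1 ≤ t) (p : ℝ × ℝ) :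
    |weightDeriv e₁ e₂ m n b β k t p| ≤
      (movingSpeed m b t * rootBump (movingCoord e₁ m b t p.1)
        + (movingSpeed m β t + 4 * movingSpeed n k t) * rootBump (movingCoord e₁ m β t p.1))
        * rootBump (movingCoord e₂ n k t p.2) := by
  have ht0 : 0 < t := by linarith
  have hA := abs_bump_mul_movingCoordDeriv_le he₁ m b p.1 ht0
  have hB := abs_bump_mul_movingCoordDeriv_le he₁ m β p.1 ht0
  have hY := abs_bump_mul_movingCoordDeriv_le he₂ n k p.2 ht0
  have hD := abs_weightX_le e₁ m p.1 hb ht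
  have sA := movingSpeed_nonneg m b ht0
  have sB := movingSpeed_nonneg m β ht0
  have sY := movingSpeed_nonneg n k ht0
  rw [weightDeriv]
  generalize movingCoord e₁ m b t p.1 = zA at *
  generalize movingCoord e₁ m β t p.1 = zB at *
  generalize movingCoord e₂ n k t p.2 = zY at *
  generalize movingCoordDeriv e₁ m b t p.1 = dA at *
  generalize movingCoordDeriv e₁ m β t p.1 = dB at *
  generalize movingCoordDeriv e₂ n k t p.2 = dY at *
  have h1 : |(bump zA * dA - bump zB * dB) * bump zY| ≤
      (movingSpeed m b t * rootBump zA + movingSpeed m β t * rootBump zB) * rootBump zY := by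
    rw [abs_mul, abs_of_pos (bump_pos zY)]
    refine mul_le_mul ((abs_sub _ _).trans ?_) (bump_le_rootBump _) (bump_pos _).le
      (add_nonneg (mul_nonneg sA (rootBump_nonneg _)) (mul_nonneg sB (rootBump_nonneg _)))
    rw [abs_mul, abs_mul, abs_of_pos (bump_pos zA), abs_of_pos (bump_pos zB)]
    exact add_le_add hA hB
  have h2 : |bump₁ zY * dY| ≤ 2 * (movingSpeed n k t * rootBump zY) := by
    rw [abs_mul]
    have := mul_le_mul_of_nonneg_right (abs_bump₁_le zY) (abs_nonneg dY)
    linarith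
  have h3 := mul_le_mul hD h2 (abs_nonneg _) (mul_nonneg zero_le_two (rootBump_nonneg zB))
  rw [← abs_mul] at h3
  refine (abs_add_le _ _).trans ((add_le_add h1 h3).trans (le_of_eq ?_))
  ring

theorem abs_weight_le_two (e₁ e₂ m n k : ℝ) {b β t : ℝ} (hb : b ≤ β) (ht : 1 ≤ t)
    (p : ℝ × ℝ) :
    |weightX e₁ m b β t p.1 * bump (movingCoord e₂ n k t p.2)| ≤ 2 := by
  rw [abs_mul, abs_of_pos (bump_pos _)]
  have h1 := abs_weightX_le e₁ m p.1 hb ht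
  have h2 := rootBump_le_one (movingCoord e₁ m β t p.1)
  have h3 := bump_le_one (movingCoord e₂ n k t p.2)
  nlinarith [abs_nonneg (weightX e₁ m b β t p.1), bump_pos (movingCoord e₂ n k t p.2)]

theorem hasDerivAt_movingCoord_space (e m b t x : ℝ) :
    HasDerivAt (movingCoord e m b t) (t ^ (-b)) x :=
  (((hasDerivAt_id x).add_const (e * t ^ m)).mul_const (t ^ (-b))).congr_deriv (one_mul _)

namespace IsAdmissibleZK2

variable {u : ℝ → ℝ → ℝ → ℝ}

theorem hasDerivAt_integral (hu : IsAdmissibleZK2 u) {e₁ e₂ : ℝ} (he₁ : |e₁| = 1)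
    (he₂ : |e₂| = 1) (m n k : ℝ) {b β t : ℝ} (hb : b ≤ β) (ht : 2 < t) :
    HasDerivAt (fun t => ∫ p : ℝ × ℝ, u t p.1 p.2 *
        (weightX e₁ m b β t p.1 * bump (movingCoord e₂ n k t p.2)))
      ((∫ p : ℝ × ℝ, D2 u [0] t p.1 p.2 *
          (weightX e₁ m b β t p.1 * bump (movingCoord e₂ n k t p.2)))
        + ∫ p : ℝ × ℝ, u t p.1 p.2 * weightDeriv e₁ e₂ m n b β k t p) t := by
  have hb₁ := continuous_bump
  have hI : ∀ s ∈ Set.Icc 2 (t + 1), 1 ≤ s := fun s hs => by linarith [hs.1]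
  have bound : ∀ s ∈ Set.Icc 2 (t + 1), ∀ p, |weightDeriv e₁ e₂ m n b β k s p| ≤
      movingSpeed m b s + (movingSpeed m β s + 4 * movingSpeed n k s) := fun s hs p => by
    have h0 : 0 < s := by linarith [hI s hs]
    refine (abs_weightDeriv_le he₁ he₂ m n k hb (hI s hs) p).trans ?_
    have sA := movingSpeed_nonneg m b h0
    have sB := movingSpeed_nonneg m β h0
    have sY := movingSpeed_nonneg n k h0
    have h1 := mul_le_of_le_one_right sA (rootBump_le_one (movingCoord e₁ m b s p.1))
    have h2 := mul_le_of_le_one_right (add_nonneg sB (mul_nonneg zero_le_four sY))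
      (rootBump_le_one (movingCoord e₁ m β s p.1))
    refine (mul_le_of_le_one_right ?_ (rootBump_le_one _)).trans (add_le_add h1 h2)
    have := rootBump_nonneg (movingCoord e₁ m b s p.1)
    have := rootBump_nonneg (movingCoord e₁ m β s p.1)
    positivity
  obtain ⟨K, hK⟩ : ∃ K, ∀ s ∈ Set.Icc 2 (t + 1),
      movingSpeed m b s + (movingSpeed m β s + 4 * movingSpeed n k s) ≤ K := by
    have hc : ContinuousOn (fun s => movingSpeed m b s +
        (movingSpeed m β s + 4 * movingSpeed n k s)) (Set.Icc 2 (t + 1)) :=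
      ((continuousOn_movingSpeed m b).add ((continuousOn_movingSpeed m β).add
        (continuousOn_const.mul (continuousOn_movingSpeed n k)))).mono
        fun s hs => lt_of_lt_of_le two_pos hs.1
    obtain ⟨K, hK⟩ := isCompact_Icc.exists_bound_of_continuousOn hc
    exact ⟨K, fun s hs => (le_abs_self _).trans (hK s hs)⟩
  obtain ⟨C₀, hC₀, h₀⟩ := hu.exists_bound_s2 [] le_rfl (t + 1)
  obtain ⟨C₁, hC₁, h₁⟩ := hu.exists_bound_s2 [0] le_rfl (t + 1)
  have htI : t ∈ Set.Icc 2 (t + 1) := ⟨ht.le, by linarith⟩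
  have hmeas : ∀ s, Continuous fun p : ℝ × ℝ => u s p.1 p.2 *
      (weightX e₁ m b β s p.1 * bump (movingCoord e₂ n k s p.2)) := fun s =>
    (hu.continuous_D2 [] s).mul (by fun_prop)
  have hint₁ := hu.integrable_D2_mul [0] ht.le
    (w := fun p => weightX e₁ m b β t p.1 * bump (movingCoord e₂ n k t p.2))
    (by fun_prop) (abs_weight_le_two e₁ e₂ m n k hb (hI t htI))
  have hint₂ := hu.integrable_D2_mul [] ht.le
    (continuous_weightDeriv e₁ e₂ m n b β k t) (bound t htI)
  rw [← integral_add hint₁ (by exact hint₂)]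
  refine (hasDerivAt_integral_of_dominated_loc_of_deriv_le (s := Set.Icc 2 (t + 1))
    (F' := fun s p => D2 u [0] s p.1 p.2 *
      (weightX e₁ m b β s p.1 * bump (movingCoord e₂ n k s p.2))
        + u s p.1 p.2 * weightDeriv e₁ e₂ m n b β k s p)
    (bound := fun p => (C₁ * 2 + C₀ * K) * (1 + ‖p‖) ^ (-3 : ℝ))
    (Icc_mem_nhds ht (by linarith))
    (Eventually.of_forall fun s => (hmeas s).aestronglyMeasurable)
    (hu.integrable_D2_mul [] ht.le (by fun_prop)
      (abs_weight_le_two e₁ e₂ m n k hb (hI t htI)))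
    (hint₁.add hint₂).aestronglyMeasurable
    (Eventually.of_forall fun p s hs => ?_) (integrable_weight.const_mul _)
    (Eventually.of_forall fun p s hs => ?_)).2
  · rw [Real.norm_eq_abs]
    refine (abs_add_le _ _).trans ?_
    rw [abs_mul (D2 u [0] s p.1 p.2), abs_mul (u s p.1 p.2)]
    have i1 := mul_le_mul (h₁ s hs p) (abs_weight_le_two e₁ e₂ m n k hb (hI s hs) p)
      (abs_nonneg _) (by positivity)
    have i2 := mul_le_mul (h₀ s hs p) ((bound s hs p).trans (hK s hs))
      (abs_nonneg _) (by positivity)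
    refine (add_le_add i1 i2).trans (le_of_eq ?_)
    ring
  · exact (hu.hasDerivAt_t [] s p.1 p.2).mul
      (hasDerivAt_weight e₁ e₂ m n b β k p (by linarith [hI s hs]))

theorem integral_weight_eq (hu : IsAdmissibleZK2 u) (e₁ e₂ m n k : ℝ) {b β t : ℝ} (hb : b ≤ β)
    (ht : 2 ≤ t) :
    ∫ p : ℝ × ℝ, D2 u [0] t p.1 p.2 *
        (weightX e₁ m b β t p.1 * bump (movingCoord e₂ n k t p.2))
      = (∫ p : ℝ × ℝ, u t p.1 p.2 *
          (((t ^ (-b)) ^ 3 * bump₂ (movingCoord e₁ m b t p.1)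
            - (t ^ (-β)) ^ 3 * bump₂ (movingCoord e₁ m β t p.1))
            * bump (movingCoord e₂ n k t p.2)))
        + (∫ p : ℝ × ℝ, u t p.1 p.2 *
          ((t ^ (-b) * bump (movingCoord e₁ m b t p.1)
            - t ^ (-β) * bump (movingCoord e₁ m β t p.1))
            * ((t ^ (-k)) ^ 2 * bump₂ (movingCoord e₂ n k t p.2))))
        + (1 / 2) * ∫ p : ℝ × ℝ, u t p.1 p.2 ^ 2 *
          ((t ^ (-b) * bump (movingCoord e₁ m b t p.1)
            - t ^ (-β) * bump (movingCoord e₁ m β t p.1))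
            * bump (movingCoord e₂ n k t p.2)) := by
  have ht1 : 1 ≤ t := by linarith
  have a0 : 0 ≤ t ^ (-b) := by positivity
  have a0' : 0 ≤ t ^ (-β) := by positivity
  have l0 : 0 ≤ t ^ (-k) := by positivity
  have bd : ∀ z, |bump z| ≤ 1 := fun z => by
    rw [abs_of_pos (bump_pos z)]; exact bump_le_one z
  have bd₁ : ∀ z, |bump₁ z| ≤ 2 := fun z => by linarith [abs_bump₁_le z, bump_le_one z]
  have bd₂ : ∀ z, |bump₂ z| ≤ 10 := fun z => by linarith [abs_bump₂_le z, bump_le_one z]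
  have sub_bd : ∀ {f : ℝ → ℝ} {C : ℝ}, (∀ z, |f z| ≤ C) → ∀ {a a' : ℝ}, 0 ≤ a → 0 ≤ a' →
      ∀ z z', |a * f z - a' * f z'| ≤ a * C + a' * C := fun hf a a' ha ha' z z' => by
    refine (abs_sub _ _).trans ?_
    rw [abs_mul, abs_mul, abs_of_nonneg ha, abs_of_nonneg ha']
    exact add_le_add (mul_le_mul_of_nonneg_left (hf z) ha) (mul_le_mul_of_nonneg_left (hf z') ha')
  have mul_bd : ∀ {f : ℝ → ℝ} {C : ℝ}, (∀ z, |f z| ≤ C) → ∀ {a : ℝ}, 0 ≤ a →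
      ∀ z, |a * f z| ≤ a * C := fun hf a ha z => by
    rw [abs_mul, abs_of_nonneg ha]
    exact mul_le_mul_of_nonneg_left (hf z) ha
  have comp : ∀ {f f' : ℝ → ℝ}, (∀ z, HasDerivAt f (f' z) z) → ∀ e m b x,
      HasDerivAt (fun x => f (movingCoord e m b t x)) (f' (movingCoord e m b t x) * t ^ (-b)) x :=
    fun hf e m b x => (hf _).comp x (hasDerivAt_movingCoord_space e m b t x)
  have dAt : ∀ z, HasDerivAt Real.arctan (bump z) z := Real.hasDerivAt_arctan'
  have hb₁ := continuous_bump
  have hb₂ := continuous_bump₂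
  exact hu.integral_t_mul ht (P := weightX e₁ m b β t)
    (P₁ := fun x => t ^ (-b) * bump (movingCoord e₁ m b t x)
      - t ^ (-β) * bump (movingCoord e₁ m β t x))
    (P₂ := fun x => (t ^ (-b)) ^ 2 * bump₁ (movingCoord e₁ m b t x)
      - (t ^ (-β)) ^ 2 * bump₁ (movingCoord e₁ m β t x))
    (P₃ := fun x => (t ^ (-b)) ^ 3 * bump₂ (movingCoord e₁ m b t x)
      - (t ^ (-β)) ^ 3 * bump₂ (movingCoord e₁ m β t x))
    (Q := fun y => bump (movingCoord e₂ n k t y))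
    (Q₁ := fun y => t ^ (-k) * bump₁ (movingCoord e₂ n k t y))
    (Q₂ := fun y => (t ^ (-k)) ^ 2 * bump₂ (movingCoord e₂ n k t y))
    (fun x => ((comp dAt e₁ m b x).sub (comp dAt e₁ m β x)).congr_deriv (by ring))
    (fun x => (((comp hasDerivAt_bump e₁ m b x).const_mul _).sub
      ((comp hasDerivAt_bump e₁ m β x).const_mul _)).congr_deriv (by ring))
    (fun x => (((comp hasDerivAt_bump₁ e₁ m b x).const_mul _).sub
      ((comp hasDerivAt_bump₁ e₁ m β x).const_mul _)).congr_deriv (by ring))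
    (by fun_prop)
    (fun y => (comp hasDerivAt_bump e₂ n k y).congr_deriv (by ring))
    (fun y => ((comp hasDerivAt_bump₁ e₂ n k y).const_mul _).congr_deriv (by ring))
    (by fun_prop)
    (fun x => (abs_weightX_le e₁ m x hb ht1).trans
      (mul_le_mul_of_nonneg_left (rootBump_le_one _) zero_le_two))
    (fun x => sub_bd bd a0 a0' _ _)
    (fun x => sub_bd bd₁ (pow_nonneg a0 2) (pow_nonneg a0' 2) _ _)
    (fun x => sub_bd bd₂ (pow_nonneg a0 3) (pow_nonneg a0' 3) _ _)
    (fun y => bd _) (fun y => mul_bd bd₁ l0 _) (fun y => mul_bd bd₂ (pow_nonneg l0 2) _)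

end IsAdmissibleZK2

theorem rpow_half_sq_mul {t : ℝ} (ht : 0 < t) (b k : ℝ) :
    (t ^ ((b + k) / 2)) ^ 2 * (t ^ (-b) * t ^ (-k)) = 1 := by
  rw [← Real.rpow_natCast, ← Real.rpow_mul ht.le, ← Real.rpow_add ht, ← Real.rpow_add ht,
    ← Real.rpow_zero t]
  congr 1
  push_cast
  ring

/-- The error in the virial inequality, up to the contribution of the outer scale to the
quadratic term. -/
def virialError (m n b β k t : ℝ) : ℝ :=
  (movingSpeed m b t + 10 * (t ^ (-b)) ^ 3 + 10 * (t ^ (-b) * (t ^ (-k)) ^ 2)) *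
      t ^ ((b + k) / 2)
    + (movingSpeed m β t + 4 * movingSpeed n k t + 10 * (t ^ (-β)) ^ 3
      + 10 * (t ^ (-β) * (t ^ (-k)) ^ 2)) * t ^ ((β + k) / 2)

namespace IsAdmissibleZK2

variable {u : ℝ → ℝ → ℝ → ℝ}

theorem abs_integral_mul_le_of_moving (hu : IsAdmissibleZK2 u) {M t : ℝ} (ht : 2 ≤ t)
    (hM : ∫ p : ℝ × ℝ, u t p.1 p.2 ^ 2 ≤ M) (e₁ e₂ m n b β k : ℝ) {K K' : ℝ} (hK : 0 ≤ K)
    (hK' : 0 ≤ K') {Ψ : ℝ × ℝ → ℝ}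
    (hΨ : ∀ p : ℝ × ℝ, |Ψ p| ≤ (K * rootBump (movingCoord e₁ m b t p.1)
      + K' * rootBump (movingCoord e₁ m β t p.1)) * rootBump (movingCoord e₂ n k t p.2)) :
    |∫ p : ℝ × ℝ, u t p.1 p.2 * Ψ p| ≤
      (K * t ^ ((b + k) / 2) + K' * t ^ ((β + k) / 2)) * ((M + Real.pi ^ 2) / 2) := by
  have h0 : 0 < t := by linarith
  have pos : ∀ x : ℝ, 0 < t ^ x := fun x => Real.rpow_pos_of_pos h0 x
  exact abs_integral_mul_le_s2 (hu.integrable_sq_s2 ht) hM (pos _) (pos _) (pos _) (pos _) (pos _)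
    (rpow_half_sq_mul h0 b k) (rpow_half_sq_mul h0 β k) hK hK' hΨ

theorem setIntegral_le_integral_weight (hu : IsAdmissibleZK2 u) {t : ℝ} (ht : 2 ≤ t)
    (e₁ e₂ m n b k : ℝ) :
    ∫ p in {q : ℝ × ℝ | |q.1 + e₁ * t ^ m| < t ^ b ∧ |q.2 + e₂ * t ^ n| < t ^ k},
        u t p.1 p.2 ^ 2 ≤
      4 * ∫ p : ℝ × ℝ, u t p.1 p.2 ^ 2 *
        (bump (movingCoord e₁ m b t p.1) * bump (movingCoord e₂ n k t p.2)) := by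
  have h0 : 0 < t := by linarith
  have half : ∀ e m b x : ℝ, |x + e * t ^ m| < t ^ b →
      1 / 2 ≤ bump (movingCoord e m b t x) := fun e m b x hx => by
    have h1 : |movingCoord e m b t x| < 1 := by
      rw [movingCoord, abs_mul, abs_of_pos (Real.rpow_pos_of_pos h0 _), Real.rpow_neg h0.le,
        ← div_eq_mul_inv, div_lt_one (Real.rpow_pos_of_pos h0 _)]
      exact hx
    have h2 : movingCoord e m b t x ^ 2 ≤ 1 := (sq_le_one_iff_abs_le_one _).2 h1.le
    rw [bump, one_div]
    exact inv_anti₀ (by positivity) (by linarith)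
  have o₁ : IsOpen {q : ℝ × ℝ | |q.1 + e₁ * t ^ m| < t ^ b} :=
    isOpen_lt (by fun_prop) (by fun_prop)
  have o₂ : IsOpen {q : ℝ × ℝ | |q.2 + e₂ * t ^ n| < t ^ k} :=
    isOpen_lt (by fun_prop) (by fun_prop)
  have hmeas : MeasurableSet
      {q : ℝ × ℝ | |q.1 + e₁ * t ^ m| < t ^ b ∧ |q.2 + e₂ * t ^ n| < t ^ k} :=
    (o₁.inter o₂).measurableSet
  have hb₁ := continuous_bump
  have hint := (hu.integrable_sq_mul ht
    (w := fun p => bump (movingCoord e₁ m b t p.1) * bump (movingCoord e₂ n k t p.2))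
    (by fun_prop) (K := 1) fun p => by
      rw [abs_of_pos (mul_pos (bump_pos _) (bump_pos _))]
      exact mul_le_one₀ (bump_le_one _) (bump_pos _).le (bump_le_one _)).const_mul 4
  rw [← integral_const_mul]
  refine le_trans (setIntegral_mono_on (hu.integrable_sq_s2 ht).integrableOn hint.integrableOn hmeas
    fun p hp => ?_) (setIntegral_le_integral hint (Eventually.of_forall fun p => ?_))
  · have h1 := half e₁ m b p.1 hp.1
    have h2 := half e₂ n k p.2 hp.2
    have h3 := mul_le_mul h1 h2 (by norm_num) (bump_pos _).le
    have h4 := mul_le_mul_of_nonneg_left h3 (sq_nonneg (u t p.1 p.2))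
    linarith
  · have := bump_pos (movingCoord e₁ m b t p.1)
    have := bump_pos (movingCoord e₂ n k t p.2)
    simp only [Pi.zero_apply]
    positivity

theorem abs_integral_weight_le (hu : IsAdmissibleZK2 u) {M t : ℝ} (ht : 2 ≤ t)
    (hM : ∫ p : ℝ × ℝ, u t p.1 p.2 ^ 2 ≤ M) (e₁ e₂ m n k : ℝ) {b β : ℝ} (hb : b ≤ β) :
    |∫ p : ℝ × ℝ, u t p.1 p.2 * (weightX e₁ m b β t p.1 * bump (movingCoord e₂ n k t p.2))| ≤
      2 * t ^ ((β + k) / 2) * ((M + Real.pi ^ 2) / 2) := by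
  have := hu.abs_integral_mul_le_of_moving ht hM e₁ e₂ m n b β k le_rfl zero_le_two
    (Ψ := fun p => weightX e₁ m b β t p.1 * bump (movingCoord e₂ n k t p.2)) fun p => by
      rw [abs_mul, abs_of_pos (bump_pos _), zero_mul, zero_add]
      exact mul_le_mul (abs_weightX_le e₁ m p.1 hb (by linarith)) (bump_le_rootBump _)
        (bump_pos _).le (mul_nonneg zero_le_two (rootBump_nonneg _))
  simpa using this

/-- The virial inequality: the local mass controls the growth of the weighted integral. -/
theorem virial (hu : IsAdmissibleZK2 u) {M t : ℝ} (ht : 2 < t)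
    (hM : ∫ p : ℝ × ℝ, u t p.1 p.2 ^ 2 ≤ M) {e₁ e₂ : ℝ} (he₁ : |e₁| = 1) (he₂ : |e₂| = 1)
    (m n k : ℝ) {b β : ℝ} (hb : b ≤ β) :
    ∃ J', HasDerivAt (fun t => ∫ p : ℝ × ℝ, u t p.1 p.2 *
        (weightX e₁ m b β t p.1 * bump (movingCoord e₂ n k t p.2))) J' t ∧
      (1 / 8) * t ^ (-b) *
        (∫ p in {q : ℝ × ℝ | |q.1 + e₁ * t ^ m| < t ^ b ∧ |q.2 + e₂ * t ^ n| < t ^ k},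
          u t p.1 p.2 ^ 2)
        - virialError m n b β k t * ((M + Real.pi ^ 2) / 2) - (1 / 2) * t ^ (-β) * M ≤ J' := by
  refine ⟨_, hu.hasDerivAt_integral he₁ he₂ m n k hb ht, ?_⟩
  rw [hu.integral_weight_eq e₁ e₂ m n k hb ht.le]
  have h0 : 0 < t := by linarith
  have a0 : 0 < t ^ (-b) := Real.rpow_pos_of_pos h0 _
  have a0' : 0 < t ^ (-β) := Real.rpow_pos_of_pos h0 _
  have l0 : 0 < t ^ (-k) := Real.rpow_pos_of_pos h0 _
  have sA := movingSpeed_nonneg m b h0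
  have sB := movingSpeed_nonneg m β h0
  have sY := movingSpeed_nonneg n k h0
  have E₁ := hu.abs_integral_mul_le_of_moving ht.le hM e₁ e₂ m n b β k sA (by positivity)
    (abs_weightDeriv_le he₁ he₂ m n k hb (by linarith))
  have root₂ : ∀ z, |bump₂ z| ≤ 10 * rootBump z := fun z =>
    (abs_bump₂_le z).trans (by linarith [bump_le_rootBump z])
  have E₂ := hu.abs_integral_mul_le_of_moving ht.le hM e₁ e₂ m n b β k
    (K := 10 * (t ^ (-b)) ^ 3) (K' := 10 * (t ^ (-β)) ^ 3) (by positivity) (by positivity)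
    (Ψ := fun p => ((t ^ (-b)) ^ 3 * bump₂ (movingCoord e₁ m b t p.1)
            - (t ^ (-β)) ^ 3 * bump₂ (movingCoord e₁ m β t p.1))
            * bump (movingCoord e₂ n k t p.2)) fun p => by
      have r1 := rootBump_nonneg (movingCoord e₁ m b t p.1)
      have r2 := rootBump_nonneg (movingCoord e₁ m β t p.1)
      rw [abs_mul, abs_of_pos (bump_pos _)]
      refine mul_le_mul ((abs_sub _ _).trans ?_) (bump_le_rootBump _) (bump_pos _).le
        (by positivity)
      rw [abs_mul, abs_mul, abs_of_pos (pow_pos a0 3), abs_of_pos (pow_pos a0' 3)]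
      have h1 := mul_le_mul_of_nonneg_left (root₂ (movingCoord e₁ m b t p.1)) (pow_pos a0 3).le
      have h2 := mul_le_mul_of_nonneg_left (root₂ (movingCoord e₁ m β t p.1)) (pow_pos a0' 3).le
      linarith
  have E₃ := hu.abs_integral_mul_le_of_moving ht.le hM e₁ e₂ m n b β k
    (K := 10 * (t ^ (-b) * (t ^ (-k)) ^ 2)) (K' := 10 * (t ^ (-β) * (t ^ (-k)) ^ 2))
    (by positivity) (by positivity)
    (Ψ := fun p => (t ^ (-b) * bump (movingCoord e₁ m b t p.1)
            - t ^ (-β) * bump (movingCoord e₁ m β t p.1))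
            * ((t ^ (-k)) ^ 2 * bump₂ (movingCoord e₂ n k t p.2))) fun p => by
      have r1 := rootBump_nonneg (movingCoord e₁ m b t p.1)
      have r2 := rootBump_nonneg (movingCoord e₁ m β t p.1)
      have h1 : |t ^ (-b) * bump (movingCoord e₁ m b t p.1)
          - t ^ (-β) * bump (movingCoord e₁ m β t p.1)| ≤
          t ^ (-b) * rootBump (movingCoord e₁ m b t p.1)
            + t ^ (-β) * rootBump (movingCoord e₁ m β t p.1) := by
        refine (abs_sub _ _).trans ?_
        rw [abs_mul, abs_mul, abs_of_pos a0, abs_of_pos a0', abs_of_pos (bump_pos _),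
          abs_of_pos (bump_pos _)]
        exact add_le_add (mul_le_mul_of_nonneg_left (bump_le_rootBump _) a0.le)
          (mul_le_mul_of_nonneg_left (bump_le_rootBump _) a0'.le)
      have h2 : |(t ^ (-k)) ^ 2 * bump₂ (movingCoord e₂ n k t p.2)| ≤
          (t ^ (-k)) ^ 2 * (10 * rootBump (movingCoord e₂ n k t p.2)) := by
        rw [abs_mul, abs_of_pos (pow_pos l0 2)]
        exact mul_le_mul_of_nonneg_left (root₂ _) (pow_pos l0 2).le
      rw [abs_mul]
      refine (mul_le_mul h1 h2 (abs_nonneg _) (by positivity)).trans (le_of_eq ?_)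
      ring
  have main := hu.setIntegral_le_integral_weight ht.le e₁ e₂ m n b k
  have hb₁ := continuous_bump
  have prod_le : ∀ z w, |bump z * bump w| ≤ 1 := fun z w => by
    rw [abs_of_pos (mul_pos (bump_pos _) (bump_pos _))]
    exact mul_le_one₀ (bump_le_one _) (bump_pos _).le (bump_le_one _)
  have i₁ := hu.integrable_sq_mul ht.le
    (w := fun p => bump (movingCoord e₁ m b t p.1) * bump (movingCoord e₂ n k t p.2))
    (by fun_prop) (K := 1) fun p => prod_le _ _
  have i₂ := hu.integrable_sq_mul ht.le
    (w := fun p => bump (movingCoord e₁ m β t p.1) * bump (movingCoord e₂ n k t p.2))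
    (by fun_prop) (K := 1) fun p => prod_le _ _
  have outer : ∫ p : ℝ × ℝ, u t p.1 p.2 ^ 2 *
      (bump (movingCoord e₁ m β t p.1) * bump (movingCoord e₂ n k t p.2)) ≤ M := by
    refine (integral_mono i₂ (hu.integrable_sq_s2 ht.le) fun p => ?_).trans hM
    exact mul_le_of_le_one_right (sq_nonneg _) ((le_abs_self _).trans (prod_le _ _))
  have split : ∫ p : ℝ × ℝ, u t p.1 p.2 ^ 2 *
      ((t ^ (-b) * bump (movingCoord e₁ m b t p.1)
        - t ^ (-β) * bump (movingCoord e₁ m β t p.1)) * bump (movingCoord e₂ n k t p.2))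
      = t ^ (-b) * (∫ p : ℝ × ℝ, u t p.1 p.2 ^ 2 *
          (bump (movingCoord e₁ m b t p.1) * bump (movingCoord e₂ n k t p.2)))
        - t ^ (-β) * ∫ p : ℝ × ℝ, u t p.1 p.2 ^ 2 *
          (bump (movingCoord e₁ m β t p.1) * bump (movingCoord e₂ n k t p.2)) := by
    rw [← integral_const_mul, ← integral_const_mul,
      ← integral_sub (i₁.const_mul _) (i₂.const_mul _)]
    congr 1 with p
    ring
  rw [split]
  have h1 := mul_le_mul_of_nonneg_left main a0.le
  have h2 := mul_le_mul_of_nonneg_left outer a0'.le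
  have h3 := neg_le_of_abs_le E₁
  have h4 := neg_le_of_abs_le E₂
  have h5 := neg_le_of_abs_le E₃
  rw [virialError]
  linarith

end IsAdmissibleZK2

theorem tendsto_const_mul_rpow_atTop_zero (c : ℝ) {x : ℝ} (hx : x < 0) :
    Tendsto (fun t : ℝ => c * t ^ x) atTop (nhds 0) := by
  have := (tendsto_rpow_neg_atTop (neg_pos.2 hx)).const_mul c
  simpa using this

theorem tendsto_virialError {m n b β k : ℝ} (hb : b ≤ β) (hm : m - 1 + (b + k) / 2 < 0)
    (h1 : b - 1 + (β + k) / 2 < 0) (hk₁ : k < 3 * b) (hk₂ : b < 3 * k)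
    (hn : n - 1 + b + (β - k) / 2 < 0) :
    Tendsto (fun t => t ^ b * virialError m n b β k t) atTop (nhds 0) := by
  have key := ((((tendsto_const_mul_rpow_atTop_zero |m|
      (show b + (m - 1 - b) + (b + k) / 2 < 0 by linarith)).add
    (tendsto_const_mul_rpow_atTop_zero |b| (show b + -1 + (b + k) / 2 < 0 by linarith))).add
    (tendsto_const_mul_rpow_atTop_zero 10
      (show b + -b + -b + -b + (b + k) / 2 < 0 by linarith))).add
    (tendsto_const_mul_rpow_atTop_zero 10
      (show b + -b + -k + -k + (b + k) / 2 < 0 by linarith))).add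
    ((((((tendsto_const_mul_rpow_atTop_zero |m|
      (show b + (m - 1 - β) + (β + k) / 2 < 0 by linarith)).add
    (tendsto_const_mul_rpow_atTop_zero |β| (show b + -1 + (β + k) / 2 < 0 by linarith))).add
    (tendsto_const_mul_rpow_atTop_zero (4 * |n|)
      (show b + (n - 1 - k) + (β + k) / 2 < 0 by linarith))).add
    (tendsto_const_mul_rpow_atTop_zero (4 * |k|)
      (show b + -1 + (β + k) / 2 < 0 by linarith))).add
    (tendsto_const_mul_rpow_atTop_zero 10
      (show b + -β + -β + -β + (β + k) / 2 < 0 by linarith))).add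
    (tendsto_const_mul_rpow_atTop_zero 10
      (show b + -β + -k + -k + (β + k) / 2 < 0 by linarith)))
  simp only [add_zero] at key
  refine key.congr' ?_
  filter_upwards [eventually_gt_atTop 0] with t ht
  simp only [virialError, movingSpeed, Real.rpow_add ht, Real.rpow_neg_one]
  ring

theorem forall_not_eventually_ge_of_deriv {F g R : ℝ → ℝ} {C : ℝ}
    (hF : ∀ᶠ t in atTop, |F t| ≤ C) (hR : Tendsto R atTop (nhds 0))
    (hd : ∀ᶠ t in atTop, ∃ F', HasDerivAt F F' t ∧ g t - R t ≤ t * F') {ε : ℝ} (hε : 0 < ε) :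
    ¬ ∀ᶠ t in atTop, ε ≤ g t := by
  intro hg
  have hR' : ∀ᶠ t in atTop, R t < ε / 2 := hR.eventually_lt_const (half_pos hε)
  obtain ⟨T, hT⟩ := eventually_atTop.1
    (hF.and (hR'.and (hd.and (hg.and (eventually_gt_atTop (0 : ℝ))))))
  have hder : ∀ t ∈ Set.Ici T, ∃ H', 0 ≤ H' ∧
      HasDerivAt (fun t => F t - ε / 2 * Real.log t) H' t := fun t ht => by
    obtain ⟨-, h2, ⟨F', h3, h4⟩, h5, h6⟩ := hT t ht
    refine ⟨_, ?_, h3.sub ((Real.hasDerivAt_log h6.ne').const_mul (ε / 2))⟩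
    rw [sub_nonneg, ← div_eq_mul_inv, div_le_iff₀ h6]
    linarith
  have hmono : MonotoneOn (fun t => F t - ε / 2 * Real.log t) (Set.Ici T) := by
    refine monotoneOn_of_deriv_nonneg (convex_Ici T)
      (fun t ht => ?_) (fun t ht => ?_) (fun t ht => ?_)
    · obtain ⟨_, -, h⟩ := hder t ht
      exact h.continuousAt.continuousWithinAt
    · obtain ⟨_, -, h⟩ := hder t (interior_subset ht)
      exact h.differentiableAt.differentiableWithinAt
    · obtain ⟨_, h0, h⟩ := hder t (interior_subset ht)
      rwa [h.deriv]
  obtain ⟨t, ht, htT⟩ := ((Real.tendsto_log_atTop.eventually_gt_atTop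
    ((2 * C + ε / 2 * Real.log T) / (ε / 2))).and (eventually_ge_atTop T)).exists
  rw [div_lt_iff₀ (half_pos hε)] at ht
  have h1 := hmono Set.self_mem_Ici htT htT
  have h2 := abs_le.1 (hT t htT).1
  have h3 := abs_le.1 (hT T le_rfl).1
  simp only at h1
  linarith

/-- Local energy decay for `L²` solutions of 2D ZK in the non-centered case:
`liminf_{t→∞} ∫_{Ω(t)} u(t,x,y)² dxdy = 0` where
`Ω(t) = {(x,y) : |x + ε₁ t^m| < t^b, |y + ε₂ t^n| < t^{br}}`. -/
theorem zk2_L2_liminf_decay_noncentered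
    (r b m n ε₁ ε₂ : ℝ) (hr₁ : 1/3 < r) (hr₂ : r < 3) (hb₁ : 0 < b) (hb₂ : b < 2/(3+r))
    (hm₁ : 0 ≤ m) (hm₂ : m < 1 - b*(1+r)/2) (hn₁ : 0 ≤ n) (hn₂ : n < 1 - b*(3-r)/2)
    (hε₁ : ε₁ = -1 ∨ ε₁ = 1) (hε₂ : ε₂ = -1 ∨ ε₂ = 1)
    (u : ℝ → ℝ → ℝ → ℝ) (hu : IsAdmissibleZK2 u)
    (hL2 : ∃ C : ℝ, ∀ t : ℝ, 2 ≤ t → (∫ p : ℝ × ℝ, (u t p.1 p.2)^2) ≤ C) :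
    Filter.liminf
      (fun t : ℝ =>
        ∫ p in {q : ℝ × ℝ | |q.1 + ε₁ * t ^ m| < t ^ b ∧ |q.2 + ε₂ * t ^ n| < t ^ (b*r)},
          (u t p.1 p.2)^2)
      Filter.atTop = 0 := by
  obtain ⟨M, hM⟩ := hL2
  have he₁ : |ε₁| = 1 := by rcases hε₁ with rfl | rfl <;> simp
  have he₂ : |ε₂| = 1 := by rcases hε₂ with rfl | rfl <;> simp
  set k := b * r
  have hbk : 3 * b + k < 2 := by
    rw [lt_div_iff₀ (by linarith)] at hb₂
    linarith
  have hk₁ : k < 3 * b := by nlinarith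
  have hk₂ : b < 3 * k := by nlinarith
  obtain ⟨β, hbβ, hβ⟩ := exists_between
    (show b < min (2 - 2 * b - k) (2 * (1 - n) - 2 * b + k) from
      lt_min (by linarith) (by linarith))
  obtain ⟨hβ₁, hβ₂⟩ := lt_min_iff.1 hβ
  have M0 : 0 ≤ M := (integral_nonneg fun p => sq_nonneg _).trans (hM 2 le_rfl)
  set g : ℝ → ℝ := fun t =>
    ∫ p in {q : ℝ × ℝ | |q.1 + ε₁ * t ^ m| < t ^ b ∧ |q.2 + ε₂ * t ^ n| < t ^ k},
      (u t p.1 p.2) ^ 2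
  have g0 : ∀ t, 0 ≤ g t := fun t => integral_nonneg fun p => sq_nonneg _
  have gM : ∀ t, 2 ≤ t → g t ≤ M := fun t ht =>
    (setIntegral_le_integral (hu.integrable_sq_s2 ht)
      (Eventually.of_forall fun p => sq_nonneg _)).trans (hM t ht)
  set κ := (M + Real.pi ^ 2) / 2
  have κ0 : 0 ≤ κ := by positivity
  set J : ℝ → ℝ := fun t => ∫ p : ℝ × ℝ, u t p.1 p.2 *
    (weightX ε₁ m b β t p.1 * bump (movingCoord ε₂ n k t p.2))
  have J_le : ∀ t, 2 ≤ t → |t ^ (b - 1) * J t| ≤ 2 * κ * t ^ (b - 1 + (β + k) / 2) :=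
    fun t ht => by
      have h0 : 0 < t := by linarith
      rw [abs_mul, abs_of_pos (Real.rpow_pos_of_pos h0 _), Real.rpow_add h0]
      have : t ^ (b - 1) * |J t| ≤ t ^ (b - 1) * (2 * t ^ ((β + k) / 2) * κ) :=
        mul_le_mul_of_nonneg_left
        (hu.abs_integral_weight_le ht (hM t ht) ε₁ ε₂ m n k hbβ.le)
        (Real.rpow_nonneg h0.le (b - 1))
      linarith
  have hF : ∀ᶠ t in atTop, |8 * (t ^ (b - 1) * J t)| ≤ 16 * κ := by
    filter_upwards [eventually_ge_atTop 2] with t ht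
    have h1 : t ^ (b - 1 + (β + k) / 2) ≤ 1 :=
      Real.rpow_le_one_of_one_le_of_nonpos (by linarith) (by linarith)
    have h2 := mul_le_mul_of_nonneg_left h1 (mul_nonneg zero_le_two κ0)
    rw [abs_mul, abs_of_pos (by norm_num : (0 : ℝ) < 8)]
    linarith [J_le t ht]
  have hR : Tendsto (fun t : ℝ => 8 * κ * (t ^ b * virialError m n b β k t)
      + (4 * M * t ^ (b - β) + 8 * |b - 1| * (2 * κ) * t ^ (b - 1 + (β + k) / 2)))
      atTop (nhds 0) := by
    have h1 := (tendsto_virialError (m := m) (n := n) hbβ.le (by linarith) (by linarith) hk₁ hk₂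
      (by linarith)).const_mul (8 * κ)
    have h2 := tendsto_const_mul_rpow_atTop_zero (4 * M) (show b - β < 0 by linarith)
    have h3 := tendsto_const_mul_rpow_atTop_zero (8 * |b - 1| * (2 * κ))
      (show b - 1 + (β + k) / 2 < 0 by linarith)
    simpa using h1.add (h2.add h3)
  have hd : ∀ᶠ t in atTop, ∃ F', HasDerivAt (fun t => 8 * (t ^ (b - 1) * J t)) F' t ∧
      g t - (8 * κ * (t ^ b * virialError m n b β k t)
        + (4 * M * t ^ (b - β) + 8 * |b - 1| * (2 * κ) * t ^ (b - 1 + (β + k) / 2)))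
      ≤ t * F' := by
    filter_upwards [eventually_gt_atTop 2] with t ht
    have h0 : 0 < t := by linarith
    obtain ⟨J', hJ', hle⟩ := hu.virial ht (hM t ht.le) he₁ he₂ m n k hbβ.le
    refine ⟨_, ((Real.hasDerivAt_rpow_const (Or.inl h0.ne')).mul hJ').const_mul 8, ?_⟩
    have e1 : t * t ^ (b - 1 - 1) = t ^ (b - 1) := by
      rw [Real.rpow_sub_one h0.ne' (b - 1)]
      field_simp
    have e2 : t * t ^ (b - 1) = t ^ b := by
      rw [Real.rpow_sub_one h0.ne' b]
      field_simp
    have e3 : t ^ b * t ^ (-b) = 1 := by rw [← Real.rpow_add h0, add_neg_cancel, Real.rpow_zero]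
    have e4 : t ^ b * t ^ (-β) = t ^ (b - β) := by rw [← Real.rpow_add h0, sub_eq_add_neg]
    have e5 : t * (8 * ((b - 1) * t ^ (b - 1 - 1) * J t + t ^ (b - 1) * J'))
        = 8 * ((b - 1) * (t ^ (b - 1) * J t)) + 8 * (t ^ b * J') := by
      rw [← e2, ← e1]
      ring
    refine le_of_le_of_eq ?_ e5.symm
    have h1 : -(|b - 1| * (2 * κ * t ^ (b - 1 + (β + k) / 2))) ≤
        (b - 1) * (t ^ (b - 1) * J t) := by
      refine neg_le_of_abs_le ?_
      rw [abs_mul]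
      exact mul_le_mul_of_nonneg_left (J_le t ht.le) (abs_nonneg _)
    have h2 : t ^ b * ((1 / 8) * t ^ (-b) * g t - virialError m n b β k t * κ
        - (1 / 2) * t ^ (-β) * M) ≤ t ^ b * J' :=
      mul_le_mul_of_nonneg_left hle (Real.rpow_nonneg h0.le b)
    have h3 : t ^ b * ((1 / 8) * t ^ (-b) * g t - virialError m n b β k t * κ
        - (1 / 2) * t ^ (-β) * M)
        = g t / 8 - κ * (t ^ b * virialError m n b β k t) - (1 / 2) * M * t ^ (b - β) := by
      rw [← e4]
      linear_combination (g t / 8) * e3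
    linarith
  have bddB : IsBoundedUnder (· ≥ ·) atTop g := isBoundedUnder_of ⟨0, g0⟩
  have bddA : IsBoundedUnder (· ≤ ·) atTop g :=
    ⟨M, eventually_map.2 ((eventually_ge_atTop 2).mono gM)⟩
  refine le_antisymm (le_of_forall_pos_le_add fun ε hε => ?_)
    (le_liminf_of_le bddA.isCoboundedUnder_ge (Eventually.of_forall g0))
  rw [zero_add]
  refine liminf_le_of_frequently_le ?_ bddB
  refine (not_eventually.1 (forall_not_eventually_ge_of_deriv hF hR hd hε)).mono fun t ht => ?_
  exact (not_le.1 ht).le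
end
end
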